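/- Let D be a domain in ℂ, let a ∈ ∂D, and let U be a connected open neighborhood of a. Then every function f ∈ L²_h(D) admits a holomorphic function F on D ∪ U with F = f on D if and only if U \ D is polar. -/

import Mathlib

open MeasureTheory Filter Metric Set

/-- `elog x` is `log x` with value `-∞` for `x ≤ 0`, as an extended real. -/
noncomputable def elog (x : ℝ) : EReal := if x ≤ 0 then ⊥ else ((Real.log x : ℝ) : EReal)

/-- The sub-mean value inequality over circles of closed discs contained in `Ω`, phrased via
continuous real-valued majorants of the (extended-real-valued) function on the circle. -/
def SubmeanOn (u : ℂ → EReal) (Ω : Set ℂ) : Prop :=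
  ∀ c : ℂ, ∀ r : ℝ, 0 < r → Metric.closedBall c r ⊆ Ω →
    ∀ φ : ℝ → ℝ, Continuous φ →
      (∀ θ : ℝ, u (c + r * Complex.exp (θ * Complex.I)) ≤ ((φ θ : ℝ) : EReal)) →
      u c ≤ (((2 * Real.pi)⁻¹ * ∫ θ in (0:ℝ)..(2 * Real.pi), φ θ : ℝ) : EReal)

/-- `u : Ω → [-∞, ∞)` is subharmonic on the open set `Ω ⊆ ℂ`: upper semicontinuous,
nowhere `+∞`, not identically `-∞` on any connected component, sub-mean value inequality. -/
def SubharmonicOn (u : ℂ → EReal) (Ω : Set ℂ) : Prop :=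
  IsOpen Ω ∧ UpperSemicontinuousOn u Ω ∧
  (∀ z ∈ Ω, u z ≠ ⊤) ∧
  (∀ z ∈ Ω, ∃ w ∈ connectedComponentIn Ω z, u w ≠ ⊥) ∧
  SubmeanOn u Ω

/-- A set `E ⊆ ℂ` is polar if some subharmonic function on an open set containing `E`
equals `-∞` on `E`. -/
def PolarSet (E : Set ℂ) : Prop :=
  ∃ Ω : Set ℂ, E ⊆ Ω ∧ ∃ u : ℂ → EReal, SubharmonicOn u Ω ∧ ∀ z ∈ E, u z = ⊥

/-- The space of square-integrable holomorphic functions on `D`. -/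
def L2h {E : Type*} [NormedAddCommGroup E] [NormedSpace ℂ E] [MeasureSpace E]
    (D : Set E) : Set (E → ℂ) :=
  {f | DifferentiableOn ℂ f D ∧ IntegrableOn (fun z => ‖f z‖ ^ 2) D volume}

/-- `D` is an `L²ₕ`-domain of holomorphy. -/
def IsL2hDomainOfHolomorphy {E : Type*} [NormedAddCommGroup E] [NormedSpace ℂ E]
    [MeasureSpace E] (D : Set E) : Prop :=
  ¬ ∃ D₀ D₁ : Set E, IsOpen D₀ ∧ IsConnected D₀ ∧ IsOpen D₁ ∧ IsConnected D₁ ∧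
      D₀ ⊆ D₁ ∩ D ∧ ¬ (D₁ ⊆ D) ∧
      ∀ f ∈ L2h D, ∃ g : E → ℂ, DifferentiableOn ℂ g D₁ ∧ Set.EqOn g f D₀

/-- The Hartogs domain `G_{D,ρ} = {(z₁,z₂) : z₁ ∈ D, |z₂| < e^{-ρ(z₁)}}`. -/
def hartogs (D : Set ℂ) (ρ : ℂ → EReal) : Set (ℂ × ℂ) :=
  {p | p.1 ∈ D ∧ elog ‖p.2‖ < - ρ p.1}

/-- `S(D)`: boundary points near which the complement of `D` is polar. -/
def polarS (D : Set ℂ) : Set ℂ :=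
  {z ∈ frontier D | ∃ U : Set ℂ, IsOpen U ∧ z ∈ U ∧ PolarSet (U \ D)}

/-- `fj` is the family of coefficients of a Hartogs expansion of `f` on `G_{D,ρ}`. -/
def HartogsExpansion (D : Set ℂ) (ρ : ℂ → EReal) (f : ℂ × ℂ → ℂ) (fj : ℕ → ℂ → ℂ) : Prop :=
  (∀ j, DifferentiableOn ℂ (fj j) D) ∧
  ∀ p ∈ hartogs D ρ, HasSum (fun j => fj j p.1 * p.2 ^ j) (f p)

/-- `ρ_f(z) = limsup_j (1/j) log |f_j(z)|` for coefficients `fj`. -/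
noncomputable def coeffGrowth (fj : ℕ → ℂ → ℂ) (z : ℂ) : EReal :=
  Filter.limsup (fun (j : ℕ) => ((((j : ℝ)⁻¹ : ℝ)) : EReal) * elog ‖fj j z‖) Filter.atTop

/-- The upper semicontinuous regularization `g*`. -/
noncomputable def uscReg (g : ℂ → EReal) (z : ℂ) : EReal := Filter.limsup g (nhds z)

/-- `ρ̃ = sup_{f ∈ L²ₕ(G_{D,ρ})} (ρ_f)*`. -/
noncomputable def rhoTilde (D : Set ℂ) (ρ : ℂ → EReal) (z : ℂ) : EReal :=
  ⨆ fj ∈ {fj : ℕ → ℂ → ℂ | ∃ f ∈ L2h (hartogs D ρ), HartogsExpansion D ρ f fj},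
    uscReg (coeffGrowth fj) z

/-- `D̂ = D ∪ {z ∈ S(D) : limsup_{D ∋ w → z} ρ(w) < ∞}`. -/
def DHat (D : Set ℂ) (ρ : ℂ → EReal) : Set ℂ :=
  D ∪ {z ∈ polarS D | Filter.limsup ρ (nhdsWithin z D) < ⊤}

open Classical in
/-- `ρ̂`, extending `ρ` to `D̂` by boundary limsups. -/
noncomputable def rhoHat (D : Set ℂ) (ρ : ℂ → EReal) (z : ℂ) : EReal :=
  if z ∈ D then ρ z else Filter.limsup ρ (nhdsWithin z D)

/-- `u` is plurisubharmonic on an open `Ω ⊆ ℂⁿ`. -/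
def PlurisubharmonicOn {n : ℕ} (u : (Fin n → ℂ) → EReal) (Ω : Set (Fin n → ℂ)) : Prop :=
  IsOpen Ω ∧ UpperSemicontinuousOn u Ω ∧
  (∀ z ∈ Ω, u z ≠ ⊤) ∧
  (∀ z ∈ Ω, ∃ w ∈ connectedComponentIn Ω z, u w ≠ ⊥) ∧
  ∀ a b : Fin n → ℂ, SubmeanOn (fun lam => u (a + lam • b)) {lam : ℂ | a + lam • b ∈ Ω}

/-- A set `E ⊆ ℂⁿ` is pluripolar. -/
def PluripolarSet {n : ℕ} (E : Set (Fin n → ℂ)) : Prop :=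
  ∃ Ω : Set (Fin n → ℂ), E ⊆ Ω ∧
    ∃ u : (Fin n → ℂ) → EReal, PlurisubharmonicOn u Ω ∧ ∀ z ∈ E, u z = ⊥

/-- `D ⊆ ℂⁿ` is pseudoconvex: it admits a plurisubharmonic exhaustion function. -/
def IsPseudoconvex {n : ℕ} (D : Set (Fin n → ℂ)) : Prop :=
  ∃ u : (Fin n → ℂ) → EReal, PlurisubharmonicOn u D ∧
    ∀ c : ℝ, IsCompact {z | z ∈ D ∧ u z ≤ (c : EReal)}

/-- `L²ₕ(D)` is infinite dimensional: arbitrarily many elements that are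
linearly independent as functions on `D`. -/
def L2hInfiniteDim {E : Type*} [NormedAddCommGroup E] [NormedSpace ℂ E] [MeasureSpace E]
    (D : Set E) : Prop :=
  ∀ N : ℕ, ∃ fs : Fin N → E → ℂ, (∀ i, fs i ∈ L2h D) ∧
    ∀ c : Fin N → ℂ, (∀ z ∈ D, ∑ i, c i * fs i z = 0) → c = 0

/-- The sup-convolution of `s` with the cone of slope `k`. -/
noncomputable def supConv (k : ℝ) (s : ℂ → ℝ) (z : ℂ) : ℝ := ⨆ w, (s w - k * ‖z - w‖)

section SupConv

variable {k : ℝ} {s : ℂ → ℝ}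

lemma supConv_bddAbove (hk : 0 ≤ k) (hs : ∀ w, s w ≤ 1) (z : ℂ) :
    BddAbove (range fun w => s w - k * ‖z - w‖) := by
  refine ⟨1, ?_⟩
  rintro _ ⟨w, rfl⟩
  have := mul_nonneg hk (norm_nonneg (z - w))
  have := hs w
  simp only
  linarith

lemma supConv_le_one (hk : 0 ≤ k) (hs : ∀ w, s w ≤ 1) (z : ℂ) : supConv k s z ≤ 1 := by
  refine ciSup_le fun w => ?_
  have := mul_nonneg hk (norm_nonneg (z - w))
  have := hs w
  linarith

lemma le_supConv' (hk : 0 ≤ k) (hs : ∀ w, s w ≤ 1) (z w : ℂ) :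
    s w - k * ‖z - w‖ ≤ supConv k s z :=
  le_ciSup (supConv_bddAbove hk hs z) w

lemma le_supConv (hk : 0 ≤ k) (hs : ∀ w, s w ≤ 1) (z : ℂ) : s z ≤ supConv k s z := by
  simpa using le_supConv' hk hs z z

lemma supConv_le_add (hk : 0 ≤ k) (hs : ∀ w, s w ≤ 1) (z z' : ℂ) :
    supConv k s z ≤ supConv k s z' + k * ‖z - z'‖ := by
  refine ciSup_le fun w => ?_
  have h1 := le_supConv' hk hs z' w
  have h2 : ‖z' - w‖ ≤ ‖z - z'‖ + ‖z - w‖ := by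
    have := norm_sub_le (z - w) (z - z')
    rw [show z - w - (z - z') = z' - w by ring] at this
    linarith
  nlinarith

lemma continuous_supConv (hk : 0 ≤ k) (hs : ∀ w, s w ≤ 1) : Continuous (supConv k s) := by
  have : LipschitzWith ⟨k, hk⟩ (supConv k s) := by
    refine LipschitzWith.of_dist_le_mul fun z z' => ?_
    rw [Real.dist_eq, dist_eq_norm, abs_le]
    have h1 := supConv_le_add hk hs z z'
    have h2 := supConv_le_add hk hs z' z
    rw [norm_sub_rev] at h2
    constructor
    · change -(k * _) ≤ _
      linarith
    · change _ ≤ k * _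
      linarith
  exact this.continuous

lemma tendsto_supConv (hs : ∀ w, s w ≤ 1) {z : ℂ} (h0 : 0 ≤ s z)
    (husc : UpperSemicontinuousAt s z) :
    Tendsto (fun n : ℕ => supConv n s z) atTop (nhds (s z)) := by
  rw [tendsto_order]
  constructor
  · intro a ha
    exact Eventually.of_forall fun n => ha.trans_le (le_supConv n.cast_nonneg hs z)
  · intro a ha
    obtain ⟨a', ha1, ha2⟩ := exists_between ha
    obtain ⟨δ, hδ, hball⟩ := Metric.eventually_nhds_iff.1 (husc a' ha1)
    obtain ⟨N, hN⟩ := exists_nat_gt (1 / δ)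
    filter_upwards [eventually_ge_atTop N] with n hn
    refine lt_of_le_of_lt (ciSup_le fun w => ?_) ha2
    have hnn : (N : ℝ) ≤ n := by exact_mod_cast hn
    by_cases hw : dist w z < δ
    · have := hball hw
      have := mul_nonneg (n.cast_nonneg (α := ℝ)) (norm_nonneg (z - w))
      linarith
    · have h1 : δ ≤ ‖z - w‖ := by
        rw [← dist_eq_norm, dist_comm]; exact not_lt.1 hw
      have h2 : 1 ≤ (n : ℝ) * ‖z - w‖ := by
        rw [div_lt_iff₀ hδ] at hN
        nlinarith
      have := hs w
      linarith

lemma supConv_eq_zero (hs : ∀ w, s w ≤ 1) {z : ℂ} {δ : ℝ} (hz : ∀ w ∈ ball z δ, s w = 0)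
    (hδ : 0 < δ) (hkδ : 1 ≤ k * δ) : supConv k s z = 0 := by
  have hk : 0 ≤ k := by
    by_contra h
    push Not at h
    nlinarith
  apply le_antisymm
  · refine ciSup_le fun w => ?_
    by_cases hw : w ∈ ball z δ
    · rw [hz w hw]
      have := mul_nonneg hk (norm_nonneg (z - w))
      linarith
    · have h1 : δ ≤ ‖z - w‖ := by
        rw [mem_ball, dist_comm, dist_eq_norm] at hw; exact not_lt.1 hw
      have := hs w
      nlinarith
  · rw [← hz z (mem_ball_self hδ)]
    exact le_supConv hk hs z

/-- The sub-mean value inequality on one circle, for a real-valued function, phrased via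
continuous majorants. -/
def MajorantSubmean (s : ℂ → ℝ) (c : ℂ) (r : ℝ) : Prop :=
  ∀ φ : ℝ → ℝ, Continuous φ → (∀ θ : ℝ, s (c + r * Complex.exp (θ * Complex.I)) ≤ φ θ) →
    s c ≤ (2 * Real.pi)⁻¹ * ∫ θ in (0:ℝ)..(2 * Real.pi), φ θ

lemma supConv_submean (hk : 0 < k) (hs : ∀ w, s w ≤ 1) (hs0 : ∀ w, 0 ≤ s w) {c : ℂ} {r : ℝ}
    (hsub : ∀ c' ∈ closedBall c (1 / k), MajorantSubmean s c' r) :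
    supConv k s c ≤
      (2 * Real.pi)⁻¹ * ∫ θ in (0:ℝ)..(2 * Real.pi),
        supConv k s (c + r * Complex.exp (θ * Complex.I)) := by
  have hcont := continuous_supConv hk.le hs
  have hcirc : Continuous fun θ : ℝ => supConv k s (c + r * Complex.exp (θ * Complex.I)) := by
    fun_prop
  refine ciSup_le fun w => ?_
  by_cases hw : w ∈ closedBall c (1 / k)
  · have := hsub w hw
      (fun θ => supConv k s (c + r * Complex.exp (θ * Complex.I)) + k * ‖c - w‖)
      (by fun_prop) (fun θ => by
        have := le_supConv' hk.le hs (c + r * Complex.exp (θ * Complex.I))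
          (w + r * Complex.exp (θ * Complex.I))
        rw [add_sub_add_right_eq_sub] at this
        linarith)
    rw [intervalIntegral.integral_add (hcirc.intervalIntegrable _ _) (by simp)] at this
    simp only [intervalIntegral.integral_const, sub_zero, smul_eq_mul, mul_add] at this
    rw [inv_mul_cancel_left₀ (by positivity)] at this
    linarith
  · have h1 : 1 / k < ‖c - w‖ := by
      rw [mem_closedBall, dist_comm, dist_eq_norm] at hw; exact not_le.1 hw
    rw [div_lt_iff₀ hk] at h1
    have h2 : 0 ≤ (2 * Real.pi)⁻¹ * ∫ θ in (0:ℝ)..(2 * Real.pi),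
        supConv k s (c + r * Complex.exp (θ * Complex.I)) :=
      mul_nonneg (by positivity) (intervalIntegral.integral_nonneg (by positivity)
        fun θ _ => (hs0 _).trans (le_supConv hk.le hs _))
    have := hs w
    linarith

end SupConv

open Classical in
/-- The truncation `max (1 + (u - M) / n) 0` of `u` on `B`, extended by `0`. -/
noncomputable def truncFn (u : ℂ → EReal) (B : Set ℂ) (M n : ℝ) (z : ℂ) : ℝ :=
  if z ∈ B ∧ u z ≠ ⊥ then max (1 + ((u z).toReal - M) / n) 0 else 0

section Trunc

variable {u : ℂ → EReal} {B Ω : Set ℂ} {M n : ℝ}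

lemma truncFn_nonneg (z : ℂ) : 0 ≤ truncFn u B M n z := by
  unfold truncFn; split_ifs
  · exact le_max_right _ _
  · exact le_rfl

lemma le_of_truncFn (hn : 0 < n) (hM : ∀ z ∈ B, u z ≤ (M : EReal)) {z : ℂ} (hz : z ∈ B) {x : ℝ}
    (hx : truncFn u B M n z ≤ x) : u z ≤ ((n * (x - 1) + M : ℝ) : EReal) := by
  by_cases h : u z = ⊥
  · simp [h]
  have ht : u z ≠ ⊤ := ((hM z hz).trans_lt (EReal.coe_lt_top _)).ne
  rw [truncFn, if_pos ⟨hz, h⟩] at hx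
  have h1 := (le_max_left _ _).trans hx
  rw [← EReal.coe_toReal ht h, EReal.coe_le_coe_iff]
  have h2 : ((u z).toReal - M) / n ≤ x - 1 := by linarith
  rw [div_le_iff₀ hn] at h2
  linarith

lemma truncFn_le (hn : 0 < n) (hM : ∀ z ∈ B, u z ≤ (M : EReal)) {z : ℂ} {x : ℝ} (hx0 : 0 ≤ x)
    (hx : z ∈ B → u z ≤ ((n * (x - 1) + M : ℝ) : EReal)) : truncFn u B M n z ≤ x := by
  unfold truncFn
  split_ifs with h
  · obtain ⟨hz, h⟩ := h
    have ht : u z ≠ ⊤ := ((hM z hz).trans_lt (EReal.coe_lt_top _)).ne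
    have h2 := hx hz
    rw [← EReal.coe_toReal ht h, EReal.coe_le_coe_iff] at h2
    refine max_le ?_ hx0
    have h2 : ((u z).toReal - M) / n ≤ x - 1 := by
      rw [div_le_iff₀ hn]; linarith
    linarith
  · exact hx0

lemma truncFn_le_one (hn : 0 < n) (hM : ∀ z ∈ B, u z ≤ (M : EReal)) (z : ℂ) :
    truncFn u B M n z ≤ 1 :=
  truncFn_le hn hM zero_le_one fun hz => by simpa using hM z hz

lemma truncFn_majorantSubmean (hn : 0 < n) (hM : ∀ z ∈ B, u z ≤ (M : EReal))
    (hu : SubmeanOn u Ω) (hB : B ⊆ Ω) {c : ℂ} {r : ℝ} (hr : 0 < r) (hc : closedBall c r ⊆ B) :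
    MajorantSubmean (truncFn u B M n) c r := by
  intro φ hφ hle
  have hmem : ∀ θ : ℝ, c + r * Complex.exp (θ * Complex.I) ∈ B := fun θ => hc (by
    simp [Complex.norm_exp_ofReal_mul_I, abs_of_pos hr])
  refine truncFn_le hn hM (mul_nonneg (by positivity)
    (intervalIntegral.integral_nonneg (by positivity)
      fun θ _ => (truncFn_nonneg _).trans (hle θ))) fun _ => ?_
  have h := hu c r hr (hc.trans hB) (fun θ => n * (φ θ - 1) + M) (by fun_prop)
    fun θ => le_of_truncFn hn hM (hmem θ) (hle θ)
  refine h.trans_eq ?_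
  congr 1
  have hi : IntervalIntegrable φ volume 0 (2 * Real.pi) := hφ.intervalIntegrable _ _
  rw [intervalIntegral.integral_add ((hi.sub (by simp)).const_mul n) (by simp),
    intervalIntegral.integral_const_mul, intervalIntegral.integral_sub hi (by simp)]
  simp only [intervalIntegral.integral_const, sub_zero, smul_eq_mul]
  field_simp

lemma truncFn_usc (hn : 0 < n) (hM : ∀ z ∈ B, u z ≤ (M : EReal)) (hBo : IsOpen B)
    (hu : UpperSemicontinuousOn u B) {z : ℂ} (hz : z ∈ B) :
    UpperSemicontinuousAt (truncFn u B M n) z := by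
  intro x hx
  obtain ⟨y, hy1, hy2⟩ := exists_between hx
  have h1 : u z < ((n * (y - 1) + M : ℝ) : EReal) := by
    refine (le_of_truncFn hn hM hz le_rfl).trans_lt ?_
    rw [EReal.coe_lt_coe_iff]
    nlinarith
  have h2 := hu z hz _ h1
  rw [hBo.nhdsWithin_eq hz] at h2
  filter_upwards [h2] with w hw
  exact (truncFn_le hn hM ((truncFn_nonneg z).trans hy1.le) fun _ => hw.le).trans_lt hy2

lemma tendsto_truncFn {z : ℂ} (hz : z ∈ B) :
    Tendsto (fun n : ℕ => truncFn u B M (n + 1) z) atTop (nhds ({z | u z ≠ ⊥}.indicator 1 z)) := by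
  by_cases h : u z = ⊥
  · simp [truncFn, h]
  · have h' : z ∈ {z | u z ≠ ⊥} := h
    simp only [truncFn, hz, h, ne_eq, not_false_eq_true, and_self, if_true, indicator_of_mem h',
      Pi.one_apply]
    have h1 : Tendsto (fun n : ℕ => 1 + ((u z).toReal - M) / ((n : ℝ) + 1)) atTop
        (nhds (1 + 0)) := by
      refine tendsto_const_nhds.add ?_
      have := tendsto_one_div_add_atTop_nhds_zero_nat (𝕜 := ℝ)
      simpa [div_eq_mul_inv] using this.const_mul ((u z).toReal - M)
    have h2 := h1.max (tendsto_const_nhds (x := (0:ℝ)))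
    simpa using h2

lemma truncFn_submean_average (hn : 0 < n) {z : ℂ} {R r : ℝ} (hr : 0 < r) (hrR : r < R)
    (hM : ∀ w ∈ ball z R, u w ≤ (M : EReal)) (hΩ : ball z R ⊆ Ω)
    (husc : UpperSemicontinuousOn u Ω) (hu : SubmeanOn u Ω) :
    AEStronglyMeasurable (fun θ : ℝ => truncFn u (ball z R) M n (z + r * Complex.exp (θ * Complex.I)))
      volume ∧
    truncFn u (ball z R) M n z ≤ (2 * Real.pi)⁻¹ * ∫ θ in (0:ℝ)..(2 * Real.pi),
        truncFn u (ball z R) M n (z + r * Complex.exp (θ * Complex.I)) := by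
  set s := truncFn u (ball z R) M n with hs
  have hs1 : ∀ w, s w ≤ 1 := truncFn_le_one hn hM
  have hs0 : ∀ w, 0 ≤ s w := truncFn_nonneg
  have hmem : ∀ θ : ℝ, z + r * Complex.exp (θ * Complex.I) ∈ ball z R := fun θ => by
    simpa [Complex.norm_exp_ofReal_mul_I, abs_of_pos hr] using hrR
  have hcont : ∀ k : ℕ, Continuous fun θ : ℝ => supConv k s (z + r * Complex.exp (θ * Complex.I)) :=
    fun k => (continuous_supConv k.cast_nonneg hs1).comp (by fun_prop)
  have hlim : ∀ θ : ℝ, Tendsto (fun k : ℕ => supConv k s (z + r * Complex.exp (θ * Complex.I)))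
      atTop (nhds (s (z + r * Complex.exp (θ * Complex.I)))) := fun θ =>
    tendsto_supConv hs1 (hs0 _) (truncFn_usc hn hM isOpen_ball (husc.mono hΩ) (hmem θ))
  refine ⟨aestronglyMeasurable_of_tendsto_ae atTop (fun k => (hcont k).aestronglyMeasurable)
    (Eventually.of_forall hlim), ?_⟩
  have hint : Tendsto (fun k : ℕ => (2 * Real.pi)⁻¹ * ∫ θ in (0:ℝ)..(2 * Real.pi),
      supConv k s (z + r * Complex.exp (θ * Complex.I))) atTop
      (nhds ((2 * Real.pi)⁻¹ * ∫ θ in (0:ℝ)..(2 * Real.pi),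
        s (z + r * Complex.exp (θ * Complex.I)))) := by
    refine Tendsto.const_mul _ (intervalIntegral.tendsto_integral_filter_of_dominated_convergence
      (fun _ => 1) (Eventually.of_forall fun k => (hcont k).aestronglyMeasurable)
      (Eventually.of_forall fun k => Eventually.of_forall fun θ _ => ?_) (by simp)
      (Eventually.of_forall fun θ _ => hlim θ))
    rw [Real.norm_eq_abs, abs_of_nonneg ((hs0 _).trans (le_supConv k.cast_nonneg hs1 _))]
    exact supConv_le_one k.cast_nonneg hs1 _
  refine ge_of_tendsto hint ?_
  obtain ⟨N, hN⟩ := exists_nat_gt (1 / (R - r))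
  filter_upwards [eventually_ge_atTop (N + 1)] with k hk
  have hk0 : (0 : ℝ) < k := by exact_mod_cast (Nat.succ_pos N).trans_le hk
  have hkR : 1 / (k : ℝ) < R - r := by
    have : (N : ℝ) ≤ k := by exact_mod_cast (Nat.le_succ N).trans hk
    rw [div_lt_comm₀ hk0 (by linarith)]
    linarith
  refine (le_supConv hk0.le hs1 z).trans (supConv_submean hk0 hs1 hs0 fun c' hc' => ?_)
  refine truncFn_majorantSubmean hn hM hu hΩ hr fun w hw => ?_
  rw [mem_closedBall] at hc' hw
  rw [mem_ball]
  linarith [dist_triangle w c' z]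

lemma ae_circle_ne_bot {z : ℂ} {R r : ℝ} (hr : 0 < r) (hrR : r < R)
    (hM : ∀ w ∈ ball z R, u w ≤ (M : EReal)) (hΩ : ball z R ⊆ Ω)
    (husc : UpperSemicontinuousOn u Ω) (hu : SubmeanOn u Ω) (hz : u z ≠ ⊥) :
    ∀ᵐ θ : ℝ ∂(volume.restrict (Ioc 0 (2 * Real.pi))),
      u (z + r * Complex.exp (θ * Complex.I)) ≠ ⊥ := by
  have hmem : ∀ θ : ℝ, z + r * Complex.exp (θ * Complex.I) ∈ ball z R := fun θ => by
    simpa [Complex.norm_exp_ofReal_mul_I, abs_of_pos hr] using hrR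
  have hn : ∀ n : ℕ, (0 : ℝ) < n + 1 := fun n => by positivity
  have hav := fun n : ℕ => truncFn_submean_average (hn n) hr hrR hM hΩ husc hu
  set v : ℝ → ℝ := fun θ => {z | u z ≠ ⊥}.indicator 1 (z + r * Complex.exp (θ * Complex.I)) with hv
  have hlim : ∀ θ : ℝ, Tendsto (fun n : ℕ => truncFn u (ball z R) M (n + 1)
      (z + r * Complex.exp (θ * Complex.I))) atTop (nhds (v θ)) := fun θ => tendsto_truncFn (hmem θ)
  have hvm : AEStronglyMeasurable v volume := aestronglyMeasurable_of_tendsto_ae atTop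
    (fun n => (hav n).1) (Eventually.of_forall hlim)
  have hint : Tendsto (fun n : ℕ => (2 * Real.pi)⁻¹ * ∫ θ in (0:ℝ)..(2 * Real.pi),
      truncFn u (ball z R) M (n + 1) (z + r * Complex.exp (θ * Complex.I))) atTop
      (nhds ((2 * Real.pi)⁻¹ * ∫ θ in (0:ℝ)..(2 * Real.pi), v θ)) := by
    refine Tendsto.const_mul _ (intervalIntegral.tendsto_integral_filter_of_dominated_convergence
      (fun _ => 1) (Eventually.of_forall fun n => (hav n).1.restrict)
      (Eventually.of_forall fun n => Eventually.of_forall fun θ _ => ?_) (by simp)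
      (Eventually.of_forall fun θ _ => hlim θ))
    rw [Real.norm_eq_abs, abs_of_nonneg (truncFn_nonneg _)]
    exact truncFn_le_one (hn n) hM _
  have h0 := tendsto_truncFn (u := u) (M := M) (mem_ball_self (x := z) (hr.trans hrR))
  have h1 : (1 : ℝ) ≤ (2 * Real.pi)⁻¹ * ∫ θ in (0:ℝ)..(2 * Real.pi), v θ := by
    have := le_of_tendsto_of_tendsto' h0 hint fun n => (hav n).2
    simpa [hz] using this
  have hv1 : ∀ θ, v θ ≤ 1 := fun θ => by
    simp only [hv]; exact indicator_le_self' (fun _ _ => zero_le_one) _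
  have hv0 : ∀ θ, 0 ≤ v θ := fun θ => by
    simp only [hv]; exact indicator_nonneg (fun _ _ => zero_le_one) _
  have hvi : IntegrableOn v (Ioc 0 (2 * Real.pi)) volume := by
    refine Integrable.mono' (g := fun _ => (1:ℝ)) (by simp) hvm.restrict
      (Eventually.of_forall fun θ => ?_)
    rw [Real.norm_eq_abs, abs_of_nonneg (hv0 θ)]
    exact hv1 θ
  have h2 : ∫ θ in Ioc 0 (2 * Real.pi), (1 - v θ) = 0 := by
    apply le_antisymm
    · rw [integral_sub (by simp) hvi, ← intervalIntegral.integral_of_le (by positivity) (f := v)]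
      rw [inv_mul_eq_div, le_div_iff₀ (by positivity)] at h1
      simp [Real.pi_pos.le] at h1 ⊢
      linarith
    · exact integral_nonneg fun θ => sub_nonneg.2 (hv1 θ)
  rw [integral_eq_zero_iff_of_nonneg (fun θ => sub_nonneg.2 (hv1 θ))
    ((integrable_const 1).sub hvi)] at h2
  filter_upwards [h2] with θ hθ hbot
  simp [hv, hbot] at hθ

end Trunc

lemma measurableSet_bot_of_usc {u : ℂ → EReal} {Ω : Set ℂ} (hΩ : IsOpen Ω)
    (husc : UpperSemicontinuousOn u Ω) : MeasurableSet {z | z ∈ Ω ∧ u z = ⊥} := by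
  have : {z | z ∈ Ω ∧ u z = ⊥} = ⋂ n : ℕ, {z | z ∈ Ω ∧ u z < ((-(n : ℝ) : ℝ) : EReal)} := by
    ext z
    simp only [mem_ofPred_eq, mem_iInter]
    constructor
    · rintro ⟨h1, h2⟩ n
      exact ⟨h1, h2 ▸ EReal.bot_lt_coe _⟩
    · intro h
      refine ⟨(h 0).1, ?_⟩
      rw [EReal.eq_bot_iff_forall_lt]
      intro y
      obtain ⟨n, hn⟩ := exists_nat_gt (-y)
      refine (h n).2.trans ?_
      rw [EReal.coe_lt_coe_iff]
      linarith
  rw [this]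
  refine MeasurableSet.iInter fun n => IsOpen.measurableSet ?_
  rw [isOpen_iff_mem_nhds]
  rintro z ⟨hz, hlt⟩
  have h := husc z hz _ hlt
  rw [hΩ.nhdsWithin_eq hz] at h
  filter_upwards [h, hΩ.mem_nhds hz] with w hw hw'
  exact ⟨hw', hw⟩

lemma volume_bot_ball {u : ℂ → EReal} {Ω : Set ℂ} {M : ℝ} {z : ℂ} {R : ℝ} 
    (hM : ∀ w ∈ ball z R, u w ≤ (M : EReal)) (hΩ : ball z R ⊆ Ω)
    (husc : UpperSemicontinuousOn u Ω) (hu : SubmeanOn u Ω) (hz : u z ≠ ⊥) :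
    volume {w | w ∈ ball z R ∧ u w = ⊥} = 0 := by
  set N := {w | w ∈ ball z R ∧ u w = ⊥} with hN
  have hNm : MeasurableSet N := measurableSet_bot_of_usc isOpen_ball (husc.mono hΩ)
  have h1 : volume N = ∫⁻ w, N.indicator 1 (z + w) := by
    rw [lintegral_add_left_eq_self (fun w => N.indicator (1 : ℂ → ENNReal) w) z,
      lintegral_indicator_one hNm]
  rw [h1, ← Complex.lintegral_comp_polarCoord_symm]
  have hmeas : Measurable fun p : ℝ × ℝ => z + Complex.polarCoord.symm p := by
    simp only [Complex.polarCoord_symm_apply]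
    fun_prop
  have h2 : volume ((fun p : ℝ × ℝ => z + Complex.polarCoord.symm p) ⁻¹' N ∩
      polarCoord.target) = 0 := by
    rw [polarCoord_target, Measure.volume_eq_prod, Measure.measure_prod_null
      ((hmeas hNm).inter (measurableSet_Ioi.prod measurableSet_Ioo))]
    refine Eventually.of_forall fun r => ?_
    by_cases hr : 0 < r ∧ r < R
    · have h3 := ae_circle_ne_bot hr.1 hr.2 hM hΩ husc hu hz
      rw [ae_restrict_iff' measurableSet_Ioc] at h3
      have h4 := (measurePreserving_add_right (volume : Measure ℝ)
        (2 * Real.pi)).quasiMeasurePreserving.ae h3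
      change volume _ = 0
      rw [measure_eq_zero_iff_ae_notMem]
      filter_upwards [h3, h4] with θ h3 h4
      rintro ⟨⟨-, hbot⟩, -, hθ1, hθ2⟩
      simp only [Complex.polarCoord_symm_apply] at hbot
      rw [Complex.ofReal_cos, Complex.ofReal_sin, ← Complex.exp_mul_I] at hbot
      by_cases hpos : 0 < θ
      · exact h3 ⟨hpos, by linarith [Real.pi_pos]⟩ hbot
      · refine h4 ⟨by linarith [Real.pi_pos], by linarith⟩ ?_
        rw [← hbot]
        congr 3
        push_cast
        rw [add_mul, Complex.exp_add, Complex.exp_two_pi_mul_I, mul_one]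
    · refine (measure_mono (t := ∅) ?_).antisymm (by simp) |>.trans (by simp)
      rintro θ ⟨⟨hb, -⟩, hr0, -⟩
      apply hr
      refine ⟨hr0, ?_⟩
      rw [mem_ball, dist_eq_norm, add_sub_cancel_left, Complex.norm_polarCoord_symm,
        abs_of_pos hr0] at hb
      exact hb
  rw [← nonpos_iff_eq_zero]
  calc ∫⁻ p in polarCoord.target, ENNReal.ofReal p.1 • N.indicator (1 : ℂ → ENNReal)
        (z + Complex.polarCoord.symm p) = ∫⁻ p in polarCoord.target, 0 := by
        refine lintegral_congr_ae ?_
        rw [EventuallyEq, ae_restrict_iff' polarCoord.open_target.measurableSet]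
        filter_upwards [measure_eq_zero_iff_ae_notMem.1 h2] with p hp hpt
        rw [indicator_of_notMem, smul_zero]
        exact fun h => hp ⟨h, hpt⟩
    _ ≤ 0 := by simp

lemma SubharmonicOn.exists_ball_le {u : ℂ → EReal} {Ω : Set ℂ} (hu : SubharmonicOn u Ω)
    {z : ℂ} (hz : z ∈ Ω) : ∃ R > 0, ∃ M : ℝ, ball z R ⊆ Ω ∧ ∀ w ∈ ball z R, u w ≤ (M : EReal) := by
  obtain ⟨hΩ, husc, htop, -, -⟩ := hu
  obtain ⟨M, hM, -⟩ := EReal.lt_iff_exists_real_btwn.1 (htop z hz).lt_top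
  have h := husc z hz _ hM
  rw [hΩ.nhdsWithin_eq hz] at h
  obtain ⟨R, hR, hball⟩ := Metric.mem_nhds_iff.1 (h.and (hΩ.mem_nhds hz))
  exact ⟨R, hR, M, fun w hw => (hball hw).2, fun w hw => (hball hw).1.le⟩

lemma SubharmonicOn.volume_bot {u : ℂ → EReal} {Ω : Set ℂ} (hu : SubharmonicOn u Ω) :
    volume {z | z ∈ Ω ∧ u z = ⊥} = 0 := by
  set A := {z | z ∈ Ω ∧ ∃ ε > 0, volume {w | w ∈ ball z ε ∧ u w = ⊥} = 0} with hA
  have hmono : ∀ {s t : Set ℂ}, s ⊆ t → volume {w | w ∈ t ∧ u w = ⊥} = 0 →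
      volume {w | w ∈ s ∧ u w = ⊥} = 0 := fun hst h =>
    measure_mono_null (by rintro w ⟨h1, h2⟩; exact ⟨hst h1, h2⟩) h
  have hAo : IsOpen A := by
    rw [Metric.isOpen_iff]
    rintro z ⟨hz, ε, hε, hv⟩
    obtain ⟨δ, hδ, hδΩ⟩ := Metric.isOpen_iff.1 hu.1 z hz
    refine ⟨min δ ε, lt_min hδ hε, fun w hw => ⟨hδΩ (ball_subset_ball (min_le_left _ _) hw),
      ε - dist w z, ?_, hmono (fun x hx => ?_) hv⟩⟩
    · have := (mem_ball.1 hw).trans_le (min_le_right _ _)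
      linarith
    · rw [mem_ball] at hx ⊢
      linarith [dist_triangle x w z]
  have key : ∀ z ∈ Ω, (∃ᶠ w in nhds z, u w ≠ ⊥) → z ∈ A := by
    intro z hz hfr
    obtain ⟨R, hR, M, hRΩ, hM⟩ := hu.exists_ball_le hz
    obtain ⟨y, hy, hyz⟩ := (hfr.and_eventually (ball_mem_nhds z (half_pos hR))).exists
    have hsub : ball y (R / 2) ⊆ ball z R := ball_subset_ball' (by linarith)
    have := volume_bot_ball (fun w hw => hM w (hsub hw)) (hsub.trans hRΩ) hu.2.1 hu.2.2.2.2 hy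
    exact ⟨hz, R / 2 - dist y z, by linarith, hmono (ball_subset_ball' (by rw [dist_comm]; linarith)) this⟩
  have hAΩ : ∀ z ∈ Ω, z ∈ A := by
    intro z hz
    obtain ⟨w, hw, hwb⟩ := hu.2.2.2.1 z hz
    have hsub := connectedComponentIn_subset Ω z
    refine isPreconnected_connectedComponentIn.subset_of_closure_inter_subset hAo
      ⟨w, hw, key w (hsub hw) ?_⟩ ?_ (mem_connectedComponentIn hz)
    · exact fun h => h.self_of_nhds hwb
    · rintro x ⟨hxA, hxC⟩
      refine key x (hsub hxC) ?_
      rw [frequently_iff]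
      intro V hV
      obtain ⟨y, ⟨hyV, -, ε, hε, hy⟩⟩ := mem_closure_iff_nhds.1 hxA _ (interior_mem_nhds.2 hV)
      obtain ⟨δ, hδ, hδV⟩ := Metric.isOpen_iff.1 isOpen_interior y hyV
      by_contra hcon
      push Not at hcon
      have : volume (ball y (min δ ε)) = 0 := by
        refine measure_mono_null (t := {w | w ∈ ball y ε ∧ u w = ⊥}) ?_ hy
        intro v hv
        refine ⟨ball_subset_ball (min_le_right _ _) hv, ?_⟩
        exact hcon v (interior_subset (hδV (ball_subset_ball (min_le_left _ _) hv)))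
      exact (measure_ball_pos volume y (lt_min hδ hε)).ne' this
  refine measure_null_of_locally_null _ fun z hz => ?_
  obtain ⟨-, ε, hε, hv⟩ := hAΩ z hz.1
  refine ⟨_, inter_mem_nhdsWithin _ (ball_mem_nhds z hε), measure_mono_null ?_ hv⟩
  rintro w ⟨h1, h2⟩
  exact ⟨h2, h1.2⟩

lemma exists_capacity_cutoff {u : ℂ → EReal} {Ω : Set ℂ} (hu : SubharmonicOn u Ω) {b : ℂ}
    {R R₁ M : ℝ} (hR : R₁ < R) (hΩ : ball b R ⊆ Ω) (hM : ∀ w ∈ ball b R, u w ≤ (M : EReal))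
    {K : Set ℂ} (hK : IsCompact K) (hKb : K ⊆ ball b R) (hKu : ∀ z ∈ K, u z = ⊥)
    {ε : ℝ} (hε : 0 < ε) :
    ∃ t : ℂ → ℝ, Continuous t ∧ (∀ z, 0 ≤ t z) ∧ (∀ z, t z ≤ 1) ∧
      (∃ δ > (0:ℝ), ∀ z, (∃ w ∈ K, dist z w < δ) → t z = 0) ∧
      (∃ δ > (0:ℝ), ∀ r : ℝ, 0 < r → r < δ → ∀ c ∈ ball b R₁, t c ≤
        (2 * Real.pi)⁻¹ * ∫ θ in (0:ℝ)..(2 * Real.pi), t (c + r * Complex.exp (θ * Complex.I))) ∧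
      ∫ z in ball b R, (1 - t z) < ε := by
  have hn : ∀ n : ℕ, (0 : ℝ) < n + 1 := fun n => by positivity
  have hs1 : ∀ (n : ℕ) w, truncFn u (ball b R) M (n + 1) w ≤ 1 := fun n => truncFn_le_one (hn n) hM
  have hs0 : ∀ (n : ℕ) w, 0 ≤ truncFn u (ball b R) M (n + 1) w := fun n => truncFn_nonneg
  have husc := hu.2.1.mono hΩ
  have hlimk : ∀ n : ℕ, ∀ᵐ z ∂volume.restrict (ball b R), Tendsto
      (fun k : ℕ => supConv k (truncFn u (ball b R) M (n + 1)) z) atTop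
      (nhds (truncFn u (ball b R) M (n + 1) z)) := fun n => by
    filter_upwards [ae_restrict_mem measurableSet_ball] with z hz
    exact tendsto_supConv (hs1 n) (hs0 n z) (truncFn_usc (hn n) hM isOpen_ball husc hz)
  have hcont : ∀ n k : ℕ, Continuous (supConv k (truncFn u (ball b R) M (n + 1))) :=
    fun n k => continuous_supConv k.cast_nonneg (hs1 n)
  have hsm : ∀ n : ℕ, AEStronglyMeasurable (truncFn u (ball b R) M (n + 1))
      (volume.restrict (ball b R)) := fun n =>
    aestronglyMeasurable_of_tendsto_ae atTop (fun k => (hcont n k).aestronglyMeasurable) (hlimk n)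
  have hfin : IsFiniteMeasure (volume.restrict (ball b R)) :=
    ⟨by rw [Measure.restrict_apply_univ]; exact measure_ball_lt_top⟩
  have hnull : ∀ᵐ z ∂volume.restrict (ball b R), u z ≠ ⊥ := by
    rw [ae_restrict_iff' measurableSet_ball]
    filter_upwards [measure_eq_zero_iff_ae_notMem.1 hu.volume_bot] with z hz hzb hbot
    exact hz ⟨hΩ hzb, hbot⟩
  have hlim1 : Tendsto (fun n : ℕ => ∫ z in ball b R, (1 - truncFn u (ball b R) M (n + 1) z)) atTop
      (nhds (∫ z in ball b R, (0:ℝ))) := by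
    refine tendsto_integral_of_dominated_convergence (fun _ => 1)
      (fun n => (aestronglyMeasurable_const.sub (hsm n))) (integrable_const _)
      (fun n => Eventually.of_forall fun z => ?_) ?_
    · rw [Real.norm_eq_abs, abs_of_nonneg (sub_nonneg.2 (hs1 n z))]
      linarith [hs0 n z]
    · filter_upwards [hnull, ae_restrict_mem measurableSet_ball] with z hz hzb
      have := (tendsto_truncFn (u := u) (M := M) hzb).const_sub 1
      simpa [hz] using this
  rw [integral_zero] at hlim1
  obtain ⟨n, hnε⟩ := (hlim1.eventually_lt_const hε).exists
  set s := truncFn u (ball b R) M (n + 1) with hs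
  have hlim2 : Tendsto (fun k : ℕ => ∫ z in ball b R, (1 - supConv k s z)) atTop
      (nhds (∫ z in ball b R, (1 - s z))) := by
    refine tendsto_integral_of_dominated_convergence (fun _ => 1)
      (fun k => (continuous_const.sub (hcont n k)).aestronglyMeasurable) (integrable_const _)
      (fun k => Eventually.of_forall fun z => ?_) ?_
    · rw [Real.norm_eq_abs, abs_of_nonneg (sub_nonneg.2 (supConv_le_one k.cast_nonneg (hs1 n) z))]
      linarith [hs0 n z, le_supConv (k.cast_nonneg (α := ℝ)) (hs1 n) z]
    · filter_upwards [hlimk n] with z hz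
      exact hz.const_sub 1
  have hVo : IsOpen {w | w ∈ ball b R ∧ u w < ((M - (n + 1) : ℝ) : EReal)} := by
    rw [isOpen_iff_mem_nhds]
    rintro z ⟨hz, hlt⟩
    have h := husc z hz _ hlt
    rw [isOpen_ball.nhdsWithin_eq hz] at h
    filter_upwards [h, isOpen_ball.mem_nhds hz] with w hw hw'
    exact ⟨hw', hw⟩
  obtain ⟨δ, hδ, hδV⟩ := hK.exists_thickening_subset_open hVo
    fun z hz => ⟨hKb hz, by rw [hKu z hz]; exact EReal.bot_lt_coe _⟩
  obtain ⟨N₁, hN₁⟩ := exists_nat_gt (2 / δ)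
  obtain ⟨N₂, hN₂⟩ := exists_nat_gt (2 / (R - R₁))
  obtain ⟨k, hk1, hk2⟩ := ((hlim2.eventually_lt_const hnε).and
    (eventually_ge_atTop (max N₁ N₂ + 1))).exists
  have hk0 : (0 : ℝ) < k := by exact_mod_cast (Nat.succ_pos _).trans_le hk2
  have hkN₁ : (N₁ : ℝ) ≤ k := by
    exact_mod_cast (le_max_left _ _).trans ((Nat.le_succ _).trans hk2)
  have hkN₂ : (N₂ : ℝ) ≤ k := by
    exact_mod_cast (le_max_right _ _).trans ((Nat.le_succ _).trans hk2)
  refine ⟨supConv k s, hcont n k, fun z => (hs0 n z).trans (le_supConv hk0.le (hs1 n) z),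
    supConv_le_one hk0.le (hs1 n), ⟨δ / 2, half_pos hδ, ?_⟩, ⟨(R - R₁) / 2, by linarith, ?_⟩, hk1⟩
  · rintro z ⟨w, hwK, hwz⟩
    refine supConv_eq_zero (δ := δ / 2) (hs1 n) (fun v hv => ?_) (half_pos hδ) ?_
    · have hvV := hδV (mem_thickening_iff.2 ⟨w, hwK, (by
        linarith [dist_triangle v z w, mem_ball.1 hv] : dist v w < δ)⟩)
      refine le_antisymm (truncFn_le (hn n) hM le_rfl fun _ => ?_) (hs0 n v)
      refine hvV.2.le.trans (EReal.coe_le_coe_iff.2 ?_)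
      linarith
    · have := hN₁.trans_le hkN₁
      rw [div_lt_iff₀ hδ] at this
      linarith
  · intro r hr hrδ c hc
    refine supConv_submean hk0 (hs1 n) (hs0 n) fun c' hc' => ?_
    refine truncFn_majorantSubmean (hn n) hM hu.2.2.2.2 hΩ hr fun w hw => ?_
    have hk3 : 1 / (k : ℝ) < (R - R₁) / 2 := by
      have := hN₂.trans_le hkN₂
      rw [div_lt_iff₀ (by linarith)] at this
      rw [div_lt_iff₀ hk0]
      linarith
    rw [mem_closedBall] at hc' hw
    rw [mem_ball] at hc ⊢
    linarith [dist_triangle w c' c, dist_triangle w c b]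

/-- The product of the angular measure on `(0, 2π]` with Lebesgue measure on `ℂ`. -/
noncomputable def angleProd : Measure (ℝ × ℂ) :=
  ((volume : Measure ℝ).restrict (Ioc 0 (2 * Real.pi))).prod volume

section AngleProd

lemma measurePreserving_circleShift (r : ℝ) :
    MeasurePreserving (fun p : ℝ × ℂ => (p.1, p.2 + r * Complex.exp (p.1 * Complex.I)))
      angleProd angleProd := by
  refine MeasurePreserving.skew_product (g := fun (θ : ℝ) (c : ℂ) =>
    c + r * Complex.exp (θ * Complex.I)) (MeasurePreserving.id _) ?_ (Eventually.of_forall fun θ => ?_)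
  · exact Continuous.measurable (by fun_prop)
  · exact (measurePreserving_add_right volume (r * Complex.exp (θ * Complex.I))).map_eq

lemma integral_angleProd_circleShift {G : Type*} [NormedAddCommGroup G] [NormedSpace ℝ G]
    [SecondCountableTopology G] [MeasurableSpace G] [BorelSpace G] (r : ℝ)
    {f : ℝ × ℂ → G} (hf : Measurable f) :
    ∫ p, f (p.1, p.2 + r * Complex.exp (p.1 * Complex.I)) ∂angleProd = ∫ p, f p ∂angleProd := by
  conv_rhs => rw [← (measurePreserving_circleShift r).map_eq]
  rw [integral_map (measurePreserving_circleShift r).aemeasurable]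
  exact hf.stronglyMeasurable.aestronglyMeasurable

lemma integrable_angleProd_circleShift {G : Type*} [NormedAddCommGroup G]
    [SecondCountableTopology G] [MeasurableSpace G] [BorelSpace G] (r : ℝ)
    {f : ℝ × ℂ → G} (hf : Measurable f) :
    Integrable (fun p : ℝ × ℂ => f (p.1, p.2 + r * Complex.exp (p.1 * Complex.I))) angleProd ↔
      Integrable f angleProd :=
  (measurePreserving_circleShift r).integrable_comp hf.stronglyMeasurable.aestronglyMeasurable

lemma integrable_angleProd_snd {G : Type*} [NormedAddCommGroup G] {f : ℂ → G}
    (hf : Integrable f) : Integrable (fun p : ℝ × ℂ => f p.2) angleProd :=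
  hf.comp_snd _

lemma integral_angleProd_snd {f : ℂ → ℝ} :
    ∫ p, f p.2 ∂angleProd = 2 * Real.pi * ∫ c, f c := by
  rw [angleProd, integral_fun_snd]
  simp [Measure.real, Real.pi_nonneg]

lemma integral_angleProd {G : Type*} [NormedAddCommGroup G] [NormedSpace ℝ G]
    {f : ℝ × ℂ → G} (hf : Integrable f angleProd) :
    ∫ p, f p ∂angleProd = ∫ c, ∫ θ in (0:ℝ)..(2 * Real.pi), f (θ, c) := by
  rw [angleProd, integral_prod_symm _ hf]
  simp_rw [intervalIntegral.integral_of_le Real.two_pi_pos.le]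

lemma integral_angle_exp : ∫ θ in (0:ℝ)..(2 * Real.pi), Complex.exp (θ * Complex.I) = 0 := by
  have := integral_exp_mul_complex (a := 0) (b := 2 * Real.pi) (c := Complex.I) Complex.I_ne_zero
  simp_rw [mul_comm _ Complex.I]
  rw [this, mul_comm Complex.I]
  push_cast
  simp [Complex.exp_two_pi_mul_I]

lemma integral_exp_mul_comp_sub {h : ℂ → ℂ} {c : ℂ} {r : ℝ} (hr : 0 < r)
    (hh : DifferentiableOn ℂ h (closedBall c r)) :
    ∫ θ in (0:ℝ)..(2 * Real.pi), Complex.exp (θ * Complex.I) *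
      h (c - r * Complex.exp (θ * Complex.I)) = 0 := by
  have h1 : DifferentiableOn ℂ (fun z => h (2 * c - z)) (closedBall c r) := by
    refine hh.comp (by fun_prop) fun z hz => ?_
    rw [mem_closedBall, dist_eq_norm] at hz ⊢
    rwa [show 2 * c - z - c = -(z - c) by ring, norm_neg]
  have h2 := Complex.circleIntegral_eq_zero_of_differentiable_on_off_countable hr.le
    countable_empty h1.continuousOn fun z hz => (h1 z (ball_subset_closedBall hz.1)).differentiableAt
      (closedBall_mem_nhds_of_mem hz.1)
  simp only [circleIntegral, deriv_circleMap, circleMap, smul_eq_mul, zero_add] at h2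
  have h3 : ∀ θ : ℝ, (r * Complex.exp (θ * Complex.I)) * Complex.I *
      h (2 * c - (c + r * Complex.exp (θ * Complex.I))) = (r * Complex.I) *
      (Complex.exp (θ * Complex.I) * h (c - r * Complex.exp (θ * Complex.I))) := fun θ => by
    rw [show 2 * c - (c + r * Complex.exp (θ * Complex.I)) = c - r * Complex.exp (θ * Complex.I) by ring]
    ring
  simp_rw [h3] at h2
  rw [intervalIntegral.integral_const_mul] at h2
  simpa [hr.ne'] using h2

end AngleProd

/-- The paraboloid bump `max (R² - ‖c - b‖²) 0`. -/
noncomputable def bump (b : ℂ) (R : ℝ) (c : ℂ) : ℝ := max (R ^ 2 - ‖c - b‖ ^ 2) 0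

section Bump

variable {b : ℂ} {R : ℝ}

lemma continuous_bump : Continuous (bump b R) := by unfold bump; fun_prop

lemma bump_nonneg (c : ℂ) : 0 ≤ bump b R c := le_max_right _ _

lemma bump_le (c : ℂ) : bump b R c ≤ R ^ 2 :=
  max_le (by linarith [sq_nonneg ‖c - b‖]) (sq_nonneg R)

lemma bump_eq_zero (hR : 0 ≤ R) {c : ℂ} (hc : c ∉ ball b R) : bump b R c = 0 := by
  rw [mem_ball, dist_eq_norm, not_lt] at hc
  exact max_eq_right (by nlinarith)

lemma bump_eq (hR : 0 ≤ R) {c : ℂ} (hc : c ∈ ball b R) : bump b R c = R ^ 2 - ‖c - b‖ ^ 2 := by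
  rw [mem_ball, dist_eq_norm] at hc
  exact max_eq_left (by nlinarith [norm_nonneg (c - b)])

lemma abs_bump_sub_le (c v : ℂ) :
    |bump b R (c + v) - bump b R c| ≤ ‖v‖ * (2 * ‖c - b‖ + ‖v‖) := by
  unfold bump
  refine (abs_max_sub_max_le_abs _ _ _).trans ?_
  rw [show R ^ 2 - ‖c + v - b‖ ^ 2 - (R ^ 2 - ‖c - b‖ ^ 2)
    = (‖c - b‖ - ‖c + v - b‖) * (‖c + v - b‖ + ‖c - b‖) by ring, abs_mul]
  have h1 : |‖c - b‖ - ‖c + v - b‖| ≤ ‖v‖ := by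
    have := abs_norm_sub_norm_le (c - b) (c + v - b)
    rwa [show c - b - (c + v - b) = -v by ring, norm_neg] at this
  have h2 : ‖c + v - b‖ ≤ ‖c - b‖ + ‖v‖ := by
    rw [show c + v - b = c - b + v by ring]; exact norm_add_le _ _
  rw [abs_of_nonneg (by positivity : 0 ≤ ‖c + v - b‖ + ‖c - b‖)]
  exact mul_le_mul h1 (by linarith) (by positivity) (norm_nonneg _)

lemma normSq_add_circle (w : ℂ) (r θ : ℝ) :
    ‖w + r * Complex.exp (θ * Complex.I)‖ ^ 2 =
      ‖w‖ ^ 2 + r ^ 2 + 2 * r * (w.re * Real.cos θ + w.im * Real.sin θ) := by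
  rw [← Complex.normSq_eq_norm_sq, ← Complex.normSq_eq_norm_sq, Complex.exp_mul_I]
  simp only [Complex.normSq_apply, Complex.add_re, Complex.add_im, Complex.mul_re, Complex.mul_im,
    Complex.ofReal_re, Complex.ofReal_im, Complex.cos_ofReal_re, Complex.sin_ofReal_re,
    Complex.cos_ofReal_im, Complex.sin_ofReal_im, Complex.I_re, Complex.I_im]
  have := Real.sin_sq_add_cos_sq θ
  linear_combination r ^ 2 * this

lemma integral_normSq_add_circle (w : ℂ) (r : ℝ) :
    ∫ θ in (0:ℝ)..(2 * Real.pi), ‖w + r * Complex.exp (θ * Complex.I)‖ ^ 2 =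
      2 * Real.pi * (‖w‖ ^ 2 + r ^ 2) := by
  simp_rw [normSq_add_circle]
  rw [intervalIntegral.integral_add (by simp) (Continuous.intervalIntegrable (by fun_prop) _ _),
    intervalIntegral.integral_const_mul,
    intervalIntegral.integral_add (Continuous.intervalIntegrable (by fun_prop) _ _)
      (Continuous.intervalIntegrable (by fun_prop) _ _)]
  simp
  ring

lemma integral_exp_mul_normSq_add_circle (w : ℂ) (r : ℝ) :
    ∫ θ in (0:ℝ)..(2 * Real.pi), Complex.exp (θ * Complex.I) *
      ((‖w + r * Complex.exp (θ * Complex.I)‖ ^ 2 : ℝ) : ℂ) = 2 * Real.pi * (r * w) := by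
  have h : ∀ θ : ℝ, Complex.exp (θ * Complex.I) *
      ((‖w + r * Complex.exp (θ * Complex.I)‖ ^ 2 : ℝ) : ℂ) =
      (‖w‖ ^ 2 + r ^ 2) * Complex.exp (θ * Complex.I) + (r * w
        + r * (starRingEnd ℂ) w * Complex.exp ((2 * Complex.I) * θ)) := fun θ => by
    rw [Complex.ofReal_pow, ← Complex.conj_mul', ← Complex.conj_mul']
    have h2 : Complex.exp ((2 * Complex.I) * θ) = Complex.exp (θ * Complex.I) ^ 2 := by
      rw [← Complex.exp_nat_mul]; congr 1; push_cast; ring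
    have h3 : (starRingEnd ℂ) (Complex.exp (θ * Complex.I)) * Complex.exp (θ * Complex.I) = 1 := by
      rw [Complex.conj_mul', Complex.norm_exp_ofReal_mul_I]; simp
    rw [h2, map_add, map_mul, Complex.conj_ofReal]
    linear_combination (r * w + r ^ 2 * Complex.exp (θ * Complex.I)) * h3
  simp_rw [h]
  rw [intervalIntegral.integral_add (Continuous.intervalIntegrable (by fun_prop) _ _)
      (Continuous.intervalIntegrable (by fun_prop) _ _),
    intervalIntegral.integral_add (by simp) (Continuous.intervalIntegrable (by fun_prop) _ _),
    intervalIntegral.integral_const_mul, intervalIntegral.integral_const_mul (r * (starRingEnd ℂ) w),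
    integral_angle_exp, integral_exp_mul_complex (by simp)]
  have : Complex.exp (2 * Complex.I * ((2 * Real.pi : ℝ) : ℂ)) = 1 := by
    rw [Complex.exp_eq_one_iff]; exact ⟨2, by push_cast; ring⟩
  rw [this]
  simp
  ring

end Bump

section Energy

variable {b : ℂ} {R r : ℝ}

lemma integrable_angleProd_of_bdd {F : ℝ × ℂ → ℝ} (hF : Measurable F) (b : ℂ) (C ρ : ℝ)
    (hC : ∀ p, |F p| ≤ C) (h0 : ∀ p, p.2 ∉ ball b ρ → F p = 0) : Integrable F angleProd := by
  have h1 : Integrable ((ball b ρ).indicator fun _ : ℂ => C) :=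
    (integrable_indicator_iff measurableSet_ball).2 (integrableOn_const measure_ball_lt_top.ne)
  refine (integrable_angleProd_snd h1).mono' hF.aestronglyMeasurable (Eventually.of_forall fun p => ?_)
  by_cases hp : p.2 ∈ ball b ρ
  · rw [indicator_of_mem hp]; exact hC p
  · rw [indicator_of_notMem hp, h0 p hp]; simp

lemma integrable_integral_angle {G : Type*} [NormedAddCommGroup G] [NormedSpace ℝ G]
    {f : ℝ × ℂ → G} (hf : Integrable f angleProd) :
    Integrable fun c => ∫ θ in (0:ℝ)..(2 * Real.pi), f (θ, c) := by
  simp_rw [intervalIntegral.integral_of_le Real.two_pi_pos.le]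
  exact hf.integral_prod_right

lemma energy_le {t : ℂ → ℝ} (ht : Continuous t) (ht0 : ∀ z, 0 ≤ t z) (ht1 : ∀ z, t z ≤ 1)
    (hR : 0 ≤ R) (hsub : ∀ c ∈ ball b R, t c ≤
        (2 * Real.pi)⁻¹ * ∫ θ in (0:ℝ)..(2 * Real.pi), t (c + r * Complex.exp (θ * Complex.I))) :
    ∫ p, bump b R p.2 * (t (p.2 + r * Complex.exp (p.1 * Complex.I)) - t p.2) ^ 2 ∂angleProd ≤
      4 * Real.pi * r ^ 2 * ∫ c in ball b R, (1 - t c) := by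
  have hη := continuous_bump (b := b) (R := R)
  set q : ℂ → ℝ := fun z => 1 - t z ^ 2 with hq
  have hqc : Continuous q := by fun_prop
  have hq0 : ∀ z, 0 ≤ q z := fun z => by simp only [hq]; nlinarith [ht0 z, ht1 z]
  have hq1 : ∀ z, q z ≤ 1 := fun z => by simp only [hq]; nlinarith [ht0 z, ht1 z]
  have hzero : ∀ c ∉ ball b R, bump b R c = 0 := fun c hc => bump_eq_zero hR hc
  have i1 : Integrable (fun p : ℝ × ℂ => bump b R p.2 *
      (t (p.2 + r * Complex.exp (p.1 * Complex.I)) - t p.2) ^ 2) angleProd := by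
    refine integrable_angleProd_of_bdd (Continuous.measurable (by fun_prop)) b (R ^ 2 * 1) R
      (fun p => ?_) fun p hp => by rw [hzero _ hp, zero_mul]
    rw [abs_of_nonneg (mul_nonneg (bump_nonneg _) (sq_nonneg _))]
    refine mul_le_mul (bump_le _) ?_ (sq_nonneg _) (sq_nonneg _)
    nlinarith [ht0 p.2, ht1 p.2, ht0 (p.2 + r * Complex.exp (p.1 * Complex.I)),
      ht1 (p.2 + r * Complex.exp (p.1 * Complex.I))]
  have i2 : Integrable (fun p : ℝ × ℂ => bump b R p.2 * q p.2) angleProd := by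
    refine integrable_angleProd_of_bdd (Continuous.measurable (by fun_prop)) b (R ^ 2 * 1) R
      (fun p => ?_) fun p hp => by rw [hzero _ hp, zero_mul]
    rw [abs_of_nonneg (mul_nonneg (bump_nonneg _) (hq0 _))]
    exact mul_le_mul (bump_le _) (hq1 _) (hq0 _) (sq_nonneg _)
  have i3 : Integrable (fun p : ℝ × ℂ => bump b R p.2 *
      q (p.2 + r * Complex.exp (p.1 * Complex.I))) angleProd := by
    refine integrable_angleProd_of_bdd (Continuous.measurable (by fun_prop)) b (R ^ 2 * 1) R
      (fun p => ?_) fun p hp => by rw [hzero _ hp, zero_mul]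
    rw [abs_of_nonneg (mul_nonneg (bump_nonneg _) (hq0 _))]
    exact mul_le_mul (bump_le _) (hq1 _) (hq0 _) (sq_nonneg _)
  have hshift : ∀ p : ℝ × ℂ, p.2 + (-r : ℝ) * Complex.exp (p.1 * Complex.I) +
      r * Complex.exp (p.1 * Complex.I) = p.2 := fun p => by push_cast; ring
  have i4 : Integrable (fun p : ℝ × ℂ => bump b R (p.2 + (-r : ℝ) * Complex.exp (p.1 * Complex.I)) *
      q p.2) angleProd := by
    have := (integrable_angleProd_circleShift (-r) (f := fun p : ℝ × ℂ => bump b R p.2 *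
      q (p.2 + r * Complex.exp (p.1 * Complex.I))) (Continuous.measurable (by fun_prop))).2 i3
    simpa only [hshift] using this
  have e4 : ∫ p, bump b R p.2 * q (p.2 + r * Complex.exp (p.1 * Complex.I)) ∂angleProd =
      ∫ p, bump b R (p.2 + (-r : ℝ) * Complex.exp (p.1 * Complex.I)) * q p.2 ∂angleProd := by
    have := integral_angleProd_circleShift (-r) (f := fun p : ℝ × ℂ => bump b R p.2 *
      q (p.2 + r * Complex.exp (p.1 * Complex.I))) (Continuous.measurable (by fun_prop))
    simp only [hshift] at this
    exact this.symm
  have i23 : Integrable (fun p : ℝ × ℂ => bump b R p.2 * q p.2 - bump b R p.2 *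
      q (p.2 + r * Complex.exp (p.1 * Complex.I))) angleProd := i2.sub i3
  have i24 : Integrable (fun p : ℝ × ℂ => bump b R p.2 * q p.2 -
      bump b R (p.2 + (-r : ℝ) * Complex.exp (p.1 * Complex.I)) * q p.2) angleProd := i2.sub i4
  calc _ ≤ ∫ p, (bump b R p.2 * q p.2 - bump b R p.2 *
        q (p.2 + r * Complex.exp (p.1 * Complex.I))) ∂angleProd := by
        rw [integral_angleProd i1, integral_angleProd i23]
        refine integral_mono (integrable_integral_angle i1) (integrable_integral_angle i23)
          fun c => ?_
        simp only
        by_cases hc : c ∈ ball b R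
        · simp only [← mul_sub]
          rw [intervalIntegral.integral_const_mul, intervalIntegral.integral_const_mul]
          refine mul_le_mul_of_nonneg_left ?_ (bump_nonneg c)
          have hs := hsub c hc
          rw [inv_mul_eq_div, le_div_iff₀ Real.two_pi_pos] at hs
          rw [← sub_nonneg, ← intervalIntegral.integral_sub
            (Continuous.intervalIntegrable (by fun_prop) _ _)
            (Continuous.intervalIntegrable (by fun_prop) _ _)]
          have : ∀ θ : ℝ, q c - q (c + r * Complex.exp (θ * Complex.I)) -
              (t (c + r * Complex.exp (θ * Complex.I)) - t c) ^ 2 =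
              2 * t c * (t (c + r * Complex.exp (θ * Complex.I)) - t c) := fun θ => by
            simp only [hq]; ring
          simp_rw [this]
          rw [intervalIntegral.integral_const_mul, intervalIntegral.integral_sub
            (Continuous.intervalIntegrable (by fun_prop) _ _)
            (Continuous.intervalIntegrable (by fun_prop) _ _), intervalIntegral.integral_const]
          refine mul_nonneg (by linarith [ht0 c]) ?_
          simp only [sub_zero, smul_eq_mul]
          linarith
        · simp [hzero c hc]
    _ = ∫ p, (bump b R p.2 * q p.2 -
        bump b R (p.2 + (-r : ℝ) * Complex.exp (p.1 * Complex.I)) * q p.2) ∂angleProd := by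
        rw [integral_sub i2 i3, integral_sub i2 i4, e4]
    _ ≤ ∫ c, (ball b R).indicator (fun c => 2 * Real.pi * r ^ 2 * (2 * (1 - t c))) c := by
        rw [integral_angleProd i24]
        refine integral_mono (integrable_integral_angle i24) ?_ fun c => ?_
        · rw [integrable_indicator_iff measurableSet_ball]
          exact ((Continuous.continuousOn (by fun_prop)).integrableOn_compact
            (isCompact_closedBall b R)).mono_set ball_subset_closedBall
        · simp only [← sub_mul]
          rw [intervalIntegral.integral_mul_const, intervalIntegral.integral_sub
            (Continuous.intervalIntegrable (by fun_prop) _ _)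
            (Continuous.intervalIntegrable (by fun_prop) _ _), intervalIntegral.integral_const,
            sub_zero, smul_eq_mul]
          by_cases hc : c ∈ ball b R
          · rw [indicator_of_mem hc, bump_eq hR hc]
            have h1 : 2 * Real.pi * (R ^ 2 - ‖c - b‖ ^ 2 - r ^ 2) ≤ ∫ θ in (0:ℝ)..(2 * Real.pi),
                bump b R (c + (-r : ℝ) * Complex.exp (θ * Complex.I)) := by
              have h2 := intervalIntegral.integral_mono_on (a := 0) (b := 2 * Real.pi) (μ := volume)
                (f := fun θ : ℝ => R ^ 2 - ‖c - b + (-r : ℝ) * Complex.exp (θ * Complex.I)‖ ^ 2)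
                (g := fun θ : ℝ => bump b R (c + (-r : ℝ) * Complex.exp (θ * Complex.I)))
                Real.two_pi_pos.le (Continuous.intervalIntegrable (by fun_prop) _ _)
                (Continuous.intervalIntegrable (by fun_prop) _ _) (fun θ _ => by
                  unfold bump
                  rw [show c - b + (-r : ℝ) * Complex.exp (θ * Complex.I) =
                    c + (-r : ℝ) * Complex.exp (θ * Complex.I) - b by ring]
                  exact le_max_left _ _)
              rw [intervalIntegral.integral_sub (by simp)
                (Continuous.intervalIntegrable (by fun_prop) _ _), integral_normSq_add_circle,
                intervalIntegral.integral_const, sub_zero, smul_eq_mul] at h2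
              refine le_trans (le_of_eq ?_) h2
              ring
            have h3 : q c ≤ 2 * (1 - t c) := by
              simp only [hq]; nlinarith [ht0 c, ht1 c]
            refine mul_le_mul ?_ h3 (hq0 c) (by positivity)
            nlinarith
          · rw [indicator_of_notMem hc, hzero c hc, mul_zero, zero_sub]
            refine mul_nonpos_of_nonpos_of_nonneg (neg_nonpos.2 ?_) (hq0 c)
            exact intervalIntegral.integral_nonneg Real.two_pi_pos.le fun θ _ => bump_nonneg _
    _ = _ := by
        rw [integral_indicator measurableSet_ball, integral_const_mul, integral_const_mul]
        ring

end Energy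

lemma mul_le_add_sq_div {x y l : ℝ} (hl : 0 < l) : x * y ≤ l * x ^ 2 + y ^ 2 / l := by
  rw [← sub_nonneg, show l * x ^ 2 + y ^ 2 / l - x * y =
    ((l * x - y / 2) ^ 2 + 3 / 4 * y ^ 2) / l by field_simp; ring]
  positivity

section Cutoff

variable {b : ℂ} {R R' R'' r : ℝ} {t : ℂ → ℝ} {h : ℂ → ℂ} {W : Set ℂ}

lemma integral_angle_mul_bump_mul_eq_zero (ht : Continuous t) (ht1 : ∀ z, |t z| ≤ 1) (hr : 0 < r)
    (hm : Measurable h) (hi : Integrable h) (hd : DifferentiableOn ℂ h W)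
    (hW : ∀ c, bump b R c * t c ≠ 0 → closedBall c r ⊆ W) :
    Integrable (fun p : ℝ × ℂ => Complex.exp (p.1 * Complex.I) * h p.2 *
      ((bump b R (p.2 + r * Complex.exp (p.1 * Complex.I)) *
        t (p.2 + r * Complex.exp (p.1 * Complex.I)) : ℝ) : ℂ)) angleProd ∧
    ∫ p, Complex.exp (p.1 * Complex.I) * h p.2 *
      ((bump b R (p.2 + r * Complex.exp (p.1 * Complex.I)) *
        t (p.2 + r * Complex.exp (p.1 * Complex.I)) : ℝ) : ℂ) ∂angleProd = 0 := by
  have hη := continuous_bump (b := b) (R := R)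
  set F : ℝ × ℂ → ℂ := fun p => Complex.exp (p.1 * Complex.I) * h p.2 *
      ((bump b R (p.2 + r * Complex.exp (p.1 * Complex.I)) *
        t (p.2 + r * Complex.exp (p.1 * Complex.I)) : ℝ) : ℂ) with hF
  have hFm : Measurable F := by
    refine (Measurable.mul (Continuous.measurable (by fun_prop)) (hm.comp measurable_snd)).mul ?_
    exact Continuous.measurable (by fun_prop)
  have hFi : Integrable F angleProd := by
    refine ((integrable_angleProd_snd hi.norm).const_mul (R ^ 2 * 1)).mono' hFm.aestronglyMeasurable
      (Eventually.of_forall fun p => ?_)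
    simp only [hF, norm_mul, Complex.norm_exp_ofReal_mul_I, one_mul, Complex.norm_real, Real.norm_eq_abs,
      abs_of_nonneg (bump_nonneg _)]
    rw [mul_comm]
    exact mul_le_mul_of_nonneg_right (mul_le_mul (bump_le _) (ht1 _) (abs_nonneg _) (sq_nonneg _))
      (norm_nonneg _)
  refine ⟨hFi, ?_⟩
  have hFi' := (integrable_angleProd_circleShift (-r) hFm).2 hFi
  rw [← integral_angleProd_circleShift (-r) hFm, integral_angleProd hFi']
  refine integral_eq_zero_of_ae (Eventually.of_forall fun c => ?_)
  have hs : ∀ θ : ℝ, c + (-r : ℝ) * Complex.exp (θ * Complex.I) + r * Complex.exp (θ * Complex.I) = c :=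
    fun θ => by push_cast; ring
  simp only [hF, hs, Pi.zero_apply]
  rw [intervalIntegral.integral_mul_const]
  by_cases hc : bump b R c * t c = 0
  · rw [hc]; simp
  · have := integral_exp_mul_comp_sub hr (hd.mono (hW c hc))
    have hs' : ∀ θ : ℝ, c + (-r : ℝ) * Complex.exp (θ * Complex.I) =
      c - r * Complex.exp (θ * Complex.I) := fun θ => by push_cast; ring
    simp_rw [hs', this, zero_mul]

lemma norm_integral_angle_mul_bump_sub_le (ht : Continuous t) (ht0 : ∀ z, 0 ≤ t z)
    (ht1 : ∀ z, t z ≤ 1) (hr : 0 < r) (hR : 0 < R) (hRR' : R ≤ R') (hR'' : R' + r ≤ R'')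
    (hm : Measurable h) (hi : Integrable h) (hi2 : Integrable fun z => ‖h z‖ ^ 2)
    (h0 : ∀ z ∉ ball b R', h z = 0) (hd : DifferentiableOn ℂ h W)
    (hW : ∀ c, bump b R c * t c ≠ 0 → closedBall c r ⊆ W)
    (hsub : ∀ c ∈ ball b R, t c ≤
        (2 * Real.pi)⁻¹ * ∫ θ in (0:ℝ)..(2 * Real.pi), t (c + r * Complex.exp (θ * Complex.I)))
    {l : ℝ} (hl : 0 < l) :
    ‖∫ p, Complex.exp (p.1 * Complex.I) * h p.2 *
      ((bump b R (p.2 + r * Complex.exp (p.1 * Complex.I)) - bump b R p.2 : ℝ) : ℂ) ∂angleProd‖ ≤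
      r * (2 * Real.pi * (2 * R' + r + R ^ 2) * (∫ z, ‖h z‖ ^ 2) * l +
        2 * Real.pi * (2 * R' + r + 2) * (∫ z in ball b R'', (1 - t z)) / l) := by
  have hη := continuous_bump (b := b) (R := R)
  have habs : ∀ z, |t z| ≤ 1 := fun z => by rw [abs_of_nonneg (ht0 z)]; exact ht1 z
  obtain ⟨ia, ea⟩ := integral_angle_mul_bump_mul_eq_zero ht habs hr hm hi hd hW
  have hRR'' : R ≤ R'' := by linarith
  set L := 2 * R' + r with hL
  have hLpos : 0 < L := by linarith
  have hball : ∀ p : ℝ × ℂ, p.2 ∈ ball b R' → p.2 + r * Complex.exp (p.1 * Complex.I) ∈ ball b R'' := by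
    intro p hp
    rw [mem_ball, dist_eq_norm] at hp ⊢
    rw [show p.2 + r * Complex.exp (p.1 * Complex.I) - b =
      p.2 - b + r * Complex.exp (p.1 * Complex.I) by ring]
    refine (norm_add_le _ _).trans_lt ?_
    rw [norm_mul, Complex.norm_exp_ofReal_mul_I, Complex.norm_real, Real.norm_eq_abs, abs_of_pos hr]
    linarith
  have hΔ : ∀ p : ℝ × ℂ, p.2 ∈ ball b R' →
      |bump b R (p.2 + r * Complex.exp (p.1 * Complex.I)) - bump b R p.2| ≤ r * L := fun p hp => by
    refine (abs_bump_sub_le _ _).trans ?_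
    rw [norm_mul, Complex.norm_exp_ofReal_mul_I, Complex.norm_real, Real.norm_eq_abs, abs_of_pos hr,
      mul_one]
    rw [mem_ball, dist_eq_norm] at hp
    exact mul_le_mul_of_nonneg_left (by linarith) hr.le
  have hmE : Measurable fun p : ℝ × ℂ => Complex.exp (p.1 * Complex.I) * h p.2 :=
    Measurable.mul (Continuous.measurable (by fun_prop)) (hm.comp measurable_snd)
  have ib : Integrable (fun p : ℝ × ℂ => Complex.exp (p.1 * Complex.I) * h p.2 *
      ((bump b R p.2 * t p.2 : ℝ) : ℂ)) angleProd := by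
    refine ((integrable_angleProd_snd hi.norm).const_mul (R ^ 2 * 1)).mono'
      (hmE.mul (Continuous.measurable (by fun_prop))).aestronglyMeasurable
      (Eventually.of_forall fun p => ?_)
    simp only [norm_mul, Complex.norm_exp_ofReal_mul_I, one_mul, Complex.norm_real, Real.norm_eq_abs,
      abs_of_nonneg (bump_nonneg _)]
    rw [mul_comm]
    exact mul_le_mul_of_nonneg_right (mul_le_mul (bump_le _) (habs _) (abs_nonneg _) (sq_nonneg _))
      (norm_nonneg _)
  have eb : ∫ p, Complex.exp (p.1 * Complex.I) * h p.2 *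
      ((bump b R p.2 * t p.2 : ℝ) : ℂ) ∂angleProd = 0 := by
    rw [integral_angleProd ib]
    refine integral_eq_zero_of_ae (Eventually.of_forall fun c => ?_)
    simp only [mul_assoc, Pi.zero_apply]
    rw [intervalIntegral.integral_mul_const, integral_angle_exp, zero_mul]
  -- the expression to be estimated, with the cutoff inserted
  set G : ℝ × ℂ → ℂ := fun p => Complex.exp (p.1 * Complex.I) * h p.2 *
      (((bump b R (p.2 + r * Complex.exp (p.1 * Complex.I)) - bump b R p.2) *
          (1 - t (p.2 + r * Complex.exp (p.1 * Complex.I))) -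
        bump b R p.2 * (t (p.2 + r * Complex.exp (p.1 * Complex.I)) - t p.2) : ℝ) : ℂ) with hG
  have hGm : Measurable G := hmE.mul (Continuous.measurable (by fun_prop))
  set B₁ : ℝ × ℂ → ℝ := fun p => ‖h p.2‖ ^ 2
  set B₂ : ℝ × ℂ → ℝ := fun p => (ball b R'').indicator (fun z => 1 - t z)
    (p.2 + r * Complex.exp (p.1 * Complex.I)) with hB₂
  set B₃ : ℝ × ℂ → ℝ := fun p =>
    bump b R p.2 * (t (p.2 + r * Complex.exp (p.1 * Complex.I)) - t p.2) ^ 2 with hB₃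
  have hBi : Integrable ((ball b R'').indicator fun z => 1 - t z) := by
    rw [integrable_indicator_iff measurableSet_ball]
    exact ((Continuous.continuousOn (by fun_prop)).integrableOn_compact
      (isCompact_closedBall b R'')).mono_set ball_subset_closedBall
  have hBm : Measurable (fun p : ℝ × ℂ => (ball b R'').indicator (fun z => 1 - t z) p.2) :=
    (Measurable.indicator (by fun_prop) measurableSet_ball).comp measurable_snd
  have i1 : Integrable B₁ angleProd := integrable_angleProd_snd hi2
  have i2 : Integrable B₂ angleProd :=
    (integrable_angleProd_circleShift r hBm).2 (integrable_angleProd_snd hBi)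
  have i3 : Integrable B₃ angleProd := by
    refine integrable_angleProd_of_bdd (Continuous.measurable (by fun_prop)) b (R ^ 2 * 1) R
      (fun p => ?_) fun p hp => by simp only [hB₃, bump_eq_zero hR.le hp, zero_mul]
    rw [abs_of_nonneg (mul_nonneg (bump_nonneg _) (sq_nonneg _))]
    refine mul_le_mul (bump_le _) ?_ (sq_nonneg _) (sq_nonneg _)
    nlinarith [ht0 p.2, ht1 p.2, ht0 (p.2 + r * Complex.exp (p.1 * Complex.I)),
      ht1 (p.2 + r * Complex.exp (p.1 * Complex.I))]
  have e1 : ∫ p, B₁ p ∂angleProd = 2 * Real.pi * ∫ z, ‖h z‖ ^ 2 :=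
    integral_angleProd_snd (f := fun z => ‖h z‖ ^ 2)
  have e2 : ∫ p, B₂ p ∂angleProd = 2 * Real.pi * ∫ z in ball b R'', (1 - t z) := by
    have := integral_angleProd_circleShift r hBm
    rw [integral_angleProd_snd, integral_indicator measurableSet_ball] at this
    exact this
  have e3 : ∫ p, B₃ p ∂angleProd ≤ 4 * Real.pi * r ^ 2 * ∫ z in ball b R'', (1 - t z) := by
    refine (energy_le ht ht0 ht1 hR.le hsub).trans (mul_le_mul_of_nonneg_left ?_ (by positivity))
    refine setIntegral_mono_set ((integrable_indicator_iff measurableSet_ball).1 hBi)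
      (Eventually.of_forall fun z => ?_) (LE.le.eventuallyLE (ball_subset_ball hRR''))
    simpa using ht1 z
  have hbd : ∀ p, ‖G p‖ ≤ r * (L + R ^ 2) * l * B₁ p + r * L / l * B₂ p + 1 / (r * l) * B₃ p := by
    intro p
    by_cases hp : p.2 ∈ ball b R'
    · set t' := t (p.2 + r * Complex.exp (p.1 * Complex.I)) with ht'
      have h2 : B₂ p = 1 - t' := indicator_of_mem (hball p hp) _
      have h1t : 0 ≤ 1 - t' := by linarith [ht1 (p.2 + r * Complex.exp (p.1 * Complex.I))]
      have h1t' : 1 - t' ≤ 1 := by linarith [ht0 (p.2 + r * Complex.exp (p.1 * Complex.I))]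
      have hn : ‖G p‖ ≤ ‖h p.2‖ * (r * L * (1 - t') + bump b R p.2 * |t' - t p.2|) := by
        simp only [hG, norm_mul, Complex.norm_exp_ofReal_mul_I, one_mul, Complex.norm_real,
          Real.norm_eq_abs]
        refine mul_le_mul_of_nonneg_left ((abs_sub _ _).trans ?_) (norm_nonneg _)
        rw [abs_mul, abs_mul, abs_of_nonneg h1t, abs_of_nonneg (bump_nonneg p.2)]
        gcongr
        exact hΔ p hp
      refine hn.trans ?_
      have k1 := mul_le_add_sq_div (x := ‖h p.2‖) (y := 1 - t') hl
      have k1' : (1 - t') ^ 2 / l ≤ (1 - t') / l := by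
        gcongr; nlinarith
      have k2 := mul_le_add_sq_div (x := ‖h p.2‖) (y := |t' - t p.2| / r) hl
      have k3 : ‖h p.2‖ * |t' - t p.2| ≤ r * l * ‖h p.2‖ ^ 2 + (t' - t p.2) ^ 2 * (1 / (r * l)) := by
        have : r * (‖h p.2‖ * (|t' - t p.2| / r)) = ‖h p.2‖ * |t' - t p.2| := by field_simp
        rw [← this]
        refine (mul_le_mul_of_nonneg_left k2 hr.le).trans (le_of_eq ?_)
        rw [div_pow, sq_abs]; field_simp
      have k4 := mul_le_mul_of_nonneg_left k3 (bump_nonneg (b := b) (R := R) p.2)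
      have k5 := mul_le_mul_of_nonneg_left (k1.trans (add_le_add_right k1' _))
        (mul_pos hr hLpos).le
      have k6 := mul_le_mul_of_nonneg_right (bump_le (b := b) (R := R) p.2)
        (by positivity : 0 ≤ r * l * ‖h p.2‖ ^ 2)
      rw [h2]
      simp only [hB₃, B₁, ← ht']
      have k7 : r * L * ((1 - t') / l) = r * L / l * (1 - t') := by ring
      nlinarith
    · simp only [hG, h0 _ hp, mul_zero, zero_mul, norm_zero]
      have : 0 ≤ B₂ p := indicator_nonneg (fun z _ => by linarith [ht1 z]) _
      have : 0 ≤ B₁ p := sq_nonneg _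
      have : 0 ≤ B₃ p := mul_nonneg (bump_nonneg _) (sq_nonneg _)
      have : 0 ≤ L := hLpos.le
      positivity
  have iB : Integrable (fun p => r * (L + R ^ 2) * l * B₁ p + r * L / l * B₂ p +
      1 / (r * l) * B₃ p) angleProd := ((i1.const_mul _).add (i2.const_mul _)).add (i3.const_mul _)
  have iG : Integrable G angleProd :=
    iB.mono' hGm.aestronglyMeasurable (Eventually.of_forall hbd)
  have heq : ∫ p, Complex.exp (p.1 * Complex.I) * h p.2 *
      ((bump b R (p.2 + r * Complex.exp (p.1 * Complex.I)) - bump b R p.2 : ℝ) : ℂ) ∂angleProd =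
      ∫ p, G p ∂angleProd := by
    have := integral_add iG (ia.sub ib)
    rw [integral_sub' ia ib, ea, eb, sub_zero, add_zero] at this
    rw [← this]
    refine integral_congr_ae (Eventually.of_forall fun p => ?_)
    simp only [hG, Pi.sub_apply]
    push_cast
    ring
  rw [heq]
  calc ‖∫ p, G p ∂angleProd‖ ≤ ∫ p, (r * (L + R ^ 2) * l * B₁ p + r * L / l * B₂ p +
      1 / (r * l) * B₃ p) ∂angleProd := norm_integral_le_of_norm_le iB (Eventually.of_forall hbd)
    _ = r * (L + R ^ 2) * l * ∫ p, B₁ p ∂angleProd + r * L / l * ∫ p, B₂ p ∂angleProd +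
      1 / (r * l) * ∫ p, B₃ p ∂angleProd := by
      have i12 : Integrable (fun p => r * (L + R ^ 2) * l * B₁ p + r * L / l * B₂ p) angleProd :=
        (i1.const_mul _).add (i2.const_mul _)
      rw [integral_add i12 (i3.const_mul _),
        integral_add (i1.const_mul _) (i2.const_mul _), integral_const_mul, integral_const_mul,
        integral_const_mul]
    _ ≤ r * (L + R ^ 2) * l * (2 * Real.pi * ∫ z, ‖h z‖ ^ 2) +
      r * L / l * (2 * Real.pi * ∫ z in ball b R'', (1 - t z)) +
      1 / (r * l) * (4 * Real.pi * r ^ 2 * ∫ z in ball b R'', (1 - t z)) := by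
      rw [e1, e2]
      gcongr
    _ = _ := by field_simp; ring

end Cutoff

section FirstMoment

variable {b : ℂ} {R R' R'' r : ℝ} {h : ℂ → ℂ}

lemma integrable_angle_mul_bump_sub (hm : Measurable h) (hi : Integrable h) (r : ℝ) :
    Integrable (fun p : ℝ × ℂ => Complex.exp (p.1 * Complex.I) * h p.2 *
      ((bump b R (p.2 + r * Complex.exp (p.1 * Complex.I)) - bump b R p.2 : ℝ) : ℂ)) angleProd := by
  have hη := continuous_bump (b := b) (R := R)
  refine ((integrable_angleProd_snd hi.norm).const_mul (R ^ 2)).mono'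
    (Measurable.mul (Measurable.mul (Continuous.measurable (by fun_prop)) (hm.comp measurable_snd))
      (Continuous.measurable (by fun_prop))).aestronglyMeasurable (Eventually.of_forall fun p => ?_)
  simp only [norm_mul, Complex.norm_exp_ofReal_mul_I, one_mul, Complex.norm_real, Real.norm_eq_abs]
  rw [mul_comm]
  refine mul_le_mul_of_nonneg_right (abs_sub_le_iff.2 ⟨?_, ?_⟩) (norm_nonneg _) <;>
    linarith [bump_le (b := b) (R := R) p.2, bump_nonneg (b := b) (R := R) p.2,
      bump_le (b := b) (R := R) (p.2 + r * Complex.exp (p.1 * Complex.I)),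
      bump_nonneg (b := b) (R := R) (p.2 + r * Complex.exp (p.1 * Complex.I))]

lemma integral_exp_mul_bump_sub_of_lt {c : ℂ} (hR : 0 < R) (hr : 0 < r) (hc : ‖c - b‖ + r < R) :
    ∫ θ in (0:ℝ)..(2 * Real.pi), Complex.exp (θ * Complex.I) *
      ((bump b R (c + r * Complex.exp (θ * Complex.I)) - bump b R c : ℝ) : ℂ) =
      r * (-(2 * Real.pi) * (c - b)) := by
  have hv : ∀ θ : ℝ, ‖r * Complex.exp (θ * Complex.I)‖ = r := fun θ => by
    rw [norm_mul, Complex.norm_exp_ofReal_mul_I, Complex.norm_real, Real.norm_eq_abs, abs_of_pos hr,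
      mul_one]
  have h1 : ∀ θ : ℝ, Complex.exp (θ * Complex.I) *
      ((bump b R (c + r * Complex.exp (θ * Complex.I)) - bump b R c : ℝ) : ℂ) =
      (‖c - b‖ ^ 2 : ℝ) * Complex.exp (θ * Complex.I) - Complex.exp (θ * Complex.I) *
        ((‖c - b + r * Complex.exp (θ * Complex.I)‖ ^ 2 : ℝ) : ℂ) := fun θ => by
    rw [bump_eq hR.le, bump_eq hR.le, show c + r * Complex.exp (θ * Complex.I) - b =
      c - b + r * Complex.exp (θ * Complex.I) by ring]
    · push_cast; ring
    · rw [mem_ball, dist_eq_norm]; linarith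
    · rw [mem_ball, dist_eq_norm, show c + r * Complex.exp (θ * Complex.I) - b =
        c - b + r * Complex.exp (θ * Complex.I) by ring]
      refine (norm_add_le _ _).trans_lt ?_
      rw [hv]; exact hc
  simp_rw [h1]
  rw [intervalIntegral.integral_sub (Continuous.intervalIntegrable (by fun_prop) _ _)
    (Continuous.intervalIntegrable (by fun_prop) _ _), intervalIntegral.integral_const_mul,
    integral_angle_exp, integral_exp_mul_normSq_add_circle]
  ring

lemma tendsto_integral_angle_mul_bump_sub (hR : 0 < R)
    (hm : Measurable h) (hi : Integrable h) (h0 : ∀ z ∉ ball b R', h z = 0) :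
    Tendsto (fun r : ℝ => (r : ℂ)⁻¹ * ∫ p, Complex.exp (p.1 * Complex.I) * h p.2 *
      ((bump b R (p.2 + r * Complex.exp (p.1 * Complex.I)) - bump b R p.2 : ℝ) : ℂ) ∂angleProd)
      (nhdsWithin 0 (Ioi 0)) (nhds (-(2 * Real.pi) * ∫ c in ball b R, h c * (c - b))) := by
  have hη := continuous_bump (b := b) (R := R)
  rw [← integral_const_mul, ← integral_indicator measurableSet_ball]
  simp_rw [fun r : ℝ => integral_angleProd (integrable_angle_mul_bump_sub (b := b) (R := R) hm hi r),
    ← integral_const_mul]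
  have hcomm : ∀ (r : ℝ) (c : ℂ), (∫ θ in (0:ℝ)..(2 * Real.pi), Complex.exp (θ * Complex.I) * h c *
      ((bump b R (c + r * Complex.exp (θ * Complex.I)) - bump b R c : ℝ) : ℂ)) =
      h c * ∫ θ in (0:ℝ)..(2 * Real.pi), Complex.exp (θ * Complex.I) *
      ((bump b R (c + r * Complex.exp (θ * Complex.I)) - bump b R c : ℝ) : ℂ) := fun r c => by
    rw [← intervalIntegral.integral_const_mul]
    congr 1; ext θ; ring
  refine tendsto_integral_filter_of_dominated_convergence
    (fun c => ‖h c‖ * (2 * Real.pi * (2 * R' + 1))) ?_ ?_ (hi.norm.mul_const _) ?_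
  · refine Eventually.of_forall fun r => ?_
    exact ((integrable_integral_angle (integrable_angle_mul_bump_sub (b := b) (R := R) hm hi r)).const_mul
      _).aestronglyMeasurable
  · filter_upwards [Ioo_mem_nhdsGT (zero_lt_one (α := ℝ))] with r hr
    refine Eventually.of_forall fun c => ?_
    by_cases hc : c ∈ ball b R'
    · rw [hcomm, mul_left_comm, norm_mul]
      refine mul_le_mul_of_nonneg_left ?_ (norm_nonneg _)
      rw [norm_mul, norm_inv, Complex.norm_real, Real.norm_eq_abs, abs_of_pos hr.1,
        inv_mul_le_iff₀ hr.1]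
      have := intervalIntegral.norm_integral_le_of_norm_le_const (a := 0) (b := 2 * Real.pi)
        (C := r * (2 * R' + 1)) (f := fun θ : ℝ => Complex.exp (θ * Complex.I) *
        ((bump b R (c + r * Complex.exp (θ * Complex.I)) - bump b R c : ℝ) : ℂ)) fun θ _ => by
          rw [norm_mul, Complex.norm_exp_ofReal_mul_I, one_mul, Complex.norm_real, Real.norm_eq_abs]
          refine (abs_bump_sub_le _ _).trans ?_
          rw [norm_mul, Complex.norm_exp_ofReal_mul_I, Complex.norm_real, Real.norm_eq_abs,
            abs_of_pos hr.1, mul_one]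
          rw [mem_ball, dist_eq_norm] at hc
          exact mul_le_mul_of_nonneg_left (by linarith [hr.2]) hr.1.le
      rw [sub_zero, abs_of_pos Real.two_pi_pos] at this
      linarith
    · simp [h0 c hc]
  · have hs : volume (sphere b R) = 0 := Measure.addHaar_sphere _ _ _
    filter_upwards [measure_eq_zero_iff_ae_notMem.1 hs] with c hc
    rw [mem_sphere, dist_eq_norm] at hc
    refine tendsto_const_nhds.congr' ?_
    rcases lt_or_gt_of_ne hc with hlt | hgt
    · filter_upwards [Ioo_mem_nhdsGT (sub_pos.2 hlt)] with r hr
      rw [indicator_of_mem (by rwa [mem_ball, dist_eq_norm]), hcomm,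
        integral_exp_mul_bump_sub_of_lt hR hr.1 (by linarith [hr.2])]
      have : (r : ℂ) ≠ 0 := by exact_mod_cast hr.1.ne'
      field_simp
    · filter_upwards [Ioo_mem_nhdsGT (sub_pos.2 hgt)] with r hr
      rw [indicator_of_notMem (by rw [mem_ball, dist_eq_norm]; linarith)]
      have h1 : ∀ θ : ℝ, bump b R (c + r * Complex.exp (θ * Complex.I)) = 0 := fun θ => by
        refine bump_eq_zero hR.le ?_
        rw [mem_ball, dist_eq_norm, not_lt]
        have := norm_sub_norm_le (c - b) (-(r * Complex.exp (θ * Complex.I)))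
        rw [norm_neg, norm_mul, Complex.norm_exp_ofReal_mul_I, Complex.norm_real, Real.norm_eq_abs,
          abs_of_pos hr.1, sub_neg_eq_add] at this
        rw [show c + r * Complex.exp (θ * Complex.I) - b = c - b + r * Complex.exp (θ * Complex.I) by ring]
        linarith [hr.2]
      have h2 : bump b R c = 0 := bump_eq_zero hR.le (by rw [mem_ball, dist_eq_norm]; linarith)
      simp [h1, h2]

/-- The first moment of a square-integrable function over a disc vanishes if the function is
holomorphic off a compact set on which a subharmonic function is `-∞`. -/
lemma setIntegral_ball_mul_sub_eq_zero {u : ℂ → EReal} {Ω : Set ℂ} (hu : SubharmonicOn u Ω) {M : ℝ}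
    (hR : 0 < R) (hRR' : R < R') (hR'' : R' < R'') (hΩ : ball b R'' ⊆ Ω)
    (hM : ∀ w ∈ ball b R'', u w ≤ (M : EReal)) {K : Set ℂ} (hK : IsCompact K)
    (hKb : K ⊆ closedBall b R') (hKu : ∀ z ∈ K, u z = ⊥)
    (hm : Measurable h) (hi : Integrable h) (hi2 : Integrable fun z => ‖h z‖ ^ 2)
    (h0 : ∀ z ∉ ball b R', h z = 0) (hd : DifferentiableOn ℂ h (ball b R' \ K)) :
    ∫ c in ball b R, h c * (c - b) = 0 := by
  have hlim := (tendsto_integral_angle_mul_bump_sub hR hm hi h0).norm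
  set H := ∫ z, ‖h z‖ ^ 2 with hH
  have hH0 : 0 ≤ H := integral_nonneg fun z => sq_nonneg _
  set C := 2 * Real.pi * (2 * R' + 1 + R ^ 2) * H + 2 * Real.pi * (2 * R' + 1 + 2) with hC
  have hkey : ∀ l : ℝ, 0 < l → ‖-(2 * (Real.pi : ℂ)) * ∫ c in ball b R, h c * (c - b)‖ ≤ C * l := by
    intro l hl
    obtain ⟨t, ht, ht0, ht1, ⟨δ, hδ, htK⟩, ⟨δ', hδ', hsub⟩, hI⟩ :=
      exists_capacity_cutoff hu (hRR'.trans hR'') hΩ hM hK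
        (hKb.trans (closedBall_subset_ball hR'')) hKu (sq_pos_of_pos hl)
    refine le_of_tendsto hlim ?_
    filter_upwards [Ioo_mem_nhdsGT zero_lt_one, Ioo_mem_nhdsGT hδ, Ioo_mem_nhdsGT hδ',
      Ioo_mem_nhdsGT (sub_pos.2 hRR'), Ioo_mem_nhdsGT (sub_pos.2 hR'')] with r h1 h2 h3 h4 h5
    have hr := h1.1
    rw [norm_mul, norm_inv, Complex.norm_real, Real.norm_eq_abs, abs_of_pos hr,
        inv_mul_le_iff₀ hr]
    refine (norm_integral_angle_mul_bump_sub_le ht ht0 ht1 hr hR hRR'.le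
      (show R' + r ≤ R'' by linarith [h5.2]) hm hi hi2 h0
      hd ?_ (hsub r hr h3.2) hl).trans (mul_le_mul_of_nonneg_left ?_ hr.le)
    · intro c hc z hz
      have hcb : c ∈ ball b R := by
        by_contra hcb
        exact hc (by rw [bump_eq_zero hR.le hcb, zero_mul])
      rw [mem_closedBall, dist_comm] at hz
      refine ⟨?_, fun hzK => hc ?_⟩
      · rw [mem_ball] at hcb ⊢
        linarith [dist_triangle z c b, dist_comm z c, h4.2]
      · rw [htK c ⟨z, hzK, hz.trans_lt h2.2⟩, mul_zero]
    · have h6 : (∫ z in ball b R'', (1 - t z)) / l ≤ l := by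
        rw [div_le_iff₀ hl]; nlinarith
      have hI0 : 0 ≤ (∫ z in ball b R'', (1 - t z)) / l :=
        div_nonneg (integral_nonneg fun z => by simpa using ht1 z) hl.le
      have hpi := Real.pi_pos
      have hR'0 := hR.trans hRR'
      rw [hC, add_mul, mul_div_assoc]
      gcongr
      · exact h1.2.le
      · exact h1.2.le
  have : ‖-(2 * (Real.pi : ℂ)) * ∫ c in ball b R, h c * (c - b)‖ ≤ 0 := by
    refine ge_of_tendsto (f := fun l : ℝ => C * l) (x := nhdsWithin 0 (Ioi 0)) ?_ ?_
    · have : Tendsto (fun l : ℝ => C * l) (nhds 0) (nhds (C * 0)) := by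
        exact (continuous_const.mul continuous_id).tendsto 0
      rw [mul_zero] at this
      exact this.mono_left nhdsWithin_le_nhds
    · filter_upwards [self_mem_nhdsWithin] with l hl using hkey l hl
  rw [norm_le_zero_iff, mul_eq_zero] at this
  exact this.resolve_left (by simp [Real.pi_ne_zero])

end FirstMoment

section LocalExtension

lemma hasDerivAt_integral_div_sub {g : ℂ → ℂ} {A : Set ℂ} (hA : MeasurableSet A)
    (hg : IntegrableOn g A) {w₀ : ℂ} {ε : ℝ} (hε : 0 < ε) (hdist : ∀ z ∈ A, 2 * ε ≤ ‖z - w₀‖) :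
    HasDerivAt (fun w => ∫ z in A, g z / (z - w)) (∫ z in A, g z / (z - w₀) ^ 2) w₀ := by
  have hlow : ∀ z ∈ A, ∀ w ∈ ball w₀ ε, ε ≤ ‖z - w‖ := fun z hz w hw => by
    have := norm_sub_le_norm_sub_add_norm_sub z w w₀
    rw [mem_ball, dist_eq_norm] at hw
    linarith [hdist z hz]
  have hmeas : ∀ w : ℂ, AEStronglyMeasurable (fun z => g z / (z - w)) (volume.restrict A) := fun w => by
    simp_rw [div_eq_mul_inv]
    exact hg.aestronglyMeasurable.mul (by fun_prop : Measurable fun z : ℂ => (z - w)⁻¹).aestronglyMeasurable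
  have hint : ∀ w ∈ ball w₀ ε, Integrable (fun z => g z / (z - w)) (volume.restrict A) := fun w hw => by
    refine (hg.norm.mul_const ε⁻¹).mono' (hmeas w) ?_
    filter_upwards [ae_restrict_mem hA] with z hz
    rw [norm_div, div_eq_mul_inv]
    gcongr
    exact hlow z hz w hw
  refine (hasDerivAt_integral_of_dominated_loc_of_deriv_le (bound := fun z => ‖g z‖ * (ε ^ 2)⁻¹)
    (F := fun w z => g z / (z - w)) (F' := fun w z => g z / (z - w) ^ 2) (ball_mem_nhds w₀ hε)
    (Eventually.of_forall hmeas) (hint w₀ (mem_ball_self hε)) ?_ ?_ (hg.norm.mul_const _) ?_).2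
  · simp_rw [div_eq_mul_inv]
    exact hg.aestronglyMeasurable.mul
      (by fun_prop : Measurable fun z : ℂ => ((z - w₀) ^ 2)⁻¹).aestronglyMeasurable
  · filter_upwards [ae_restrict_mem hA] with z hz w hw
    rw [norm_div, div_eq_mul_inv, norm_pow]
    gcongr
    exact hlow z hz w hw
  · filter_upwards [ae_restrict_mem hA] with z hz w hw
    have hne : z - w ≠ 0 := fun h0 => by
      have := hlow z hz w hw
      rw [h0, norm_zero] at this
      linarith
    have := ((hasDerivAt_id w).const_sub z).inv hne
    have := this.const_mul (g z)
    simpa [div_eq_mul_inv] using this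

lemma differentiableOn_integral_div_sub {g : ℂ → ℂ} {b : ℂ} {R : ℝ} {A : Set ℂ} (hA : MeasurableSet A)
    (hg : IntegrableOn g A) (hdist : ∀ z ∈ A, R ≤ ‖z - b‖) :
    DifferentiableOn ℂ (fun w => ∫ z in A, g z / (z - w)) (ball b R) := fun w hw => by
  rw [mem_ball, dist_eq_norm] at hw
  refine (hasDerivAt_integral_div_sub (ε := (R - ‖w - b‖) / 2) hA hg (by linarith)
    fun z hz => ?_).differentiableAt.differentiableWithinAt
  have := norm_sub_le_norm_sub_add_norm_sub z w b
  linarith [hdist z hz]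

lemma integrable_of_sq {h : ℂ → ℂ} {b : ℂ} {R : ℝ} (hm : Measurable h)
    (hi2 : Integrable fun z => ‖h z‖ ^ 2) (h0 : ∀ z ∉ ball b R, h z = 0) : Integrable h := by
  have h1 : Integrable ((ball b R).indicator fun _ : ℂ => (1 : ℝ)) :=
    (integrable_indicator_iff measurableSet_ball).2 (integrableOn_const measure_ball_lt_top.ne)
  refine (h1.add hi2).mono' hm.aestronglyMeasurable (Eventually.of_forall fun z => ?_)
  by_cases hz : z ∈ ball b R
  · rw [Pi.add_apply, indicator_of_mem hz]
    nlinarith [sq_nonneg (‖h z‖ - 1), norm_nonneg (h z)]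
  · rw [Pi.add_apply, indicator_of_notMem hz, h0 z hz]; simp

lemma measurable_indicator_of_continuousOn {f : ℂ → ℂ} {W : Set ℂ} (hW : IsOpen W)
    (hf : ContinuousOn f W) : Measurable (W.indicator f) := by
  classical
  rw [← piecewise_eq_indicator]
  exact hf.measurable_piecewise continuousOn_const hW.measurableSet

lemma integrable_sq_dslope {f : ℂ → ℂ} {b : ℂ} {R : ℝ} {W : Set ℂ} (hW : IsOpen W) (hWb : W ⊆ ball b R)
    (hf : DifferentiableOn ℂ f W) (hf2 : IntegrableOn (fun z => ‖f z‖ ^ 2) W) {w : ℂ} (hw : w ∈ W) :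
    Integrable fun z => ‖W.indicator (dslope f w) z‖ ^ 2 := by
  have hd : DifferentiableOn ℂ (dslope f w) W :=
    (Complex.differentiableOn_dslope (hW.mem_nhds hw)).2 hf
  have hm := measurable_indicator_of_continuousOn hW hd.continuousOn
  obtain ⟨δ, hδ, hδW⟩ := nhds_basis_closedBall.mem_iff.1 (hW.mem_nhds hw)
  obtain ⟨C, hC⟩ := (isCompact_closedBall w δ).exists_bound_of_continuousOn
    (hd.continuousOn.mono hδW)
  have i1 : Integrable ((ball b R).indicator fun _ : ℂ => C ^ 2 + 2 * (‖f w‖ / δ) ^ 2) :=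
    (integrable_indicator_iff measurableSet_ball).2 (integrableOn_const measure_ball_lt_top.ne)
  have i2 : Integrable (W.indicator fun z => 2 * (δ ^ 2)⁻¹ * ‖f z‖ ^ 2) :=
    (integrable_indicator_iff hW.measurableSet).2 (hf2.const_mul _)
  refine (i1.add i2).mono' (hm.norm.pow_const 2).aestronglyMeasurable (Eventually.of_forall fun z => ?_)
  rw [Real.norm_eq_abs, abs_of_nonneg (sq_nonneg _)]
  by_cases hz : z ∈ W
  · simp only [Pi.add_apply, indicator_of_mem hz, indicator_of_mem (hWb hz)]
    by_cases hzδ : z ∈ closedBall w δ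
    · have := hC z hzδ
      have h2 : ‖dslope f w z‖ ^ 2 ≤ C ^ 2 := by gcongr
      have h3 : 0 ≤ 2 * (δ ^ 2)⁻¹ * ‖f z‖ ^ 2 := by positivity
      have h4 : 0 ≤ 2 * (‖f w‖ / δ) ^ 2 := by positivity
      linarith
    · have hne : z ≠ w := fun h => hzδ (h ▸ mem_closedBall_self hδ.le)
      rw [mem_closedBall, dist_eq_norm, not_le] at hzδ
      rw [dslope_of_ne _ hne, slope_def_field, norm_div]
      have h1 : ‖f z - f w‖ / ‖z - w‖ ≤ (‖f z‖ + ‖f w‖) / δ :=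
        div_le_div₀ (by positivity) (norm_sub_le _ _) hδ hzδ.le
      have h2 : (‖f z - f w‖ / ‖z - w‖) ^ 2 ≤ ((‖f z‖ + ‖f w‖) / δ) ^ 2 := by gcongr
      have h3 : ((‖f z‖ + ‖f w‖) / δ) ^ 2 ≤ 2 * (‖f w‖ / δ) ^ 2 + 2 * (δ ^ 2)⁻¹ * ‖f z‖ ^ 2 := by
        have := sq_nonneg (‖f z‖ / δ - ‖f w‖ / δ)
        rw [add_div]
        have e : 2 * (δ ^ 2)⁻¹ * ‖f z‖ ^ 2 = 2 * (‖f z‖ / δ) ^ 2 := by field_simp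
        rw [e]
        nlinarith
      nlinarith [sq_nonneg C]
  · simp only [Pi.add_apply, indicator_of_notMem hz, norm_zero]
    have : 0 ≤ (ball b R).indicator (fun _ : ℂ => C ^ 2 + 2 * (‖f w‖ / δ) ^ 2) z :=
      indicator_nonneg (fun _ _ => by positivity) _
    linarith [sq_nonneg (0:ℝ), (by norm_num : (0:ℝ) ^ 2 = 0)]

lemma half_le_re_div_sub {x y : ℂ} (h : ‖y‖ < ‖x‖) : 1 / 2 ≤ (x / (x - y)).re := by
  have hne : x - y ≠ 0 := fun h0 => by rw [sub_eq_zero.1 h0] at h; exact lt_irrefl _ h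
  have hpos : 0 < Complex.normSq (x - y) := Complex.normSq_pos.2 hne
  rw [Complex.div_re, ← add_div, le_div_iff₀ hpos]
  have h2 : Complex.normSq y ≤ Complex.normSq x := by
    rw [Complex.normSq_eq_norm_sq, Complex.normSq_eq_norm_sq]; gcongr
  simp only [Complex.normSq_apply, Complex.sub_re, Complex.sub_im] at *
  nlinarith

/-- Square-integrable holomorphic functions extend locally across the `-∞` set of a subharmonic
function. -/
lemma exists_local_extension {u : ℂ → EReal} {Ω : Set ℂ} (hu : SubharmonicOn u Ω) {M : ℝ} {b : ℂ}
    {R R' : ℝ} (hR : 0 < R) (hRR' : R < R') (hΩ : ball b R' ⊆ Ω)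
    (hM : ∀ w ∈ ball b R', u w ≤ (M : EReal)) {K : Set ℂ} (hK : IsCompact K)
    (hKb : K ⊆ closedBall b R) (hKu : ∀ z ∈ K, u z = ⊥) {f : ℂ → ℂ}
    (hf : DifferentiableOn ℂ f (ball b R \ K))
    (hf2 : IntegrableOn (fun z => ‖f z‖ ^ 2) (ball b R \ K)) :
    ∃ F : ℂ → ℂ, DifferentiableOn ℂ F (ball b (R / 3)) ∧ EqOn F f (ball b (R / 3) \ K) := by
  set W := ball b R \ K with hWdef
  have hW : IsOpen W := isOpen_ball.sdiff hK.isClosed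
  have hKnull : volume K = 0 := measure_mono_null
    (show K ⊆ {z | z ∈ Ω ∧ u z = ⊥} from
      fun z hz => ⟨hΩ (closedBall_subset_ball hRR' (hKb hz)), hKu z hz⟩) hu.volume_bot
  set f₀ := W.indicator f with hf₀
  have hf₀m : Measurable f₀ := measurable_indicator_of_continuousOn hW hf.continuousOn
  have hf₀2 : Integrable fun z => ‖f₀ z‖ ^ 2 := by
    rw [← integrable_indicator_iff hW.measurableSet] at hf2
    refine hf2.congr (Eventually.of_forall fun z => ?_)
    by_cases hz : z ∈ W <;> simp [f₀, hz]
  have hoff : ∀ (g : ℂ → ℂ), ∀ z ∉ ball b R, W.indicator g z = 0 := fun g z hz =>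
    indicator_of_notMem (fun h => hz h.1) _
  have hf₀i : Integrable f₀ := integrable_of_sq hf₀m hf₀2 (hoff f)
  set A := ball b (2 * R / 3) \ ball b (R / 3) with hA
  have hAm : MeasurableSet A := measurableSet_ball.diff measurableSet_ball
  have hAfin : volume A ≠ ⊤ := ((measure_mono sdiff_subset).trans_lt measure_ball_lt_top).ne
  have hAlow : ∀ z ∈ A, R / 3 ≤ ‖z - b‖ := fun z hz => by
    have := hz.2
    rwa [mem_ball, dist_eq_norm, not_lt] at this
  have hAb : ∀ z ∈ A, ‖z - b‖ ≤ R := fun z hz => by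
    have := hz.1
    rw [mem_ball, dist_eq_norm] at this
    linarith
  have hcont : Continuous fun z : ℂ => z - b := by fun_prop
  have i1 : IntegrableOn (fun z => f₀ z * (z - b)) A := by
    refine (hf₀i.norm.mul_const R).integrableOn.mono' (hf₀m.mul hcont.measurable).aestronglyMeasurable ?_
    filter_upwards [ae_restrict_mem hAm] with z hz
    rw [norm_mul]
    exact mul_le_mul_of_nonneg_left (hAb z hz) (norm_nonneg _)
  have i2 : IntegrableOn (fun z => z - b) A :=
    (hcont.continuousOn.integrableOn_compact (isCompact_closedBall b (2 * R / 3))).mono_set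
      (sdiff_subset.trans ball_subset_closedBall)
  set N := fun w => ∫ z in A, f₀ z * (z - b) / (z - w) with hN
  set Q := fun w => ∫ z in A, (z - b) / (z - w) with hQ
  have hNd : DifferentiableOn ℂ N (ball b (R / 3)) := differentiableOn_integral_div_sub hAm i1 hAlow
  have hQd : DifferentiableOn ℂ Q (ball b (R / 3)) := differentiableOn_integral_div_sub hAm i2 hAlow
  have hdiv : ∀ g : ℂ → ℂ, IntegrableOn g A → ∀ w ∈ ball b (R / 3),
      IntegrableOn (fun z => g z / (z - w)) A := fun g hg w hw => by
    rw [mem_ball, dist_eq_norm] at hw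
    refine (hg.norm.mul_const (R / 3 - ‖w - b‖)⁻¹).mono' ?_ ?_
    · simp_rw [div_eq_mul_inv]
      exact hg.aestronglyMeasurable.mul
        (by fun_prop : Measurable fun z : ℂ => (z - w)⁻¹).aestronglyMeasurable
    · filter_upwards [ae_restrict_mem hAm] with z hz
      rw [norm_div, div_eq_mul_inv]
      have := norm_sub_le_norm_sub_add_norm_sub z w b
      have := hAlow z hz
      gcongr
      linarith
  have hQ0 : ∀ w ∈ ball b (R / 3), Q w ≠ 0 := fun w hw h0 => by
    have hint := hdiv _ i2 w hw
    have hre : (Q w).re = ∫ z in A, ((z - b) / (z - w)).re := by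
      have := Complex.reCLM.integral_comp_comm hint
      exact this.symm
    have hpos : 0 < volume.real A := by
      refine ENNReal.toReal_pos (ne_of_gt ?_) hAfin
      refine (measure_ball_pos volume (b + (R / 2 : ℝ)) (by linarith : 0 < R / 6)).trans_le
        (measure_mono fun z hz => ?_)
      rw [mem_ball, dist_eq_norm] at hz
      have e : z - b = z - (b + (R / 2 : ℝ)) + (R / 2 : ℝ) := by ring
      have hn : ‖((R / 2 : ℝ) : ℂ)‖ = R / 2 := by
        rw [Complex.norm_real, Real.norm_eq_abs, abs_of_pos (by linarith)]
      refine ⟨?_, ?_⟩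
      · rw [mem_ball, dist_eq_norm, e]
        refine (norm_add_le _ _).trans_lt ?_
        rw [hn]; linarith
      · rw [mem_ball, dist_eq_norm, not_lt, e]
        have := norm_sub_le_norm_add (R / 2 : ℂ) (z - (b + (R / 2 : ℝ)))
        push_cast at this hn hz ⊢
        rw [add_comm (R / 2 : ℂ)] at this
        linarith
    have hle : ∫ _ in A, (1 / 2 : ℝ) ≤ ∫ z in A, ((z - b) / (z - w)).re := by
      refine setIntegral_mono_on (integrableOn_const hAfin) hint.re hAm fun z hz => ?_
      have := half_le_re_div_sub (x := z - b) (y := w - b) (by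
        rw [mem_ball, dist_eq_norm] at hw
        exact hw.trans_le (hAlow z hz))
      rwa [sub_sub_sub_cancel_right] at this
    rw [← hre, h0, setIntegral_const, Complex.zero_re, smul_eq_mul] at hle
    linarith
  refine ⟨fun w => N w / Q w, hNd.div hQd hQ0, fun w hw => ?_⟩
  have hwW : w ∈ W := ⟨ball_subset_ball (by linarith) hw.1, hw.2⟩
  simp only
  rw [div_eq_iff (hQ0 w hw.1)]
  set h := W.indicator (dslope f w) with hh
  have hd : DifferentiableOn ℂ (dslope f w) W :=
    (Complex.differentiableOn_dslope (hW.mem_nhds hwW)).2 hf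
  have hhm : Measurable h := measurable_indicator_of_continuousOn hW hd.continuousOn
  have hh2 : Integrable fun z => ‖h z‖ ^ 2 := integrable_sq_dslope hW sdiff_subset hf hf2 hwW
  have hhi : Integrable h := integrable_of_sq hhm hh2 (hoff _)
  have hhd : DifferentiableOn ℂ h W := hd.congr fun z hz => indicator_of_mem hz _
  have z1 := setIntegral_ball_mul_sub_eq_zero hu (by linarith : 0 < R / 3) (by linarith) hRR' hΩ hM hK
    hKb hKu hhm hhi hh2 (hoff _) hhd
  have z2 := setIntegral_ball_mul_sub_eq_zero hu (by linarith : 0 < 2 * R / 3) (by linarith) hRR' hΩ hM hK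
    hKb hKu hhm hhi hh2 (hoff _) hhd
  have hhb : IntegrableOn (fun z => h z * (z - b)) (ball b (2 * R / 3)) := by
    refine (hhi.norm.mul_const R).integrableOn.mono' (hhm.mul hcont.measurable).aestronglyMeasurable ?_
    filter_upwards [ae_restrict_mem measurableSet_ball] with z hz
    rw [norm_mul]
    rw [mem_ball, dist_eq_norm] at hz
    exact mul_le_mul_of_nonneg_left (by linarith) (norm_nonneg _)
  have z3 : ∫ z in A, h z * (z - b) = 0 := by
    rw [hA, setIntegral_sdiff measurableSet_ball hhb (ball_subset_ball (by linarith)), z1, z2, sub_zero]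
  have heq : ∫ z in A, h z * (z - b) = N w - f w * Q w := by
    rw [hN, hQ]
    simp only
    rw [← integral_const_mul, ← integral_sub (hdiv _ i1 w hw.1) ((hdiv _ i2 w hw.1).const_mul _)]
    refine setIntegral_congr_ae hAm ?_
    filter_upwards [measure_eq_zero_iff_ae_notMem.1 hKnull] with z hzK hzA
    have hzW : z ∈ W := ⟨ball_subset_ball (by linarith) hzA.1, hzK⟩
    have hne : z ≠ w := fun h => hzA.2 (h ▸ hw.1)
    have hne' : z - w ≠ 0 := sub_ne_zero.2 hne
    simp only [hh, hf₀, indicator_of_mem hzW]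
    rw [dslope_of_ne _ hne, slope_def_field]
    field_simp
  rw [z3] at heq
  exact (sub_eq_zero.1 heq.symm)

end LocalExtension

theorem PolarSet.volume_eq_zero {E : Set ℂ} (hE : PolarSet E) : volume E = 0 := by
  obtain ⟨Ω, hEΩ, u, hu, hbot⟩ := hE
  exact measure_mono_null (show E ⊆ {z | z ∈ Ω ∧ u z = ⊥} from
    fun z hz => ⟨hEΩ hz, hbot z hz⟩) hu.volume_bot

theorem subset_closure_of_volume_eq_zero {D U : Set ℂ} (hU : IsOpen U) (h0 : volume (U \ D) = 0) :
    U ⊆ closure D := fun z hz => by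
  refine mem_closure_iff.2 fun O hO hzO => ?_
  by_contra hne
  have hsub : O ∩ U ⊆ U \ D := fun w hw => ⟨hw.2, fun hwD => hne ⟨w, hw.1, hwD⟩⟩
  exact ((hO.inter hU).measure_pos volume ⟨z, hzO, hz⟩).ne' (measure_mono_null hsub h0)

theorem exists_ball_extension_of_polarSet {D U : Set ℂ} (hD : IsOpen D) (hU : IsOpen U)
    (hP : PolarSet (U \ D)) {f : ℂ → ℂ} (hf : f ∈ L2h D) {b : ℂ} (hb : b ∈ U \ D) :
    ∃ r : ℝ, 0 < r ∧ ball b r ⊆ U ∧ ∃ F : ℂ → ℂ, DifferentiableOn ℂ F (ball b r) ∧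
      EqOn F f (ball b r ∩ D) := by
  obtain ⟨Ω, hEΩ, u, hu, hbot⟩ := hP
  obtain ⟨R, hR, M, hRΩ, hM⟩ := hu.exists_ball_le (hEΩ hb)
  obtain ⟨R₁, hR₁, hRU⟩ := Metric.isOpen_iff.1 hU b hb.1
  have hm : 0 < min R R₁ := lt_min hR hR₁
  set s := min R R₁ / 2 with hs
  have hs0 : 0 < s := by positivity
  have hsm : s < min R R₁ := by linarith
  have hsub : ball b s \ (closedBall b s \ D) ⊆ D := fun z hz => by
    by_contra hzD
    exact hz.2 ⟨ball_subset_closedBall hz.1, hzD⟩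
  have hKU : closedBall b s ⊆ U :=
    (closedBall_subset_ball (hsm.trans_le (min_le_right _ _))).trans hRU
  obtain ⟨F, hF, hFf⟩ := exists_local_extension hu hs0 hsm
    ((ball_subset_ball (min_le_left _ _)).trans hRΩ)
    (fun w hw => hM w (ball_subset_ball (min_le_left _ _) hw))
    ((isCompact_closedBall b s).diff hD) sdiff_subset
    (fun z hz => hbot z ⟨hKU hz.1, hz.2⟩) (hf.1.mono hsub) (hf.2.mono_set hsub)
  refine ⟨s / 3, by positivity, ?_, F, hF, fun z hz => hFf ⟨hz.1, fun h => h.2 hz.2⟩⟩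
  exact (ball_subset_closedBall.trans (closedBall_subset_closedBall (by linarith))).trans hKU

theorem exists_extension_of_polarSet {D U : Set ℂ} (hD : IsOpen D) (hU : IsOpen U)
    (hP : PolarSet (U \ D)) {f : ℂ → ℂ} (hf : f ∈ L2h D) :
    ∃ F : ℂ → ℂ, DifferentiableOn ℂ F (D ∪ U) ∧ EqOn F f D := by
  classical
  have hcl := subset_closure_of_volume_eq_zero hU hP.volume_eq_zero
  have hloc := fun b (hb : b ∈ U \ D) => exists_ball_extension_of_polarSet hD hU hP hf hb
  choose! r hr hrU G hG hGf using hloc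
  set F : ℂ → ℂ := fun z => if z ∈ D then f z else G z z with hF
  have hFD : EqOn F f D := fun z hz => if_pos hz
  have hFG : ∀ b ∈ U \ D, EqOn F (G b) (ball b (r b)) := fun b hb z hz => by
    by_cases hzD : z ∈ D
    · rw [hFD hzD, hGf b hb ⟨hz, hzD⟩]
    have hzU : z ∈ U \ D := ⟨hrU b hb hz, hzD⟩
    have hzz : z ∈ ball z (r z) := mem_ball_self (hr z hzU)
    have : NeBot (nhdsWithin z D) := mem_closure_iff_nhdsWithin_neBot.1 (hcl hzU.1)
    have h1 : Tendsto (G z) (nhdsWithin z D) (nhds (G z z)) :=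
      ((hG z hzU).continuousOn.continuousAt (isOpen_ball.mem_nhds hzz)).mono_left nhdsWithin_le_nhds
    have h2 : Tendsto (G b) (nhdsWithin z D) (nhds (G b z)) :=
      ((hG b hb).continuousOn.continuousAt (isOpen_ball.mem_nhds hz)).mono_left nhdsWithin_le_nhds
    rw [show F z = G z z from if_neg hzD]
    refine tendsto_nhds_unique_of_eventuallyEq h1 h2 ?_
    filter_upwards [self_mem_nhdsWithin, nhdsWithin_le_nhds (isOpen_ball.mem_nhds hzz),
      nhdsWithin_le_nhds (isOpen_ball.mem_nhds hz)] with w hw hw1 hw2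
    rw [hGf z hzU ⟨hw1, hw⟩, hGf b hb ⟨hw2, hw⟩]
  refine ⟨F, fun z hz => ?_, hFD⟩
  by_cases hzD : z ∈ D
  · exact (((hf.1.congr hFD).differentiableAt (hD.mem_nhds hzD))).differentiableWithinAt
  have hzU : z ∈ U \ D := ⟨hz.resolve_left hzD, hzD⟩
  exact (((hG z hzU).congr (hFG z hzU)).differentiableAt
    (isOpen_ball.mem_nhds (mem_ball_self (hr z hzU)))).differentiableWithinAt

/-- A set on which, for every `ε > 0`, some monic polynomial of positive degree `d` with simple
roots in the set is bounded by `ε ^ d`. -/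
def ChebyshevNull (K : Set ℂ) : Prop :=
  ∀ ε : ℝ, 0 < ε → ∃ S : Finset ℂ, S.Nonempty ∧ (S : Set ℂ) ⊆ K ∧
    ∀ z ∈ K, ∏ w ∈ S, ‖z - w‖ ≤ ε ^ S.card

theorem exists_leja_sequence {K : Set ℂ} (hne : K.Nonempty) (hK : ¬ ChebyshevNull K) :
    ∃ c : ℝ, 0 < c ∧ ∃ z : ℕ → ℂ, (∀ n, z n ∈ K) ∧ Function.Injective z ∧
      ∀ n, c ^ n ≤ ∏ j ∈ Finset.range n, ‖z n - z j‖ := by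
  classical
  unfold ChebyshevNull at hK
  push Not at hK
  obtain ⟨c, hc, hS⟩ := hK
  have hS' : ∀ S : Finset ℂ, (S : Set ℂ) ⊆ K → ∃ z ∈ K, c ^ S.card ≤ ∏ w ∈ S, ‖z - w‖ := by
    intro S hSK
    rcases S.eq_empty_or_nonempty with rfl | hn
    · obtain ⟨z, hz⟩ := hne
      exact ⟨z, hz, by simp⟩
    · obtain ⟨z, hz, h⟩ := hS S hn hSK
      exact ⟨z, hz, h.le⟩
  choose! g hgK hg using hS'
  let S : ℕ → Finset ℂ := fun n => Nat.rec (motive := fun _ => Finset ℂ) ∅ (fun _ T => insert (g T) T) n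
  have hsucc : ∀ n, S (n + 1) = insert (g (S n)) (S n) := fun n => rfl
  have hSK : ∀ n, (↑(S n) : Set ℂ) ⊆ K := fun n => by
    induction n with
    | zero => simp [S]
    | succ n ih =>
      rw [hsucc, Finset.coe_insert]
      exact insert_subset (hgK _ ih) ih
  have hnot : ∀ n, g (S n) ∉ S n := fun n h => by
    have h1 := hg _ (hSK n)
    rw [Finset.prod_eq_zero h (by simp)] at h1
    exact absurd h1 (not_le.2 (pow_pos hc _))
  have himg : ∀ n, S n = (Finset.range n).image fun k => g (S k) := fun n => by
    induction n with
    | zero => simp [S]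
    | succ n ih => rw [hsucc, Finset.range_add_one, Finset.image_insert, ← ih]
  have hinj : Function.Injective fun k => g (S k) := by
    refine Function.Injective.of_lt_imp_ne fun j k hjk h => hnot k ?_
    have hmem := Finset.mem_image_of_mem (fun k => g (S k)) (Finset.mem_range.2 hjk)
    rw [← himg k] at hmem
    exact h ▸ hmem
  refine ⟨c, hc, fun k => g (S k), fun n => hgK _ (hSK n), hinj, fun n => ?_⟩
  have h1 := hg _ (hSK n)
  have hprod : ∏ w ∈ S n, ‖g (S n) - w‖ = ∏ j ∈ Finset.range n, ‖g (S n) - g (S j)‖ := by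
    generalize g (S n) = p
    rw [himg n, Finset.prod_image fun x _ y _ h => hinj h]
  have hcard : (S n).card = n := by
    rw [himg n, Finset.card_image_of_injective _ hinj, Finset.card_range]
  rwa [hprod, hcard] at h1

theorem sum_neg_log_le_of_pow_le_prod {c : ℝ} (hc : 0 < c) {n : ℕ} {x : ℕ → ℝ}
    (hx : ∀ j ∈ Finset.range n, 0 < x j) (h : c ^ n ≤ ∏ j ∈ Finset.range n, x j) :
    ∑ j ∈ Finset.range n, -Real.log (x j) ≤ n * -Real.log c := by
  have h1 := Real.log_le_log (pow_pos hc n) h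
  rw [Real.log_pow, Real.log_prod fun j hj => (hx j hj).ne'] at h1
  rw [Finset.sum_neg_distrib]
  linarith

theorem mul_sq_le_sum_sq_of_pow_le_prod {c : ℝ} (hc : 0 < c) {n : ℕ} {x : ℕ → ℝ}
    (hx : ∀ j ∈ Finset.range n, 0 < x j) (h : c ^ n ≤ ∏ j ∈ Finset.range n, x j) :
    n * c ^ 2 ≤ ∑ j ∈ Finset.range n, x j ^ 2 := by
  have h0 := sum_neg_log_le_of_pow_le_prod hc hx h
  have h1 : ∀ j ∈ Finset.range n, 2 * Real.log (x j) - 2 * Real.log c + 1 ≤ x j ^ 2 / c ^ 2 :=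
    fun j hj => by
      have hxj := hx j hj
      have := Real.log_le_sub_one_of_pos (show 0 < x j ^ 2 / c ^ 2 by positivity)
      rw [Real.log_div (by positivity) (by positivity), Real.log_pow, Real.log_pow] at this
      push_cast at this
      linarith
  have h2 := Finset.sum_le_sum h1
  rw [Finset.sum_add_distrib, Finset.sum_sub_distrib, ← Finset.mul_sum, ← Finset.sum_div] at h2
  simp only [Finset.sum_const, Finset.card_range, nsmul_eq_mul, mul_one] at h2
  rw [Finset.sum_neg_distrib] at h0
  rw [← le_div_iff₀ (by positivity)]
  linarith

/-- Montel's theorem along an ultrafilter. -/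
theorem exists_differentiableOn_tendsto_of_locally_bounded {ι : Type*} (l : Ultrafilter ι)
    {F : ι → ℂ → ℂ} {W : Set ℂ} (hW : IsOpen W) (hF : ∀ i, DifferentiableOn ℂ (F i) W)
    (hb : ∀ w ∈ W, ∃ r : ℝ, 0 < r ∧ ball w r ⊆ W ∧ ∃ M : ℝ, ∀ i, ∀ v ∈ ball w r, ‖F i v‖ ≤ M) :
    ∃ f : ℂ → ℂ, DifferentiableOn ℂ f W ∧
      TendstoLocallyUniformlyOn F f l W := by
  have hlim : ∀ w ∈ W, ∃ y, Tendsto (fun i => F i w) l (nhds y) := fun w hw => by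
    obtain ⟨r, hr, -, M, hM⟩ := hb w hw
    obtain ⟨y, -, hy⟩ := (isCompact_closedBall (0 : ℂ) M).ultrafilter_le_nhds
      (l.map fun i => F i w) (le_principal_iff.2 (Eventually.of_forall (f := (l : Filter ι))
        fun i => mem_closedBall_zero_iff.2 (hM i w (mem_ball_self hr))))
    exact ⟨y, hy⟩
  choose! f hf using hlim
  suffices h : TendstoLocallyUniformlyOn F f l W from
    ⟨f, h.differentiableOn (Eventually.of_forall hF) hW, h⟩
  refine Metric.tendstoLocallyUniformlyOn_iff.2 fun ε hε w hw => ?_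
  obtain ⟨r, hr, hrW, M, hM⟩ := hb w hw
  have hlip : ∀ i, ∀ v ∈ ball w r, dist (F i v) (F i w) ≤ 2 * M / r * dist v w := fun i v hv =>
    Complex.dist_le_div_mul_dist_of_mapsTo_ball ((hF i).mono hrW) (fun v' hv' => by
      rw [mem_closedBall, dist_eq_norm]
      have := norm_sub_le (F i v') (F i w)
      linarith [hM i v' hv', hM i w (mem_ball_self hr)]) hv
  have hlipf : ∀ v ∈ ball w r, dist (f v) (f w) ≤ 2 * M / r * dist v w := fun v hv =>
    le_of_tendsto ((hf v (hrW hv)).dist (hf w hw)) (Eventually.of_forall fun i => hlip i v hv)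
  have hsmall : ∀ᶠ v in nhds w, 2 * M / r * dist v w < ε / 3 := by
    have : Tendsto (fun v => 2 * M / r * dist v w) (nhds w) (nhds (2 * M / r * dist w w)) :=
      Continuous.tendsto (by fun_prop) w
    rw [dist_self, mul_zero] at this
    exact this.eventually_lt_const (by positivity)
  refine ⟨_, nhdsWithin_le_nhds (inter_mem hsmall (ball_mem_nhds w hr)), ?_⟩
  have hw3 := Metric.tendsto_nhds.1 (hf w hw) (ε / 3) (by positivity)
  filter_upwards [hw3] with i hi v hv
  have h1 := hlip i v hv.2
  have h2 := hlipf v hv.2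
  have h3 : 2 * M / r * dist v w < ε / 3 := hv.1
  have h4 := dist_triangle4 (f v) (f w) (F i w) (F i v)
  rw [dist_comm (f w), dist_comm (F i w) (F i v)] at h4
  linarith

/-- The symmetrised sum
`n⁻² ∑_{j < k < n} |z k - z j|² / ((w - z j) (w - z k))`. -/
noncomputable def pairSum (z : ℕ → ℂ) (n : ℕ) (w : ℂ) : ℂ :=
  ((n : ℂ) ^ 2)⁻¹ * ∑ k ∈ Finset.range n, ∑ j ∈ Finset.range k,
    ((‖z k - z j‖ ^ 2 : ℝ) : ℂ) / ((w - z j) * (w - z k))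

theorem sum_sum_add_le {x : ℕ → ℝ} (hx : ∀ j, 0 ≤ x j) (n : ℕ) :
    ∑ k ∈ Finset.range n, ∑ j ∈ Finset.range k, (x j + x k) ≤ n * ∑ j ∈ Finset.range n, x j := by
  induction n with
  | zero => simp
  | succ n ih =>
    rw [Finset.sum_range_succ, Finset.sum_range_succ x, Finset.sum_add_distrib (s := Finset.range n)
      (f := x), Finset.sum_const, Finset.card_range, nsmul_eq_mul]
    push_cast
    linarith [hx n]

theorem norm_pairSum_le {z : ℕ → ℂ} (hz : ∀ j k, ‖z k - z j‖ ≤ 1) (n : ℕ) (w : ℂ) :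
    ‖pairSum z n w‖ ≤ (n : ℝ)⁻¹ * ∑ j ∈ Finset.range n, ‖w - z j‖⁻¹ := by
  have hterm : ∀ j k, ‖((‖z k - z j‖ ^ 2 : ℝ) : ℂ) / ((w - z j) * (w - z k))‖ ≤
      ‖w - z j‖⁻¹ + ‖w - z k‖⁻¹ := fun j k => by
    rw [norm_div, norm_mul, Complex.norm_real, Real.norm_of_nonneg (by positivity)]
    rcases eq_or_lt_of_le (norm_nonneg (w - z j)) with h0 | hj
    · rw [← h0]; simp
    rcases eq_or_lt_of_le (norm_nonneg (w - z k)) with h0 | hk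
    · rw [← h0]; simp
    have htri : ‖z k - z j‖ ≤ ‖w - z j‖ + ‖w - z k‖ := by
      have := norm_sub_le (w - z j) (w - z k)
      rwa [show w - z j - (w - z k) = z k - z j by ring] at this
    have hsq : ‖z k - z j‖ ^ 2 ≤ ‖z k - z j‖ := by
      nlinarith [norm_nonneg (z k - z j), hz j k]
    rw [div_le_iff₀ (by positivity)]
    have : (‖w - z j‖⁻¹ + ‖w - z k‖⁻¹) * (‖w - z j‖ * ‖w - z k‖) = ‖w - z k‖ + ‖w - z j‖ := by
      field_simp
    linarith
  rcases n.eq_zero_or_pos with rfl | hn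
  · simp [pairSum]
  have hn' : (0 : ℝ) < n := by exact_mod_cast hn
  have h1 := (norm_sum_le (Finset.range n) fun k => ∑ j ∈ Finset.range k,
    ((‖z k - z j‖ ^ 2 : ℝ) : ℂ) / ((w - z j) * (w - z k))).trans
    (Finset.sum_le_sum fun k _ => (norm_sum_le _ _).trans
      (Finset.sum_le_sum fun j _ => hterm j k))
  have h2 := h1.trans (sum_sum_add_le (fun j => inv_nonneg.2 (norm_nonneg (w - z j))) n)
  rw [pairSum, norm_mul, norm_inv, norm_pow, Complex.norm_natCast]
  calc _ ≤ ((n : ℝ) ^ 2)⁻¹ * (n * ∑ j ∈ Finset.range n, ‖w - z j‖⁻¹) := by gcongr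
    _ = _ := by field_simp

theorem sum_range_card_le (n : ℕ) : ∑ k ∈ Finset.range n, (k : ℝ) ≤ (n : ℝ) ^ 2 := by
  calc ∑ k ∈ Finset.range n, (k : ℝ) ≤ ∑ k ∈ Finset.range n, (n : ℝ) :=
        Finset.sum_le_sum fun k hk => by exact_mod_cast (Finset.mem_range.1 hk).le
    _ = (n : ℝ) ^ 2 := by simp [sq]

theorem norm_pairSum_le_of_dist {z : ℕ → ℂ} (hz : ∀ j k, ‖z k - z j‖ ≤ 1) {d : ℝ} (hd : 0 < d)
    {w : ℂ} (hw : ∀ j, d ≤ ‖w - z j‖) (n : ℕ) : ‖pairSum z n w‖ ≤ (d ^ 2)⁻¹ := by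
  have hterm : ∀ j k, ‖((‖z k - z j‖ ^ 2 : ℝ) : ℂ) / ((w - z j) * (w - z k))‖ ≤ (d ^ 2)⁻¹ :=
      fun j k => by
    rw [norm_div, norm_mul, Complex.norm_real, Real.norm_of_nonneg (by positivity), ← one_div, sq d]
    have := hw j
    have := hw k
    gcongr
    exact pow_le_one₀ (norm_nonneg _) (hz j k)
  rcases n.eq_zero_or_pos with rfl | hn
  · simp [pairSum]; positivity
  have hn' : (0 : ℝ) < n := by exact_mod_cast hn
  have h1 := (norm_sum_le (Finset.range n) fun k => ∑ j ∈ Finset.range k,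
    ((‖z k - z j‖ ^ 2 : ℝ) : ℂ) / ((w - z j) * (w - z k))).trans
    (Finset.sum_le_sum fun k _ => (norm_sum_le _ _).trans
      (Finset.sum_le_sum fun j _ => hterm j k))
  simp only [Finset.sum_const, Finset.card_range, nsmul_eq_mul] at h1
  rw [← Finset.sum_mul] at h1
  rw [pairSum, norm_mul, norm_inv, norm_pow, Complex.norm_natCast]
  calc _ ≤ ((n : ℝ) ^ 2)⁻¹ * ((n : ℝ) ^ 2 * (d ^ 2)⁻¹) := by
        gcongr
        exact h1.trans (by gcongr; exact sum_range_card_le n)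
    _ = _ := by field_simp

theorem differentiableOn_pairSum {z : ℕ → ℂ} {W : Set ℂ} (hW : ∀ j, z j ∉ W) (n : ℕ) :
    DifferentiableOn ℂ (pairSum z n) W := by
  unfold pairSum
  refine DifferentiableOn.const_mul (DifferentiableOn.fun_sum fun k _ =>
    DifferentiableOn.fun_sum fun j _ => ?_) _
  refine DifferentiableOn.div (by fun_prop) (by fun_prop) fun w hw => ?_
  exact mul_ne_zero (sub_ne_zero.2 fun h => hW j (h ▸ hw)) (sub_ne_zero.2 fun h => hW k (h ▸ hw))

/-- The radial majorant `3 / (s (s + δ))` on `|x| < 2`. -/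
noncomputable def radialKernel (δ : ℝ) (x : ℂ) : ℝ :=
  (Iio 2).indicator (fun s : ℝ => 3 / (s * (s + δ))) ‖x‖

theorem radialKernel_nonneg {δ : ℝ} (hδ : 0 < δ) (x : ℂ) : 0 ≤ radialKernel δ x :=
  indicator_apply_nonneg fun _ => by positivity

theorem mul_indicator_eq {δ : ℝ} (y : ℝ) (hy : y ∈ Ioi (0 : ℝ)) :
    y ^ (Module.finrank ℝ ℂ - 1) • (Iio 2).indicator (fun s : ℝ => 3 / (s * (s + δ))) y =
      (Ioo 0 2).indicator (fun s : ℝ => 3 * (s + δ)⁻¹) y := by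
  have hy' : (0 : ℝ) < y := hy
  rw [Complex.finrank_real_complex]
  by_cases h : y < 2
  · rw [indicator_of_mem (show y ∈ Iio (2 : ℝ) from h), indicator_of_mem (show y ∈ Ioo (0 : ℝ) 2 from ⟨hy', h⟩)]
    simp only [smul_eq_mul]
    norm_num
    field_simp
  · rw [indicator_of_notMem (show y ∉ Iio (2 : ℝ) from h),
      indicator_of_notMem (show y ∉ Ioo (0 : ℝ) 2 from fun h' => h h'.2), smul_zero]

theorem integrableOn_inv_add {δ : ℝ} (hδ : 0 < δ) :
    IntegrableOn (fun s : ℝ => 3 * (s + δ)⁻¹) (Icc 0 2) := by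
  refine ContinuousOn.integrableOn_compact isCompact_Icc ?_
  refine ContinuousOn.mul continuousOn_const (ContinuousOn.inv₀ (by fun_prop) fun x hx => ?_)
  have := hx.1
  positivity

theorem integrable_radialKernel {δ : ℝ} (hδ : 0 < δ) : Integrable (radialKernel δ) := by
  unfold radialKernel
  rw [integrable_fun_norm_addHaar, integrableOn_congr_fun mul_indicator_eq measurableSet_Ioi]
  refine Integrable.integrableOn ?_
  rw [integrable_indicator_iff measurableSet_Ioo]
  exact (integrableOn_inv_add hδ).mono_set Ioo_subset_Icc_self

theorem integral_radialKernel {δ : ℝ} (hδ : 0 < δ) :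
    ∫ x, radialKernel δ x = 6 * Real.pi * Real.log ((2 + δ) / δ) := by
  unfold radialKernel
  rw [integral_fun_norm_addHaar, setIntegral_congr_fun measurableSet_Ioi mul_indicator_eq,
    setIntegral_indicator measurableSet_Ioo, inter_eq_self_of_subset_right
    (show Ioo (0 : ℝ) 2 ⊆ Ioi 0 from fun x hx => hx.1), ← integral_Ioc_eq_integral_Ioo,
    ← intervalIntegral.integral_of_le (by norm_num), intervalIntegral.integral_const_mul,
    intervalIntegral.integral_comp_add_right (fun x => x⁻¹), integral_inv_of_pos (by linarith)
    (by linarith), Complex.finrank_real_complex, zero_add, measureReal_def, Complex.volume_ball]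
  simp
  ring

theorem inv_mul_inv_le {δ α β : ℝ} (hα : 0 < α) (hβ : 0 < β) (hδ : 0 < δ) (h : δ ≤ α + β) :
    α⁻¹ * β⁻¹ ≤ 3 / (α * (α + δ)) + 3 / (β * (β + δ)) := by
  have key : ∀ {x y : ℝ}, 0 < x → 0 < y → δ ≤ x + y → x ≤ y → x⁻¹ * y⁻¹ ≤ 3 / (x * (x + δ)) :=
      fun {x y} hx hy hd hxy => by
    rw [← mul_inv, ← one_div, div_le_div_iff₀ (by positivity) (by positivity)]
    nlinarith [mul_le_mul_of_nonneg_left (show x + δ ≤ 3 * y by linarith) hx.le]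
  have p1 : 0 < 3 / (α * (α + δ)) := by positivity
  have p2 : 0 < 3 / (β * (β + δ)) := by positivity
  rcases le_total α β with hab | hab
  · linarith [key hα hβ h hab]
  · have := key hβ hα (by linarith) hab
    rw [mul_comm]
    linarith

theorem setIntegral_radialKernel_le {δ : ℝ} (hδ : 0 < δ) (ζ : ℂ) (L : Set ℂ) :
    IntegrableOn (fun w => radialKernel δ (w - ζ)) L ∧
    ∫ w in L, radialKernel δ (w - ζ) ≤ 6 * Real.pi * Real.log ((2 + δ) / δ) := by
  have hi := (integrable_radialKernel hδ).comp_sub_right ζ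
  refine ⟨hi.integrableOn, ?_⟩
  rw [← integral_radialKernel hδ, ← integral_sub_right_eq_self (radialKernel δ) ζ]
  exact setIntegral_le_integral hi (Eventually.of_forall fun x => radialKernel_nonneg hδ _)

theorem setIntegral_inv_mul_inv_le {ζ ζ' : ℂ} (hδ : 0 < ‖ζ - ζ'‖) (hδ1 : ‖ζ - ζ'‖ ≤ 1)
    {L : Set ℂ} (hL : IsCompact L) (h1 : ∀ w ∈ L, 0 < ‖w - ζ‖ ∧ ‖w - ζ‖ < 2)
    (h2 : ∀ w ∈ L, 0 < ‖w - ζ'‖ ∧ ‖w - ζ'‖ < 2) :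
    ∫ w in L, ‖w - ζ‖⁻¹ * ‖w - ζ'‖⁻¹ ≤
      12 * Real.pi * (Real.log 3 - Real.log ‖ζ - ζ'‖) := by
  set δ := ‖ζ - ζ'‖ with hδdef
  obtain ⟨i1, b1⟩ := setIntegral_radialKernel_le hδ ζ L
  obtain ⟨i2, b2⟩ := setIntegral_radialKernel_le hδ ζ' L
  have hc : IntegrableOn (fun w => ‖w - ζ‖⁻¹ * ‖w - ζ'‖⁻¹) L := by
    refine ContinuousOn.integrableOn_compact hL ?_
    exact ContinuousOn.mul (ContinuousOn.inv₀ (by fun_prop) fun w hw => (h1 w hw).1.ne')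
      (ContinuousOn.inv₀ (by fun_prop) fun w hw => (h2 w hw).1.ne')
  have hle : ∫ w in L, ‖w - ζ‖⁻¹ * ‖w - ζ'‖⁻¹ ≤
      ∫ w in L, (radialKernel δ (w - ζ) + radialKernel δ (w - ζ')) := by
    refine setIntegral_mono_on hc (i1.add i2) hL.measurableSet fun w hw => ?_
    unfold radialKernel
    rw [indicator_of_mem (show ‖w - ζ‖ ∈ Iio (2 : ℝ) from (h1 w hw).2),
      indicator_of_mem (show ‖w - ζ'‖ ∈ Iio (2 : ℝ) from (h2 w hw).2)]
    refine inv_mul_inv_le (h1 w hw).1 (h2 w hw).1 hδ ?_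
    have := norm_sub_le (w - ζ') (w - ζ)
    rw [show w - ζ' - (w - ζ) = ζ - ζ' by ring] at this
    linarith
  rw [integral_add i1 i2] at hle
  have hlog : Real.log ((2 + δ) / δ) ≤ Real.log 3 - Real.log δ := by
    rw [Real.log_div (by positivity) hδ.ne']
    gcongr
    linarith
  have := mul_le_mul_of_nonneg_left hlog (show 0 ≤ 12 * Real.pi by positivity)
  linarith

theorem sum_sum_eq_sum_add_two_mul {g : ℕ → ℕ → ℝ} (hg : ∀ j k, g j k = g k j) (n : ℕ) :
    ∑ k ∈ Finset.range n, ∑ j ∈ Finset.range n, g j k =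
      ∑ k ∈ Finset.range n, g k k + 2 * ∑ k ∈ Finset.range n, ∑ j ∈ Finset.range k, g j k := by
  induction n with
  | zero => simp
  | succ n ih =>
    simp only [Finset.sum_range_succ, Finset.sum_add_distrib]
    rw [ih, Finset.sum_congr rfl fun k _ => hg n k]
    ring

theorem norm_sub_le_one {z : ℕ → ℂ} {b : ℂ} (hzb : ∀ j, ‖z j - b‖ ≤ 1 / 2) (j k : ℕ) :
    ‖z k - z j‖ ≤ 1 := by
  have := norm_sub_le (z k - b) (z j - b)
  rw [show z k - b - (z j - b) = z k - z j by ring] at this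
  linarith [hzb j, hzb k]

theorem setIntegral_norm_pairSum_sq_le {z : ℕ → ℂ} {b : ℂ} {c : ℝ} (hc : 0 < c)
    (hzb : ∀ j, ‖z j - b‖ ≤ 1 / 2) (hinj : Function.Injective z)
    (hz : ∀ n, c ^ n ≤ ∏ j ∈ Finset.range n, ‖z n - z j‖) {L : Set ℂ} (hL : IsCompact L)
    (hLb : L ⊆ closedBall b 1) {d : ℝ} (hd : 0 < d) (hLd : ∀ w ∈ L, ∀ j, d ≤ ‖w - z j‖)
    {n : ℕ} (hn : 0 < n) :
    ∫ w in L, ‖pairSum z n w‖ ^ 2 ≤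
      volume.real L / (n * d ^ 2) + 24 * Real.pi * (Real.log 3 - Real.log c) := by
  have hn' : (0 : ℝ) < n := by exact_mod_cast hn
  have hz1 := norm_sub_le_one hzb
  have hzpos : ∀ {j k}, j ≠ k → 0 < ‖z k - z j‖ := fun {j k} h =>
    norm_pos_iff.2 (sub_ne_zero.2 fun h' => h (hinj h').symm)
  have hc1 : c ≤ 1 := by
    have := hz 1
    simp only [Finset.prod_range_one, pow_one] at this
    exact this.trans (hz1 0 1)
  have hCpos : 0 ≤ Real.log 3 - Real.log c := by
    have := Real.log_nonpos hc.le hc1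
    have := Real.log_nonneg (show (1 : ℝ) ≤ 3 by norm_num)
    linarith
  have hpos : ∀ w ∈ L, ∀ j, 0 < ‖w - z j‖ ∧ ‖w - z j‖ < 2 := fun w hw j => by
    refine ⟨hd.trans_le (hLd w hw j), ?_⟩
    have h1 := hLb hw
    rw [mem_closedBall, dist_eq_norm] at h1
    have := norm_sub_le (w - b) (z j - b)
    rw [show w - b - (z j - b) = w - z j by ring] at this
    linarith [hzb j]
  have hcx : ∀ j, ContinuousOn (fun w => ‖w - z j‖⁻¹) L := fun j =>
    ContinuousOn.inv₀ (by fun_prop) fun w hw => (hpos w hw j).1.ne'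
  have hi : ∀ j k, IntegrableOn (fun w => ‖w - z j‖⁻¹ * ‖w - z k‖⁻¹) L := fun j k =>
    ((hcx j).mul (hcx k)).integrableOn_compact hL
  have hi1 : ∀ k, IntegrableOn (fun w => ∑ j ∈ Finset.range n, ‖w - z j‖⁻¹ * ‖w - z k‖⁻¹) L :=
    fun k => integrable_finsetSum _ fun j _ => hi j k
  have hi2 : IntegrableOn (fun w => ∑ k ∈ Finset.range n, ∑ j ∈ Finset.range n,
      ‖w - z j‖⁻¹ * ‖w - z k‖⁻¹) L := integrable_finsetSum _ fun k _ => hi1 k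
  have hpt : ∀ w, ‖pairSum z n w‖ ^ 2 ≤ ((n : ℝ) ^ 2)⁻¹ * ∑ k ∈ Finset.range n,
      ∑ j ∈ Finset.range n, ‖w - z j‖⁻¹ * ‖w - z k‖⁻¹ := fun w => by
    have h1 := pow_le_pow_left₀ (norm_nonneg _) (norm_pairSum_le hz1 n w) 2
    refine h1.trans_eq ?_
    rw [mul_pow, inv_pow, sq (∑ j ∈ Finset.range n, _), Finset.sum_mul_sum, Finset.sum_comm]
  have hstep : ∫ w in L, ‖pairSum z n w‖ ^ 2 ≤ ((n : ℝ) ^ 2)⁻¹ * ∑ k ∈ Finset.range n,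
      ∑ j ∈ Finset.range n, ∫ w in L, ‖w - z j‖⁻¹ * ‖w - z k‖⁻¹ := by
    have e : ∫ w in L, ((n : ℝ) ^ 2)⁻¹ * ∑ k ∈ Finset.range n, ∑ j ∈ Finset.range n,
        ‖w - z j‖⁻¹ * ‖w - z k‖⁻¹ = ((n : ℝ) ^ 2)⁻¹ * ∑ k ∈ Finset.range n,
        ∑ j ∈ Finset.range n, ∫ w in L, ‖w - z j‖⁻¹ * ‖w - z k‖⁻¹ := by
      rw [integral_const_mul, integral_finsetSum _ fun k _ => hi1 k]
      congr 1
      exact Finset.sum_congr rfl fun k _ => integral_finsetSum _ fun j _ => hi j k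
    rw [← e]
    refine integral_mono_of_nonneg (Eventually.of_forall fun w => by positivity)
      (hi2.const_mul _) (Eventually.of_forall hpt)
  refine hstep.trans ?_
  rw [sum_sum_eq_sum_add_two_mul fun j k => by simp_rw [mul_comm]]
  have hdiag : ∀ k, ∫ w in L, ‖w - z k‖⁻¹ * ‖w - z k‖⁻¹ ≤ (d ^ 2)⁻¹ * volume.real L := fun k => by
    have : ∫ w in L, ‖w - z k‖⁻¹ * ‖w - z k‖⁻¹ ≤ ∫ w in L, (d ^ 2)⁻¹ := by
      refine setIntegral_mono_on (hi k k) (integrableOn_const hL.measure_lt_top.ne)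
        hL.measurableSet fun w hw => ?_
      have := hLd w hw k
      rw [← mul_inv, ← sq]
      gcongr
    rwa [setIntegral_const, smul_eq_mul, mul_comm] at this
  have hoff : ∀ k, ∑ j ∈ Finset.range k, ∫ w in L, ‖w - z j‖⁻¹ * ‖w - z k‖⁻¹ ≤
      k * (12 * Real.pi * (Real.log 3 - Real.log c)) := fun k => by
    have hx : ∀ j ∈ Finset.range k, 0 < ‖z k - z j‖ := fun j hj =>
      hzpos (Finset.mem_range.1 hj).ne
    have h1 := sum_neg_log_le_of_pow_le_prod hc hx (hz k)
    have h2 : ∀ j ∈ Finset.range k, ∫ w in L, ‖w - z j‖⁻¹ * ‖w - z k‖⁻¹ ≤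
        12 * Real.pi * (Real.log 3 + -Real.log ‖z k - z j‖) := fun j hj => by
      have := setIntegral_inv_mul_inv_le (hx j hj) (hz1 j k) hL (fun w hw => hpos w hw k)
        (fun w hw => hpos w hw j)
      simp_rw [mul_comm] at this ⊢
      linarith
    refine (Finset.sum_le_sum h2).trans ?_
    rw [← Finset.mul_sum, Finset.sum_add_distrib, Finset.sum_const, Finset.card_range, nsmul_eq_mul]
    have := mul_le_mul_of_nonneg_left h1 (show 0 ≤ 12 * Real.pi by positivity)
    linarith
  have s1 : ∑ k ∈ Finset.range n, ∫ w in L, ‖w - z k‖⁻¹ * ‖w - z k‖⁻¹ ≤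
      n * ((d ^ 2)⁻¹ * volume.real L) := by
    refine (Finset.sum_le_sum fun k _ => hdiag k).trans_eq ?_
    simp
  have s2 : ∑ k ∈ Finset.range n, ∑ j ∈ Finset.range k, ∫ w in L, ‖w - z j‖⁻¹ * ‖w - z k‖⁻¹ ≤
      (n : ℝ) ^ 2 * (12 * Real.pi * (Real.log 3 - Real.log c)) := by
    refine (Finset.sum_le_sum fun k _ => hoff k).trans ?_
    rw [← Finset.sum_mul]
    gcongr
    exact sum_range_card_le n
  calc _ ≤ ((n : ℝ) ^ 2)⁻¹ * (n * ((d ^ 2)⁻¹ * volume.real L) +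
        2 * ((n : ℝ) ^ 2 * (12 * Real.pi * (Real.log 3 - Real.log c)))) := by gcongr
    _ = _ := by field_simp; ring

theorem sq_div_four_le_sum_range {n : ℕ} (hn : 2 ≤ n) :
    (n : ℝ) ^ 2 / 4 ≤ ∑ k ∈ Finset.range n, (k : ℝ) := by
  induction n, hn using Nat.le_induction with
  | base => norm_num [Finset.sum_range_succ]
  | succ n hn ih =>
    rw [Finset.sum_range_succ]
    have : (2 : ℝ) ≤ n := by exact_mod_cast hn
    push_cast
    nlinarith

theorem re_sq_div_ge {a p q : ℂ} (hp : ‖p‖ ≤ ‖a‖ / 5) (hq : ‖q‖ ≤ ‖a‖ / 5) (ha : 0 < ‖a‖) :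
    1 / 4 ≤ (a ^ 2 / ((a - p) * (a - q))).re := by
  have aux : ∀ r : ℂ, ‖r‖ ≤ ‖a‖ / 5 → ‖a / (a - r) - 1‖ ≤ 1 / 4 := fun r hr => by
    have h1 : ‖a‖ * (4 / 5) ≤ ‖a - r‖ := by linarith [norm_sub_norm_le a r]
    have h2 : 0 < ‖a - r‖ := lt_of_lt_of_le (by positivity) h1
    have h3 : a / (a - r) - 1 = r / (a - r) := by
      have := norm_pos_iff.1 h2
      field_simp
      ring
    rw [h3, norm_div, div_le_iff₀ h2]
    linarith
  have hx := aux p hp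
  have hy := aux q hq
  rw [show a ^ 2 / ((a - p) * (a - q)) =
    1 + ((a / (a - p) - 1) * (a / (a - q) - 1) + (a / (a - p) - 1) + (a / (a - q) - 1)) by
      rw [sq, mul_div_mul_comm]; ring]
  set x := a / (a - p) - 1
  set y := a / (a - q) - 1
  have h1 : ‖x * y + x + y‖ ≤ 3 / 4 := by
    refine (norm_add₃_le).trans ?_
    rw [norm_mul]
    nlinarith [norm_nonneg x, norm_nonneg y]
  have h2 := (abs_le.1 (Complex.abs_re_le_norm (x * y + x + y))).1
  rw [Complex.add_re, Complex.one_re]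
  linarith

theorem le_re_sq_mul_pairSum {z : ℕ → ℂ} {b : ℂ} {c ρ : ℝ} (hρ : 0 < ρ)
    (hzb : ∀ j, ‖z j - b‖ ≤ ρ)
    (hz : ∀ k : ℕ, k * c ^ 2 ≤ ∑ j ∈ Finset.range k, ‖z k - z j‖ ^ 2) {w : ℂ}
    (hw : 5 * ρ ≤ ‖w - b‖) {n : ℕ} (hn : 2 ≤ n) :
    c ^ 2 / 16 ≤ ((w - b) ^ 2 * pairSum z n w).re := by
  have hn' : (0 : ℝ) < n := by exact_mod_cast (by omega : 0 < n)
  have hterm : ∀ j k, 1 / 4 * ‖z k - z j‖ ^ 2 ≤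
      ((w - b) ^ 2 * (((‖z k - z j‖ ^ 2 : ℝ) : ℂ) / ((w - z j) * (w - z k)))).re := fun j k => by
    have h1 := re_sq_div_ge (a := w - b) (p := z j - b) (q := z k - b)
      (by linarith [hzb j]) (by linarith [hzb k]) (by linarith)
    rw [sub_sub_sub_cancel_right, sub_sub_sub_cancel_right] at h1
    rw [mul_div_left_comm, Complex.re_ofReal_mul, mul_comm]
    gcongr
  have e : ((w - b) ^ 2 * pairSum z n w).re = ((n : ℝ) ^ 2)⁻¹ * ∑ k ∈ Finset.range n,
      ∑ j ∈ Finset.range k,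
        ((w - b) ^ 2 * (((‖z k - z j‖ ^ 2 : ℝ) : ℂ) / ((w - z j) * (w - z k)))).re := by
    rw [pairSum, mul_left_comm, show ((n : ℂ) ^ 2)⁻¹ = ((((n : ℝ) ^ 2)⁻¹ : ℝ) : ℂ) by push_cast; rfl,
      Complex.re_ofReal_mul]
    simp_rw [Finset.mul_sum, Complex.re_sum, Finset.mul_sum]
  rw [e]
  have h2 : (n : ℝ) ^ 2 * (c ^ 2 / 16) ≤ ∑ k ∈ Finset.range n, ∑ j ∈ Finset.range k,
        ((w - b) ^ 2 * (((‖z k - z j‖ ^ 2 : ℝ) : ℂ) / ((w - z j) * (w - z k)))).re := by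
    have h3 : ∀ k ∈ Finset.range n, (k : ℝ) * (c ^ 2 / 4) ≤ ∑ j ∈ Finset.range k,
        ((w - b) ^ 2 * (((‖z k - z j‖ ^ 2 : ℝ) : ℂ) / ((w - z j) * (w - z k)))).re := fun k _ => by
      refine le_trans ?_ (Finset.sum_le_sum fun j _ => hterm j k)
      rw [← Finset.mul_sum]
      linarith [hz k]
    refine le_trans ?_ (Finset.sum_le_sum h3)
    rw [← Finset.sum_mul]
    have := mul_le_mul_of_nonneg_right (sq_div_four_le_sum_range hn)
      (show 0 ≤ c ^ 2 / 4 by positivity)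
    linarith
  rw [inv_mul_eq_div, le_div_iff₀ (by positivity)]
  linarith

theorem exists_sq_integrable_of_not_chebyshevNull {K : Set ℂ} {b : ℂ} {ρ : ℝ} (hK : IsCompact K)
    (hne : K.Nonempty) (hρ : 0 < ρ) (hρ2 : ρ ≤ 1 / 2) (hKb : K ⊆ closedBall b ρ)
    (hnn : ¬ ChebyshevNull K) :
    ∃ f : ℂ → ℂ, DifferentiableOn ℂ f Kᶜ ∧ IntegrableOn (fun w => ‖f w‖ ^ 2) Kᶜ ∧
      (∀ w, 1 ≤ ‖w - b‖ → ‖f w‖ ≤ 4 / ‖w - b‖ ^ 2) ∧ ∀ w, 5 * ρ ≤ ‖w - b‖ → 1 ≤ ‖w - b‖ → f w ≠ 0 := by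
  obtain ⟨c, hc, z, hzK, hinj, hz⟩ := exists_leja_sequence hne hnn
  have hzW : ∀ j, z j ∉ Kᶜ := fun j h => h (hzK j)
  have hzb : ∀ j, ‖z j - b‖ ≤ ρ := fun j => by
    rw [← dist_eq_norm]
    exact hKb (hzK j)
  have hzb2 : ∀ j, ‖z j - b‖ ≤ 1 / 2 := fun j => (hzb j).trans hρ2
  have hz1 := norm_sub_le_one hzb2
  have hdist : ∀ w j, infDist w K ≤ ‖w - z j‖ := fun w j => by
    rw [← dist_eq_norm]
    exact infDist_le_dist_of_mem (hzK j)
  have hpos : ∀ w ∈ Kᶜ, 0 < infDist w K := fun w hw =>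
    (hK.isClosed.notMem_iff_infDist_pos hne).1 hw
  obtain ⟨f, hf, hlu⟩ := exists_differentiableOn_tendsto_of_locally_bounded (hyperfilter ℕ)
    (F := pairSum z) hK.isClosed.isOpen_compl
    (fun n => differentiableOn_pairSum hzW n) (fun w hw => by
      have hd := hpos w hw
      have hb : ∀ v ∈ ball w (infDist w K / 2), infDist w K / 2 ≤ infDist v K := fun v hv => by
        have := infDist_le_infDist_add_dist (s := K) (x := w) (y := v)
        rw [mem_ball, dist_comm] at hv
        linarith
      refine ⟨infDist w K / 2, by positivity, fun v hv => ?_, ((infDist w K / 2) ^ 2)⁻¹,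
        fun n v hv => norm_pairSum_le_of_dist hz1 (by positivity)
          (fun j => (hb v hv).trans (hdist v j)) n⟩
      exact (hK.isClosed.notMem_iff_infDist_pos hne).2 (lt_of_lt_of_le (by positivity) (hb v hv)))
  have hlarge : ∀ N : ℕ, ∀ᶠ n in (hyperfilter ℕ : Filter ℕ), N ≤ n := fun N =>
    Nat.hyperfilter_le_atTop (eventually_ge_atTop N)
  have hfar : ∀ w, 1 ≤ ‖w - b‖ → w ∈ Kᶜ := fun w hw hwK => by
    have := hKb hwK
    rw [mem_closedBall, dist_eq_norm] at this
    linarith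
  have hdecay : ∀ w, 1 ≤ ‖w - b‖ → ‖f w‖ ≤ 4 / ‖w - b‖ ^ 2 := fun w hw => by
    refine le_of_tendsto (hlu.tendsto_at (hfar w hw)).norm (Eventually.of_forall fun n => ?_)
    have := norm_pairSum_le_of_dist hz1 (d := ‖w - b‖ / 2) (by linarith) (w := w) (fun j => by
      have := norm_sub_norm_le (w - b) (z j - b)
      rw [sub_sub_sub_cancel_right] at this
      linarith [hzb2 j]) n
    refine this.trans_eq ?_
    rw [div_pow, inv_div]
    norm_num
  refine ⟨f, hf, ?_, hdecay, fun w hw hw1 h0 => ?_⟩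
  swap
  · have h1 : Tendsto (fun n => ((w - b) ^ 2 * pairSum z n w).re) (hyperfilter ℕ)
        (nhds ((w - b) ^ 2 * f w).re) :=
      (Complex.continuous_re.tendsto _).comp ((hlu.tendsto_at (hfar w hw1)).const_mul _)
    have h2 := ge_of_tendsto h1 ((hlarge 2).mono fun n hn => le_re_sq_mul_pairSum hρ hzb
      (fun k => mul_sq_le_sum_sq_of_pow_le_prod hc (fun j hj => norm_pos_iff.2 (sub_ne_zero.2
        fun h => (Finset.mem_range.1 hj).ne (hinj h).symm)) (hz k)) hw hn)
    rw [h0, mul_zero, Complex.zero_re] at h2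
    have : 0 < c ^ 2 / 16 := by positivity
    linarith
  set S := closedBall b 1 \ K with hS
  have hin : IntegrableOn (fun w => ‖f w‖ ^ 2) S := by
    set L : ℕ → Set ℂ := fun m => closedBall b 1 ∩ {w | ((m : ℝ) + 1)⁻¹ ≤ infDist w K} with hL
    have hLK : ∀ m, L m ⊆ Kᶜ := fun m w hw => by
      refine (hK.isClosed.notMem_iff_infDist_pos hne).2 (lt_of_lt_of_le ?_ hw.2)
      positivity
    have hLS : ∀ m, L m ⊆ S := fun m w hw => ⟨hw.1, hLK m hw⟩
    have hLc : ∀ m, IsCompact (L m) := fun m => (isCompact_closedBall b 1).inter_right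
      (isClosed_le continuous_const (continuous_infDist_pt K))
    have hfi : ∀ m, IntegrableOn (fun w => ‖f w‖ ^ 2) (L m) := fun m =>
      ((hf.continuousOn.mono (hLK m)).norm.pow 2).integrableOn_compact (hLc m)
    have hcover : AECover (volume.restrict S) atTop L := by
      refine ⟨?_, fun m => (hLc m).measurableSet⟩
      filter_upwards [ae_restrict_mem (measurableSet_closedBall.diff hK.measurableSet)] with w hw
      have h1 := hpos w hw.2
      obtain ⟨N, hN⟩ := exists_nat_gt (infDist w K)⁻¹
      filter_upwards [eventually_ge_atTop N] with m hm
      refine ⟨hw.1, ?_⟩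
      have : (N : ℝ) ≤ m := by exact_mod_cast hm
      exact inv_le_of_inv_le₀ h1 (by linarith)
    refine hcover.integrable_of_integral_norm_bounded
      (2 * (1 + 24 * Real.pi * (Real.log 3 - Real.log c)) + 2 * volume.real (closedBall b 1))
      (fun m => ?_) (Eventually.of_forall fun m => ?_)
    · rw [IntegrableOn, Measure.restrict_restrict_of_subset (hLS m)]
      exact hfi m
    rw [Measure.restrict_restrict_of_subset (hLS m)]
    have hd : (0 : ℝ) < ((m : ℝ) + 1)⁻¹ := by positivity
    set d := ((m : ℝ) + 1)⁻¹ with hddef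
    have hunif := (tendstoLocallyUniformlyOn_iff_forall_isCompact hK.isClosed.isOpen_compl).1 hlu
      (L m) (hLK m) (hLc m)
    obtain ⟨N, hN⟩ := exists_nat_gt (volume.real (L m) / d ^ 2)
    obtain ⟨n, hn1, hn2, hn3⟩ := ((Metric.tendstoUniformlyOn_iff.1 hunif 1 one_pos).and
      ((hlarge N).and (hlarge 1))).exists
    have hn0 : (0 : ℝ) < n := by exact_mod_cast hn3
    have hfin : IntegrableOn (fun w => ‖pairSum z n w‖ ^ 2) (L m) :=
      ((((differentiableOn_pairSum hzW n).continuousOn.mono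
        (hLK m)).norm).pow 2).integrableOn_compact (hLc m)
    have hpt : ∀ w ∈ L m, ‖‖f w‖ ^ 2‖ ≤ 2 * ‖pairSum z n w‖ ^ 2 + 2 := fun w hw => by
      have h1 := hn1 w hw
      rw [dist_eq_norm] at h1
      have h2 := norm_sub_norm_le (f w) (pairSum z n w)
      rw [Real.norm_of_nonneg (by positivity)]
      have h3 : ‖f w‖ ≤ ‖pairSum z n w‖ + 1 := by linarith
      have h4 := pow_le_pow_left₀ (norm_nonneg _) h3 2
      nlinarith [sq_nonneg (‖pairSum z n w‖ - 1)]
    have hconst : IntegrableOn (fun _ : ℂ => (2 : ℝ)) (L m) :=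
      integrableOn_const (hLc m).measure_lt_top.ne
    have h2fin : IntegrableOn (fun w => 2 * ‖pairSum z n w‖ ^ 2) (L m) := hfin.const_mul 2
    have hmono := setIntegral_mono_on (hfi m).norm (h2fin.add hconst) (hLc m).measurableSet hpt
    refine hmono.trans ?_
    rw [integral_add' h2fin hconst, integral_const_mul, setIntegral_const, smul_eq_mul]
    have hb := setIntegral_norm_pairSum_sq_le hc hzb2 hinj hz (hLc m) inter_subset_left hd
      (fun w hw j => hw.2.trans (hdist w j)) hn3
    have hvol : volume.real (L m) ≤ volume.real (closedBall b 1) :=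
      measureReal_mono inter_subset_left measure_closedBall_lt_top.ne
    have hone : volume.real (L m) / (n * d ^ 2) ≤ 1 := by
      rw [mul_comm, ← div_div, div_le_one hn0]
      exact hN.le.trans (by exact_mod_cast hn2)
    linarith
  have hout : IntegrableOn (fun w => ‖f w‖ ^ 2) (closedBall b 1)ᶜ := by
    have hsub : (closedBall b 1)ᶜ ⊆ Kᶜ :=
      compl_subset_compl.2 (hKb.trans (closedBall_subset_closedBall (by linarith)))
    have hg : Integrable fun w : ℂ => 256 * (1 + ‖w - b‖) ^ (-(4 : ℝ)) :=
      ((integrable_one_add_norm (E := ℂ) (μ := volume) (r := 4)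
        (by rw [Complex.finrank_real_complex]; norm_num)).comp_sub_right b).const_mul 256
    refine hg.integrableOn.mono' (((hf.continuousOn.mono hsub).norm.pow 2).aestronglyMeasurable
      measurableSet_closedBall.compl) ?_
    filter_upwards [ae_restrict_mem measurableSet_closedBall.compl] with w hw
    have hw1 : 1 ≤ ‖w - b‖ := by
      rw [mem_compl_iff, mem_closedBall, dist_eq_norm, not_le] at hw
      exact hw.le
    rw [Real.norm_of_nonneg (by positivity)]
    have h1 := pow_le_pow_left₀ (norm_nonneg _) (hdecay w hw1) 2
    refine h1.trans ?_
    have hp : (0 : ℝ) < 1 + ‖w - b‖ := by positivity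
    have h0 : 0 < ‖w - b‖ := by linarith
    rw [Real.rpow_neg hp.le, show (4 : ℝ) = ((4 : ℕ) : ℝ) by norm_num, Real.rpow_natCast,
      ← div_eq_mul_inv, div_pow, ← pow_mul, div_le_div_iff₀ (by positivity) (by positivity)]
    have h2 := pow_le_pow_left₀ hp.le (show 1 + ‖w - b‖ ≤ 2 * ‖w - b‖ by linarith) 4
    rw [mul_pow] at h2
    norm_num at h2 ⊢
    linarith
  refine (hin.union hout).mono_set fun w hw => ?_
  by_cases h : w ∈ closedBall b 1
  · exact Or.inl ⟨h, hw⟩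
  · exact Or.inr h

theorem isPreconnected_annulus (b : ℂ) {ρ R : ℝ} (hρ : 0 < ρ) (hR : 0 < R) :
    IsPreconnected {w : ℂ | ρ < ‖w - b‖ ∧ ‖w - b‖ < R} := by
  have hconv : Convex ℝ {w : ℂ | Real.log ρ < w.re ∧ w.re < Real.log R} :=
    (convex_halfSpace_re_gt _).inter (convex_halfSpace_re_lt _)
  have himg : {w : ℂ | ρ < ‖w - b‖ ∧ ‖w - b‖ < R} =
      (fun w => b + Complex.exp w) '' {w : ℂ | Real.log ρ < w.re ∧ w.re < Real.log R} := by
    ext w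
    constructor
    · rintro ⟨h1, h2⟩
      have h0 : 0 < ‖w - b‖ := hρ.trans h1
      refine ⟨Complex.log (w - b), ⟨?_, ?_⟩, ?_⟩
      · rw [Complex.log_re]
        exact Real.log_lt_log hρ h1
      · rw [Complex.log_re]
        exact Real.log_lt_log h0 h2
      · simp only
        rw [Complex.exp_log (norm_pos_iff.1 h0)]
        ring
    · rintro ⟨v, ⟨h1, h2⟩, rfl⟩
      rw [mem_ofPred_eq, add_sub_cancel_left, Complex.norm_exp]
      exact ⟨(Real.log_lt_iff_lt_exp hρ).1 h1, (Real.lt_log_iff_exp_lt hR).1 h2⟩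
  rw [himg]
  exact hconv.isPreconnected.image _ (by fun_prop)

theorem ChebyshevNull.not_closedBall_subset {K : Set ℂ} (hK : ChebyshevNull K) {p : ℂ} {s : ℝ}
    (hs : 0 < s) : ¬ closedBall p s ⊆ K := fun hsub => by
  obtain ⟨S, hS, -, hle⟩ := hK (s / 2) (by positivity)
  set q : ℂ → ℂ := fun ξ => ∏ w ∈ S, (1 - (w - p) * ξ) with hq
  have hqd : Differentiable ℂ q := by
    refine Differentiable.fun_finsetProd fun w _ => ?_
    fun_prop
  have hbd : ∀ ξ ∈ frontier (ball (0 : ℂ) s⁻¹), ‖q ξ‖ ≤ (1 / 2) ^ S.card := fun ξ hξ => by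
    rw [frontier_ball _ (by positivity), mem_sphere_zero_iff_norm] at hξ
    have hξ0 : ξ ≠ 0 := norm_pos_iff.1 (by rw [hξ]; positivity)
    have h1 := hle (p + ξ⁻¹) (hsub (by
      rw [mem_closedBall, dist_eq_norm, add_sub_cancel_left, norm_inv, hξ, inv_inv]))
    have h2 : ‖q ξ‖ = s⁻¹ ^ S.card * ∏ w ∈ S, ‖p + ξ⁻¹ - w‖ := by
      rw [hq, norm_prod, ← Finset.prod_const, ← Finset.prod_mul_distrib]
      refine Finset.prod_congr rfl fun w _ => ?_
      rw [← hξ, ← norm_mul]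
      congr 1
      field_simp
      ring
    rw [h2]
    calc s⁻¹ ^ S.card * ∏ w ∈ S, ‖p + ξ⁻¹ - w‖ ≤ s⁻¹ ^ S.card * (s / 2) ^ S.card := by gcongr
      _ = (1 / 2) ^ S.card := by rw [← mul_pow]; congr 1; field_simp
  have h0 := Complex.norm_le_of_forall_mem_frontier_norm_le isBounded_ball hqd.diffContOnCl hbd
    (subset_closure (mem_ball_self (by positivity : 0 < s⁻¹)))
  have h1 : q 0 = 1 := by simp [hq]
  rw [h1, norm_one] at h0
  have : (1 / 2 : ℝ) ^ S.card < 1 := pow_lt_one₀ (by norm_num) (by norm_num) hS.card_ne_zero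
  linarith

theorem exists_chebyshevNull_of_extension {D U : Set ℂ} (hD : IsOpen D) (hDc : IsConnected D)
    (hU : IsOpen U)
    (hext : ∀ f ∈ L2h D, ∃ F : ℂ → ℂ, DifferentiableOn ℂ F (D ∪ U) ∧ EqOn F f D) {b : ℂ}
    (hbU : b ∈ U) (hbD : b ∉ D) (hbcl : b ∈ closure D) :
    ∃ ρ : ℝ, 0 < ρ ∧ closedBall b ρ ⊆ U ∧ ChebyshevNull (closedBall b ρ \ D) := by
  obtain ⟨R₁, hR₁, hRU⟩ := Metric.isOpen_iff.1 hU b hbU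
  obtain ⟨p, hp⟩ := hDc.nonempty
  have hpb : 0 < dist p b := dist_pos.2 fun h => hbD (h ▸ hp)
  set R := min R₁ (dist p b) with hR
  have hR0 : 0 < R := lt_min hR₁ hpb
  have hRU' : ball b R ⊆ U := (ball_subset_ball (min_le_left _ _)).trans hRU
  set ρ := min (R / 2) (1 / 2) with hρdef
  have hρ : 0 < ρ := by positivity
  have hρR : ρ < R := (min_le_left _ _).trans_lt (by linarith)
  refine ⟨ρ, hρ, (closedBall_subset_ball hρR).trans hRU', ?_⟩
  by_contra hnn
  obtain ⟨f, hf, hf2, hdec, hf0⟩ := exists_sq_integrable_of_not_chebyshevNull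
    ((isCompact_closedBall b ρ).diff hD) ⟨b, mem_closedBall_self hρ.le, hbD⟩ hρ (min_le_right _ _)
    sdiff_subset hnn
  have hDK : D ⊆ (closedBall b ρ \ D)ᶜ := fun w hw h => h.2 hw
  obtain ⟨F, hF, hFf⟩ := hext f ⟨hf.mono hDK, hf2.mono_set hDK⟩
  set A := {w : ℂ | ρ < ‖w - b‖ ∧ ‖w - b‖ < R} with hA
  have hcn : Continuous fun w : ℂ => ‖w - b‖ := by fun_prop
  have hAo : IsOpen A := (isOpen_lt continuous_const hcn).inter (isOpen_lt hcn continuous_const)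
  have hext_sub : {w : ℂ | ρ < ‖w - b‖} ⊆ (closedBall b ρ \ D)ᶜ := fun w hw h => by
    have := h.1
    rw [mem_closedBall, dist_eq_norm] at this
    exact absurd hw (not_lt.2 this)
  have hout : IsOpen {w : ℂ | ρ < ‖w - b‖} := isOpen_lt continuous_const hcn
  obtain ⟨w₀, hw₀A, hw₀D⟩ : (A ∩ D).Nonempty := by
    obtain ⟨q, hq, hqD⟩ := mem_closure_iff.1 hbcl (ball b ρ) isOpen_ball (mem_ball_self hρ)
    have hcont : ContinuousOn (fun w : ℂ => ‖w - b‖) D := hcn.continuousOn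
    have hmem : (ρ + R) / 2 ∈ Icc ‖q - b‖ ‖p - b‖ := by
      rw [mem_ball, dist_eq_norm] at hq
      have := min_le_right R₁ (dist p b)
      rw [← hR, dist_eq_norm] at this
      constructor <;> linarith
    obtain ⟨w, hwD, hw⟩ := hDc.isPreconnected.intermediate_value hqD hp hcont hmem
    refine ⟨w, ⟨?_, ?_⟩, hwD⟩ <;> simp only at hw <;> linarith
  have hAF : EqOn F f A := by
    refine AnalyticOnNhd.eqOn_of_preconnected_of_eventuallyEq
      ((hF.mono fun w hw => Or.inr (hRU' ?_)).analyticOnNhd hAo)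
      ((hf.mono fun w hw => hext_sub hw.1).analyticOnNhd hAo) (isPreconnected_annulus b hρ hR0) hw₀A ?_
    · rw [mem_ball, dist_eq_norm]
      exact hw.2
    · filter_upwards [hD.mem_nhds hw₀D] with w hw using hFf hw
  classical
  set g : ℂ → ℂ := fun w => if ‖w - b‖ < R then F w else f w with hg
  have hgf : EqOn g f {w : ℂ | ρ < ‖w - b‖} := fun w hw => by
    by_cases h : ‖w - b‖ < R
    · rw [hg]
      simp only [if_pos h]
      exact hAF ⟨hw, h⟩
    · simp only [hg, if_neg h]
  have hgF : EqOn g F (ball b R) := fun w hw => by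
    rw [mem_ball, dist_eq_norm] at hw
    simp only [hg, if_pos hw]
  have hgd : Differentiable ℂ g := fun w => by
    by_cases h : ‖w - b‖ < R
    · exact ((hF.mono fun v hv => Or.inr (hRU' hv)).congr hgF).differentiableAt
        (isOpen_ball.mem_nhds (by rwa [mem_ball, dist_eq_norm]))
    · exact ((hf.mono hext_sub).congr hgf).differentiableAt
        (hout.mem_nhds (show ρ < ‖w - b‖ by linarith))
  have hnorm : Tendsto (fun w : ℂ => ‖w - b‖) (cocompact ℂ) atTop := by
    refine tendsto_atTop_mono (fun w => norm_sub_norm_le w b) ?_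
    exact tendsto_atTop_add_const_right _ _ tendsto_norm_cocompact_atTop
  have hlim : Tendsto g (cocompact ℂ) (nhds 0) := by
    refine squeeze_zero_norm' (a := fun w => 4 / ‖w - b‖ ^ 2) ?_ ?_
    · filter_upwards [hnorm.eventually_ge_atTop 1] with w hw
      rw [hgf (show ρ < ‖w - b‖ from lt_of_le_of_lt (min_le_right _ _) (by linarith))]
      exact hdec w hw
    · exact Tendsto.div_atTop tendsto_const_nhds ((tendsto_pow_atTop two_ne_zero).comp hnorm)
  obtain ⟨w, hw⟩ := (hnorm.eventually_ge_atTop (5 * ρ + 1)).exists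
  refine hf0 w (by linarith) (by linarith) ?_
  rw [← hgf (show ρ < ‖w - b‖ by linarith)]
  exact hgd.apply_eq_of_tendsto_cocompact w hlim

theorem subset_closure_of_extension {D U : Set ℂ} (hD : IsOpen D) (hDc : IsConnected D)
    (hU : IsOpen U) (hUc : IsConnected U) {a : ℂ} (ha : a ∈ closure D) (haU : a ∈ U)
    (hext : ∀ f ∈ L2h D, ∃ F : ℂ → ℂ, DifferentiableOn ℂ F (D ∪ U) ∧ EqOn F f D) :
    U ⊆ closure D := by
  have key : closure D ∩ U ⊆ interior (closure D) := fun b hb => by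
    by_cases hbD : b ∈ D
    · exact interior_mono subset_closure (by rwa [hD.interior_eq])
    obtain ⟨ρ, hρ, -, hnull⟩ := exists_chebyshevNull_of_extension hD hDc hU hext hb.2 hbD hb.1
    refine mem_interior.2 ⟨ball b ρ, fun p hp => ?_, isOpen_ball, mem_ball_self hρ⟩
    by_contra hpc
    obtain ⟨s, hs, hsub⟩ := Metric.nhds_basis_closedBall.mem_iff.1
      ((isOpen_ball.sdiff isClosed_closure).mem_nhds ⟨hp, hpc⟩)
    exact hnull.not_closedBall_subset hs (hsub.trans fun w hw =>
      ⟨ball_subset_closedBall hw.1, fun h => hw.2 (subset_closure h)⟩)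
  refine (hUc.isPreconnected.subset_of_closure_inter_subset isOpen_interior
    ⟨a, haU, key ⟨ha, haU⟩⟩ ?_).trans interior_subset
  exact fun w hw => key ⟨closure_minimal interior_subset isClosed_closure hw.1, hw.2⟩

/-- `log V` satisfies the sub-mean value inequality on the circle of centre `c` and radius `r`,
in a form that is stable under products. -/
def LogSubmeanAt (V : ℂ → ℝ) (c : ℂ) (r : ℝ) : Prop :=
  V c ≠ 0 → ∃ h : ℂ → ℝ, CircleIntegrable h c r ∧ h c ≤ Real.circleAverage h c r ∧
    V c = Real.exp (h c) ∧ ∃ s : Set ℂ, s.Countable ∧ ∀ z ∉ s, V z = Real.exp (h z)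

theorem LogSubmeanAt.mul {V W : ℂ → ℝ} {c : ℂ} {r : ℝ} (hV : LogSubmeanAt V c r)
    (hW : LogSubmeanAt W c r) : LogSubmeanAt (fun z => V z * W z) c r := by
  intro h0
  obtain ⟨h, hi, hle, hc, s, hs, hz⟩ := hV (left_ne_zero_of_mul h0)
  obtain ⟨h', hi', hle', hc', s', hs', hz'⟩ := hW (right_ne_zero_of_mul h0)
  refine ⟨fun z => h z + h' z, hi.add hi', ?_, ?_, s ∪ s', hs.union hs', fun z hzs => ?_⟩
  · rw [Real.circleAverage_fun_add hi hi']
    exact add_le_add hle hle'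
  · simp only [Real.exp_add, hc, hc']
  · simp only [Real.exp_add]
    rw [hz z fun h => hzs (Or.inl h), hz' z fun h => hzs (Or.inr h)]

theorem logSubmeanAt_const_one (c : ℂ) (r : ℝ) : LogSubmeanAt (fun _ => 1) c r :=
  fun _ => ⟨fun _ => 0, circleIntegrable_const _ _ _, by rw [Real.circleAverage_const], by simp, ∅,
    countable_empty, by simp⟩

theorem LogSubmeanAt.finset_prod {ι : Type*} {V : ι → ℂ → ℝ} {c : ℂ} {r : ℝ} (S : Finset ι)
    (hV : ∀ i ∈ S, LogSubmeanAt (V i) c r) : LogSubmeanAt (fun z => ∏ i ∈ S, V i z) c r := by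
  classical
  induction S using Finset.induction_on with
  | empty => simpa using logSubmeanAt_const_one c r
  | insert i S hi ih =>
    simp only [Finset.prod_insert hi]
    exact (hV i (Finset.mem_insert_self i S)).mul
      (ih fun j hj => hV j (Finset.mem_insert_of_mem hj))

theorem norm_le_circleAverage_norm (c : ℂ) (r : ℝ) :
    ‖c‖ ≤ Real.circleAverage (fun z : ℂ => ‖z‖) c r := by
  have h : Real.circleAverage (fun z : ℂ => z) c r = c :=
    circleAverage_of_differentiable_on_off_countable countable_empty continuous_id.continuousOn
      fun z _ => differentiableAt_id
  conv_lhs => rw [← h]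
  rw [Real.circleAverage_def, Real.circleAverage_def, norm_smul, smul_eq_mul,
    Real.norm_of_nonneg (by positivity)]
  exact mul_le_mul_of_nonneg_left
    (intervalIntegral.norm_integral_le_integral_norm (by positivity)) (by positivity)

theorem logSubmeanAt_exp_norm {A : ℝ} (hA : 0 ≤ A) (B : ℝ) (c : ℂ) (r : ℝ) :
    LogSubmeanAt (fun z => Real.exp (A * ‖z‖ + B)) c r := by
  have hci : ∀ f : ℂ → ℝ, Continuous f → CircleIntegrable f c r := fun f hf =>
    hf.continuousOn.circleIntegrable'
  refine fun _ => ⟨fun z => A * ‖z‖ + B, hci _ (by fun_prop), ?_, rfl, ∅, countable_empty,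
    fun _ _ => rfl⟩
  have h1 : CircleIntegrable (fun z : ℂ => A • ‖z‖) c r := hci _ (by fun_prop)
  have := Real.circleAverage_fun_add h1 (circleIntegrable_const B c r)
  simp only [smul_eq_mul] at this
  rw [this, Real.circleAverage_const]
  have h2 := Real.circleAverage_fun_smul (a := A) (f := fun z : ℂ => ‖z‖) (c := c) (R := r)
  simp only [smul_eq_mul] at h2
  rw [h2]
  exact add_le_add (mul_le_mul_of_nonneg_left (norm_le_circleAverage_norm c r) hA) le_rfl

theorem logSubmeanAt_norm_sub_rpow (w : ℂ) {α : ℝ} (hα : 0 < α) (c : ℂ) {r : ℝ} (hr : 0 < r) :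
    LogSubmeanAt (fun z => ‖z - w‖ ^ α) c r := by
  intro h0
  have hcw : 0 < ‖c - w‖ := by
    refine (norm_nonneg _).lt_of_ne fun h => h0 ?_
    simp only
    rw [← h, Real.zero_rpow hα.ne']
  have hi := circleIntegrable_log_norm_sub_const (a := w) (c := c) r
  refine ⟨fun z => α • Real.log ‖z - w‖, hi.const_smul, ?_, ?_, {w}, countable_singleton w,
    fun z hz => ?_⟩
  · rw [Real.circleAverage_fun_smul,
      circleAverage_log_norm_sub_const_eq_log_radius_add_posLog hr.ne']
    refine smul_le_smul_of_nonneg_left ?_ hα.le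
    have : Real.log (r⁻¹ * ‖c - w‖) ≤ Real.posLog (r⁻¹ * ‖c - w‖) := le_max_right _ _
    rw [Real.log_mul (by positivity) hcw.ne', Real.log_inv] at this
    linarith
  · simp only [smul_eq_mul]
    rw [Real.rpow_def_of_pos hcw, mul_comm]
  · have hzw : 0 < ‖z - w‖ := norm_pos_iff.2 (sub_ne_zero.2 hz)
    simp only [smul_eq_mul]
    rw [Real.rpow_def_of_pos hzw, mul_comm]

theorem LogSubmeanAt.le_exp_average {V : ℂ → ℝ} {c : ℂ} {r : ℝ} (hV : LogSubmeanAt V c r)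
    (hr : 0 < r) {ψ : ℝ → ℝ} (hψ : Continuous ψ)
    (hle : ∀ θ ∈ Icc 0 (2 * Real.pi), V (circleMap c r θ) ≤ Real.exp (ψ θ)) :
    V c ≤ Real.exp ((2 * Real.pi)⁻¹ * ∫ θ in (0:ℝ)..(2 * Real.pi), ψ θ) := by
  by_cases h0 : V c = 0
  · rw [h0]
    positivity
  obtain ⟨h, hi, hav, hc, s, hs, hz⟩ := hV h0
  rw [hc, Real.exp_le_exp]
  refine hav.trans ?_
  rw [Real.circleAverage_def, smul_eq_mul]
  refine mul_le_mul_of_nonneg_left ?_ (by positivity)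
  refine intervalIntegral.integral_mono_ae_restrict (by positivity) hi (hψ.intervalIntegrable _ _) ?_
  have hnull : volume (circleMap c r ⁻¹' s) = 0 := (hs.preimage_circleMap c hr.ne').measure_zero _
  filter_upwards [ae_restrict_of_ae (measure_eq_zero_iff_ae_notMem.1 hnull),
    ae_restrict_mem measurableSet_Icc] with θ hθ hmem
  rw [← Real.exp_le_exp, ← hz _ hθ]
  exact hle θ hmem

theorem elog_lt_coe_iff {x t : ℝ} : elog x < (t : EReal) ↔ x < Real.exp t := by
  unfold elog
  split_ifs with h
  · exact iff_of_true (EReal.bot_lt_coe t) (h.trans_lt (Real.exp_pos t))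
  · rw [EReal.coe_lt_coe_iff, Real.log_lt_iff_lt_exp (not_le.1 h)]

theorem elog_le_coe_iff {x t : ℝ} : elog x ≤ (t : EReal) ↔ x ≤ Real.exp t := by
  unfold elog
  split_ifs with h
  · exact iff_of_true bot_le (h.trans (Real.exp_pos t).le)
  · rw [EReal.coe_le_coe_iff, Real.log_le_iff_le_exp (not_le.1 h)]

theorem elog_ne_top (x : ℝ) : elog x ≠ ⊤ := by
  unfold elog
  split_ifs
  · exact bot_ne_top
  · exact EReal.coe_ne_top _

/-- A decreasing sequence of continuous functions lying eventually below a continuous function at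
every point of a compact set lies eventually below it uniformly. -/
theorem exists_forall_lt_of_antitone {X : Type*} [TopologicalSpace X] {s : Set X} (hs : IsCompact s)
    {f : ℕ → X → ℝ} {g : X → ℝ} (hf : ∀ n, Continuous (f n)) (hg : Continuous g)
    (hanti : ∀ x, Antitone fun n => f n x) (h : ∀ x ∈ s, ∃ n, f n x < g x) :
    ∃ n, ∀ x ∈ s, f n x < g x := by
  obtain ⟨n, hn⟩ := hs.elim_directed_cover (fun n => {x | f n x < g x})
    (fun n => isOpen_lt (hf n) hg) (fun x hx => mem_iUnion.2 (h x hx))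
    (directed_of_isDirected_le fun m n hmn x (hx : f m x < g x) => (hanti x hmn).trans_lt hx)
  exact ⟨n, fun x hx => hn hx⟩

theorem subharmonicOn_elog_iInf {V : ℕ → ℂ → ℝ} (hanti : ∀ z, Antitone fun n => V n z)
    (hpos : ∀ n z, 0 ≤ V n z) (hcont : ∀ n, Continuous (V n))
    (hsub : ∀ n c r, 0 < r → LogSubmeanAt (V n) c r) {z₀ : ℂ} (h0 : 0 < ⨅ n, V n z₀) :
    SubharmonicOn (fun z => elog (⨅ n, V n z)) univ := by
  have hbdd : ∀ z, BddBelow (range fun n => V n z) := fun z =>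
    ⟨0, by rintro _ ⟨n, rfl⟩; exact hpos n z⟩
  refine ⟨isOpen_univ, fun z _ y hy => ?_, fun z _ => elog_ne_top _, fun z _ => ⟨z₀, ?_, ?_⟩, ?_⟩
  · obtain ⟨t, ht, hty⟩ := EReal.lt_iff_exists_real_btwn.1 hy
    obtain ⟨n, hn⟩ := exists_lt_of_ciInf_lt (elog_lt_coe_iff.1 ht)
    rw [nhdsWithin_univ]
    filter_upwards [(hcont n).continuousAt.eventually_lt continuousAt_const hn] with w hw
    exact (elog_lt_coe_iff.2 ((ciInf_le (hbdd w) n).trans_lt hw)).trans hty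
  · rw [connectedComponentIn_univ, PreconnectedSpace.connectedComponent_eq_univ]
    trivial
  · simp only [elog, if_neg (not_le.2 h0)]
    exact EReal.coe_ne_bot _
  · intro c r hr _ φ hφ hle
    rw [elog_le_coe_iff]
    have hδ : ∀ δ : ℝ, 0 < δ → (⨅ n, V n c) ≤
        Real.exp ((2 * Real.pi)⁻¹ * (∫ θ in (0:ℝ)..(2 * Real.pi), φ θ) + δ) := by
      intro δ hδ
      have hex : ∀ θ ∈ Icc 0 (2 * Real.pi), ∃ n, V n (circleMap c r θ) < Real.exp (φ θ + δ) :=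
        fun θ _ => exists_lt_of_ciInf_lt ((elog_le_coe_iff.1 (hle θ)).trans_lt
          (Real.exp_lt_exp.2 (by linarith)))
      obtain ⟨n, hn⟩ := exists_forall_lt_of_antitone isCompact_Icc
        (f := fun n θ => V n (circleMap c r θ)) (fun n => (hcont n).comp (continuous_circleMap c r))
        (by fun_prop) (fun θ => hanti _) hex
      refine ((ciInf_le (hbdd c) n).trans ((hsub n c r hr).le_exp_average (ψ := fun θ => φ θ + δ) hr
        (hφ.add continuous_const) fun θ hθ => (hn θ hθ).le)).trans_eq ?_
      rw [intervalIntegral.integral_add (hφ.intervalIntegrable _ _)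
        (continuous_const.intervalIntegrable _ _), intervalIntegral.integral_const]
      congr 1
      rw [smul_eq_mul]
      field_simp
      ring
    have hlim : Tendsto (fun δ : ℝ => Real.exp
        ((2 * Real.pi)⁻¹ * (∫ θ in (0:ℝ)..(2 * Real.pi), φ θ) + δ)) (nhdsWithin 0 (Ioi 0))
        (nhds (Real.exp ((2 * Real.pi)⁻¹ * (∫ θ in (0:ℝ)..(2 * Real.pi), φ θ) + 0))) :=
      (Continuous.tendsto (by fun_prop) 0).mono_left nhdsWithin_le_nhds
    rw [add_zero] at hlim
    exact ge_of_tendsto hlim (eventually_mem_nhdsWithin.mono hδ)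

/-- The exponential of the potential `∑ α log ‖z - w‖`, normalised by a radial factor. -/
noncomputable def potentialFactor (S : Finset ℂ) (ε B α : ℝ) (z : ℂ) : ℝ :=
  Real.exp (-ε * ‖z‖ - B) * ∏ w ∈ S, ‖z - w‖ ^ α

theorem potentialFactor_nonneg (S : Finset ℂ) (ε B α : ℝ) (z : ℂ) :
    0 ≤ potentialFactor S ε B α z :=
  mul_nonneg (Real.exp_pos _).le (Finset.prod_nonneg fun w _ => by positivity)

theorem continuous_potentialFactor (S : Finset ℂ) (ε B : ℝ) {α : ℝ} (hα : 0 < α) :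
    Continuous (potentialFactor S ε B α) := by
  unfold potentialFactor
  refine Continuous.mul (by fun_prop) (continuous_finsetProd _ fun w _ => ?_)
  have : Continuous fun z : ℂ => ‖z - w‖ := by fun_prop
  exact this.rpow_const fun _ => Or.inr hα.le

theorem ChebyshevNull.exists_potentialFactor {K : Set ℂ} (hK : ChebyshevNull K)
    (hKc : IsCompact K) {z₀ : ℂ} (hz₀ : z₀ ∉ K) {η : ℝ} (hη : 0 < η) :
    ∃ (S : Finset ℂ) (ε B α : ℝ), 0 < α ∧ ε ≤ η ∧
      (∀ z, potentialFactor S ε B α z ≤ 1) ∧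
      (∀ z ∈ K, potentialFactor S ε B α z ≤ Real.exp (-1)) ∧
      Real.exp (-(η * (‖z₀‖ + 2))) ≤ potentialFactor S ε B α z₀ := by
  obtain ⟨r, hr0, hr⟩ : ∃ r : ℝ, 0 ≤ r ∧ ∀ w ∈ K, ‖w‖ ≤ r := by
    obtain ⟨r, hr⟩ := hKc.isBounded.exists_norm_le
    exact ⟨max r 0, le_max_right _ _, fun w hw => (hr w hw).trans (le_max_left _ _)⟩
  obtain ⟨L, hL0, hL⟩ : ∃ L : ℝ, 0 ≤ L ∧ ∀ w ∈ K, Real.exp (-L) ≤ ‖z₀ - w‖ := by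
    obtain ⟨δ, hδ, hδK⟩ := Metric.isOpen_iff.1 hKc.isClosed.isOpen_compl z₀ hz₀
    refine ⟨max 0 (-Real.log δ), le_max_left _ _, fun w hw => ?_⟩
    have h1 : δ ≤ ‖z₀ - w‖ := by
      by_contra! h
      exact hδK (by rwa [mem_ball, dist_comm, dist_eq_norm]) hw
    refine le_trans ?_ h1
    rw [← Real.le_log_iff_exp_le hδ]
    linarith [le_max_right 0 (-Real.log δ)]
  set ε : ℝ := η / (1 + r + L) with hε
  have hεpos : 0 < ε := by positivity
  have hεη : ε * (1 + r + L) = η := by rw [hε]; field_simp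
  obtain ⟨S, hSne, hSK, hS⟩ := hK (Real.exp (-1 / ε)) (Real.exp_pos _)
  have hcard : (0 : ℝ) < S.card := Nat.cast_pos.2 hSne.card_pos
  have hα : 0 < ε / S.card := by positivity
  have hαc : (S.card : ℝ) * (ε / S.card) = ε := by field_simp
  have hexp : ∀ x : ℝ, ∏ w ∈ S, (Real.exp x) ^ (ε / S.card) = Real.exp (ε * x) := fun x => by
    rw [Finset.prod_const, ← Real.exp_mul, ← Real.exp_nat_mul]
    congr 1
    rw [mul_left_comm, hαc, mul_comm]
  refine ⟨S, ε, ε * r, ε / S.card, hα, by nlinarith [mul_nonneg hεpos.le hr0, mul_nonneg hεpos.le hL0],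
    fun z => ?_, fun z hz => ?_, ?_⟩
  · have : ∏ w ∈ S, ‖z - w‖ ^ (ε / S.card) ≤ Real.exp (ε * (‖z‖ + r)) := by
      rw [← hexp]
      refine Finset.prod_le_prod (fun w _ => by positivity) fun w hw =>
        Real.rpow_le_rpow (norm_nonneg _) ?_ hα.le
      linarith [norm_sub_le z w, hr w (hSK hw), Real.add_one_le_exp (‖z‖ + r)]
    calc potentialFactor S ε (ε * r) (ε / S.card) z
        ≤ Real.exp (-ε * ‖z‖ - ε * r) * Real.exp (ε * (‖z‖ + r)) :=
          mul_le_mul_of_nonneg_left this (Real.exp_pos _).le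
      _ = 1 := by rw [← Real.exp_add, Real.exp_eq_one_iff]; ring
  · have h1 : ∏ w ∈ S, ‖z - w‖ ^ (ε / S.card) ≤ Real.exp (-1) := by
      rw [Real.finsetProd_rpow _ _ fun w _ => norm_nonneg _]
      refine (Real.rpow_le_rpow (Finset.prod_nonneg fun w _ => norm_nonneg _) (hS z hz)
        hα.le).trans_eq ?_
      rw [← Real.exp_nat_mul, ← Real.exp_mul]
      congr 1
      field_simp
    refine (mul_le_of_le_one_left (Finset.prod_nonneg fun w _ => by positivity) ?_).trans h1
    rw [Real.exp_le_one_iff]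
    nlinarith [mul_nonneg hεpos.le hr0, mul_nonneg hεpos.le (norm_nonneg z)]
  · have h1 : Real.exp (ε * (-L)) ≤ ∏ w ∈ S, ‖z₀ - w‖ ^ (ε / S.card) := by
      rw [← hexp]
      exact Finset.prod_le_prod (fun w _ => by positivity) fun w hw =>
        Real.rpow_le_rpow (Real.exp_pos _).le (hL w (hSK hw)) hα.le
    refine le_trans ?_ (mul_le_mul_of_nonneg_left h1 (Real.exp_pos _).le)
    rw [← Real.exp_add, Real.exp_le_exp, ← hεη]
    have := norm_nonneg z₀
    nlinarith [mul_nonneg hεpos.le hr0, mul_nonneg hεpos.le hL0, mul_nonneg (mul_nonneg hεpos.le hr0) this,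
      mul_nonneg (mul_nonneg hεpos.le hL0) this]

/-- A set covered by countably many compact Chebyshev-null sets that omit a common point is
polar. -/
theorem polarSet_of_subset_iUnion {E : Set ℂ} {K : ℕ → Set ℂ} (hE : E ⊆ ⋃ i, K i)
    (hKc : ∀ i, IsCompact (K i)) (hK : ∀ i, ChebyshevNull (K i)) {z₀ : ℂ} (hz₀ : ∀ i, z₀ ∉ K i) :
    PolarSet E := by
  have hdata := fun n : ℕ => (hK (Nat.unpair n).1).exists_potentialFactor (hKc _) (hz₀ _)
    (η := (1 / 2 : ℝ) ^ n) (by positivity)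
  choose S ε B α hα hε hle hleK hge using hdata
  set g : ℕ → ℂ → ℝ := fun n => potentialFactor (S n) (ε n) (B n) (α n) with hg
  have hg0 : ∀ n z, 0 ≤ g n z := fun n z => potentialFactor_nonneg _ _ _ _ z
  set V : ℕ → ℂ → ℝ := fun N z => Real.exp (2 * ‖z‖) * ∏ n ∈ Finset.range N, g n z with hV
  have hV0 : ∀ N z, 0 ≤ V N z := fun N z =>
    mul_nonneg (Real.exp_pos _).le (Finset.prod_nonneg fun n _ => hg0 n z)
  have hVsucc : ∀ N z, V (N + 1) z = V N z * g N z := fun N z => by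
    simp only [hV, Finset.prod_range_succ, mul_assoc]
  have hanti : ∀ z, Antitone fun N => V N z := fun z => antitone_nat_of_succ_le fun N => by
    rw [hVsucc]
    exact mul_le_of_le_one_right (hV0 N z) (hle N z)
  have hsum : ∀ N, ∑ n ∈ Finset.range N, (1 / 2 : ℝ) ^ n ≤ 2 := fun N => by
    have := (summable_geometric_two).sum_le_tsum (Finset.range N) fun n _ => by positivity
    rwa [tsum_geometric_two] at this
  have hsub : ∀ N c r, 0 < r → LogSubmeanAt (V N) c r := fun N c r hr => by
    have hA : 0 ≤ 2 - ∑ n ∈ Finset.range N, ε n := by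
      linarith [hsum N, Finset.sum_le_sum fun n (_ : n ∈ Finset.range N) => hε n]
    have h1 := (logSubmeanAt_exp_norm hA (-∑ n ∈ Finset.range N, B n) c r).mul
      (LogSubmeanAt.finset_prod (Finset.range N) fun n _ => LogSubmeanAt.finset_prod (S n)
        fun w _ => logSubmeanAt_norm_sub_rpow w (hα n) c hr)
    convert h1 using 2 with z
    simp only [hV, hg, potentialFactor, Finset.prod_mul_distrib, ← Real.exp_sum, ← mul_assoc,
      ← Real.exp_add]
    congr 2
    rw [Finset.sum_sub_distrib, ← Finset.sum_mul, Finset.sum_neg_distrib]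
    ring
  have hcont : ∀ N, Continuous (V N) := fun N => Continuous.mul (by fun_prop)
    (continuous_finsetProd _ fun n _ => continuous_potentialFactor _ _ _ (hα n))
  have hz : 0 < ⨅ N, V N z₀ := by
    refine lt_of_lt_of_le (Real.exp_pos (-4)) (le_ciInf fun N => ?_)
    have h1 : ∏ n ∈ Finset.range N, Real.exp (-((1 / 2 : ℝ) ^ n * (‖z₀‖ + 2))) ≤
        ∏ n ∈ Finset.range N, g n z₀ :=
      Finset.prod_le_prod (fun n _ => (Real.exp_pos _).le) fun n _ => hge n
    rw [← Real.exp_sum, Finset.sum_neg_distrib, ← Finset.sum_mul] at h1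
    refine le_trans ?_ (mul_le_mul_of_nonneg_left h1 (Real.exp_pos _).le)
    rw [← Real.exp_add, Real.exp_le_exp]
    nlinarith [hsum N, norm_nonneg z₀]
  refine ⟨univ, subset_univ _, _, subharmonicOn_elog_iInf hanti hV0 hcont hsub hz, fun z hzE => ?_⟩
  obtain ⟨i, hi⟩ := mem_iUnion.1 (hE hzE)
  have hdecay : ∀ k : ℕ, ∃ N, V N z ≤ Real.exp (2 * ‖z‖) * Real.exp (-1) ^ k := fun k => by
    induction k with
    | zero => exact ⟨0, by simp [hV]⟩
    | succ k ih =>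
      obtain ⟨N, hN⟩ := ih
      refine ⟨Nat.pair i N + 1, ?_⟩
      have hgi : g (Nat.pair i N) z ≤ Real.exp (-1) :=
        hleK _ z (by rwa [Nat.unpair_pair])
      rw [hVsucc, pow_succ, ← mul_assoc]
      exact mul_le_mul ((hanti z (Nat.right_le_pair i N)).trans hN) hgi (hg0 _ z) (by positivity)
  have hlim : Tendsto (fun k : ℕ => Real.exp (2 * ‖z‖) * Real.exp (-1) ^ k) atTop (nhds 0) := by
    rw [← mul_zero (Real.exp (2 * ‖z‖))]
    exact (tendsto_pow_atTop_nhds_zero_of_lt_one (Real.exp_pos _).le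
      (Real.exp_lt_one_iff.2 (by norm_num))).const_mul _
  refine if_pos (ge_of_tendsto' hlim fun k => ?_)
  obtain ⟨N, hN⟩ := hdecay k
  exact (ciInf_le ⟨0, by rintro _ ⟨n, rfl⟩; exact hV0 n z⟩ N).trans hN

/-- If every square-integrable holomorphic function on `D` extends to `D ∪ U`, then `U \ D` is
polar. -/
theorem polarSet_sdiff_of_extension {D U : Set ℂ} (hD : IsOpen D) (hDc : IsConnected D)
    (hU : IsOpen U) (hUc : IsConnected U) {a : ℂ} (ha : a ∈ frontier D) (haU : a ∈ U)
    (hext : ∀ f ∈ L2h D, ∃ F : ℂ → ℂ, DifferentiableOn ℂ F (D ∪ U) ∧ EqOn F f D) :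
    PolarSet (U \ D) := by
  have hcl := subset_closure_of_extension hD hDc hU hUc ha.1 haU hext
  have haD : a ∈ U \ D := ⟨haU, fun h => ha.2 (by rwa [hD.interior_eq])⟩
  obtain ⟨z₀, hz₀⟩ := hDc.nonempty
  have hloc := fun b (hb : b ∈ U \ D) =>
    exists_chebyshevNull_of_extension hD hDc hU hext hb.1 hb.2 (hcl hb.1)
  choose! ρ hρ _ hnull using hloc
  obtain ⟨t, htU, htc, hcov⟩ := TopologicalSpace.countable_cover_nhdsWithin
    (f := fun b => closedBall b (ρ b)) (s := U \ D)
    fun b hb => mem_nhdsWithin_of_mem_nhds (closedBall_mem_nhds b (hρ b hb))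
  have htne : t.Nonempty := by
    obtain ⟨b, hb, -⟩ := mem_iUnion₂.1 (hcov haD)
    exact ⟨b, hb⟩
  obtain ⟨b, rfl⟩ := htc.exists_eq_range htne
  have hb : ∀ i, b i ∈ U \ D := fun i => htU (mem_range_self i)
  refine polarSet_of_subset_iUnion (K := fun i => closedBall (b i) (ρ (b i)) \ D) ?_
    (fun i => (isCompact_closedBall _ _).diff hD) (fun i => hnull _ (hb i)) (z₀ := z₀)
    fun i h => h.2 hz₀
  intro w hw
  obtain ⟨_, ⟨i, rfl⟩, hi⟩ := mem_iUnion₂.1 (hcov hw)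
  exact mem_iUnion.2 ⟨i, hi, hw.2⟩

/-- For a boundary point `a` of a domain `D ⊆ ℂ` and a connected open
neighborhood `U` of `a`, every `f ∈ L²ₕ(D)` extends holomorphically to `D ∪ U` iff
`U \ D` is polar. -/
theorem planar_L2h_extension_iff_polar (D : Set ℂ) (hDopen : IsOpen D) (hDconn : IsConnected D)
    (a : ℂ) (ha : a ∈ frontier D) (U : Set ℂ) (hUopen : IsOpen U) (hUconn : IsConnected U)
    (haU : a ∈ U) :
    (∀ f ∈ L2h D, ∃ F : ℂ → ℂ, DifferentiableOn ℂ F (D ∪ U) ∧ Set.EqOn F f D) ↔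
      PolarSet (U \ D) := by
  exact ⟨polarSet_sdiff_of_extension hDopen hDconn hUopen hUconn ha haU,
    fun h f hf => exists_extension_of_polarSet hDopen hUopen h hf⟩
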